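/- Let ψ: ℕ → [0,1/2] be a function satisfying ∑_{n=1}^∞ ψ(n)φ(n)/n = ∞. Write S(N,α) for the number of pairs of integers (a,n) with 1 ≤ n ≤ N, gcd(a,n) = 1 and |α − a/n| ≤ ψ(n)/n, and let Ψ(N) := ∑_{n=1}^N 2φ(n)ψ(n)/n. Then for all ε > 0 and Lebesgue-almost every α ∈ [0,1], S(N,α) = Ψ(N)(1 + O_{ε,α}(exp(−(log Ψ(N))^{1/2−ε}))) as N → ∞. -/

import Mathlib

open MeasureTheory Filter

/-- The number of coprime integer solutions `(a, n)` of `|α - a/n| ≤ ψ(n)/n`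
with `1 ≤ n ≤ N`. -/
noncomputable def S (ψ : ℕ → ℝ) (N : ℕ) (α : ℝ) : ℕ :=
  Set.ncard {p : ℤ × ℕ | 1 ≤ p.2 ∧ p.2 ≤ N ∧ Int.gcd p.1 (p.2 : ℤ) = 1 ∧
    |α - (p.1 : ℝ) / (p.2 : ℝ)| ≤ ψ p.2 / p.2}

/-- `Ψ(N) = ∑_{n=1}^N 2 φ(n) ψ(n) / n`. -/
noncomputable def Psi (ψ : ℕ → ℝ) (N : ℕ) : ℝ :=
  ∑ n ∈ Finset.Icc 1 N, 2 * (Nat.totient n : ℝ) * ψ n / n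

section
open Finset (range sum_range_succ mem_range mem_union mem_image sum_le_sum_of_subset_of_nonneg sum_nonneg sum_congr sum_image mul_sum ne_of_mem_erase add_sum_erase single_le_sum sum_eq_zero sum_div sum_le_sum sum_add_distrib sum_comm sum_mul exists_max_image prod_nonneg mem_filter mem_insert prod_insert prod_pos Icc mem_product mem_Icc mem_of_mem_erase sum_filter sum_mul_sum prod_mul_distrib prod_congr sum_nonpos sum_subset mem_insert_self mem_insert_of_mem sum_const sum_sub_distrib mem_powerset filter_subset prod_add prod_pow)
open Real (sqrt_eq_rpow sqrt_le_left mul_rpow rpow_natCast rpow_mul rpow_le_rpow exp one_le_exp exp_le_exp rpow_neg rpow_one rpow_add mul_self_sqrt exp_pos rpow_nonneg div_rpow log exp_mul exp_neg add_one_le_exp exp_add exp_nat_mul exp_one_lt_d9 exp_le_one_iff exp_one_gt_d9 tendsto_log_atTop exp_log log_le_log)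

noncomputable def Mk (H q : ℝ) (i j : ℕ) : ℝ := if i = j then 1 else H * q ^ ((i - j) + (j - i))

lemma geo_le (q : ℝ) (h0 : 0 ≤ q) (h1 : q ≤ 1/2) (m : ℕ) :
    ∑ d ∈ range m, q ^ (d+1) ≤ 2 * q := by
  have : ∀ m : ℕ, ∑ d ∈ range m, q ^ (d+1) ≤ 2 * q - 2 * q ^ (m+1) := by
    intro m
    induction m with
    | zero => simp
    | succ m ih =>
      rw [sum_range_succ]
      have hq : 0 ≤ q ^ (m+1) := by positivity
      have e : q ^ (m+1+1) = q ^ (m+1) * q := pow_succ _ _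
      rw [e]
      nlinarith
  refine (this m).trans ?_
  have hq : 0 ≤ q ^ (m+1) := by positivity
  linarith

lemma row_le (q : ℝ) (h0 : 0 ≤ q) (h1 : q ≤ 1/2) (S : Finset ℕ) (i : ℕ) :
    ∑ j ∈ S.erase i, q ^ ((i - j) + (j - i)) ≤ 4 * q := by
  obtain ⟨n, hn⟩ : ∃ n, S ⊆ range n :=
    ⟨S.sup id + 1, fun x hx => mem_range.2 (Nat.lt_succ_of_le (Finset.le_sup (f := id) hx))⟩
  have hsub : S.erase i ⊆ range i ∪ (range n).image (fun d => i + (d + 1)) := by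
    intro j hj
    rw [Finset.mem_erase] at hj
    have := mem_range.1 (hn hj.2)
    simp only [mem_union, mem_range, mem_image]
    rcases lt_or_gt_of_ne hj.1 with h | h
    · exact Or.inl h
    · exact Or.inr ⟨j - i - 1, by omega, by omega⟩
  calc _ ≤ ∑ j ∈ range i ∪ (range n).image (fun d => i + (d + 1)), q ^ ((i - j) + (j - i)) :=
        sum_le_sum_of_subset_of_nonneg hsub (fun _ _ _ => by positivity)
    _ ≤ ∑ j ∈ range i, q ^ ((i - j) + (j - i)) + ∑ j ∈ (range n).image (fun d => i + (d + 1)), q ^ ((i - j) + (j - i)) := by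
        rw [← Finset.sum_union_inter]
        have : 0 ≤ ∑ j ∈ range i ∩ (range n).image (fun d => i + (d + 1)), q ^ ((i - j) + (j - i)) :=
          sum_nonneg (fun _ _ => by positivity)
        linarith
    _ = ∑ d ∈ range i, q ^ (d+1) + ∑ d ∈ range n, q ^ (d+1) := by
        congr 1
        · rw [← Finset.sum_range_reflect]
          refine sum_congr rfl fun j hj => ?_
          have := mem_range.1 hj
          congr 1; omega
        · rw [sum_image (by intro a _ b _ h; simpa using h)]
          refine sum_congr rfl fun j hj => ?_
          congr 1; omega
    _ ≤ 4 * q := by linarith [geo_le q h0 h1 i, geo_le q h0 h1 n]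

lemma Mk_nonneg (H q : ℝ) (hH : 0 ≤ H) (h0 : 0 ≤ q) (i j : ℕ) : 0 ≤ Mk H q i j := by
  unfold Mk; split_ifs <;> positivity

lemma Mk_symm (H q : ℝ) (i j : ℕ) : Mk H q i j = Mk H q j i := by
  unfold Mk; simp only [eq_comm, add_comm]

lemma Mrow_erase (H q : ℝ) (hH : 0 ≤ H) (h0 : 0 ≤ q) (h1 : q ≤ 1/2) (S : Finset ℕ) (i : ℕ) :
    ∑ j ∈ S.erase i, Mk H q i j ≤ 4 * H * q := by
  have : ∑ j ∈ S.erase i, Mk H q i j = H * ∑ j ∈ S.erase i, q ^ ((i - j) + (j - i)) := by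
    rw [mul_sum]
    refine sum_congr rfl fun j hj => ?_
    rw [Mk, if_neg (ne_of_mem_erase hj).symm]
  rw [this]
  nlinarith [row_le q h0 h1 S i]

lemma Mrow (H q : ℝ) (hH : 0 ≤ H) (h0 : 0 ≤ q) (h1 : q ≤ 1/2) (S : Finset ℕ) (i : ℕ) :
    ∑ j ∈ S, Mk H q i j ≤ 1 + 4 * H * q := by
  by_cases hi : i ∈ S
  · rw [← add_sum_erase _ _ hi]
    have : Mk H q i i = 1 := by simp [Mk]
    linarith [Mrow_erase H q hH h0 h1 S i]
  · have := Mrow_erase H q hH h0 h1 S i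
    rw [Finset.erase_eq_of_notMem hi] at this
    linarith

lemma amgm34 (u v : ℝ) (hu : 0 ≤ u) (hv : 0 ≤ v) (hu1 : u ≤ 1) (hv1 : v ≤ 1) :
    (u * v) ^ (3/4 : ℝ) ≤ (u + v) / 2 := by
  have h : 0 ≤ u * v := by positivity
  calc (u * v) ^ (3/4 : ℝ) ≤ (u * v) ^ (1/2 : ℝ) := by
        apply Real.rpow_le_rpow_of_exponent_ge_of_imp h (by nlinarith) (by norm_num)
        intro _ h; norm_num at h
    _ = Real.sqrt (u * v) := by rw [sqrt_eq_rpow]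
    _ ≤ (u + v) / 2 := by
        rw [sqrt_le_left (by positivity)]
        nlinarith [sq_nonneg (u - v)]

/-- generic Schur bound -/
lemma schurM (M : ℕ → ℕ → ℝ) (hM : ∀ i j, 0 ≤ M i j) (R : ℝ) (S : Finset ℕ)
    (h1 : ∀ i ∈ S, ∑ j ∈ S, M i j ≤ R) (h2 : ∀ j ∈ S, ∑ i ∈ S, M i j ≤ R)
    (x y : ℕ → ℝ) (hx : ∀ i, 0 ≤ x i) (hy : ∀ i, 0 ≤ y i) (hR : 0 ≤ R)
    (X Y : ℝ) (hX : ∑ i ∈ S, x i ≤ X) (hY : ∑ i ∈ S, y i ≤ Y) :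
    ∑ i ∈ S, ∑ j ∈ S, M i j * (x i * y j) ^ (3/4 : ℝ) ≤ R * (X * Y) ^ (3/4 : ℝ) := by
  have hxX : ∀ i ∈ S, x i ≤ X := fun i hi => (single_le_sum (fun j _ => hx j) hi).trans hX
  have hyY : ∀ i ∈ S, y i ≤ Y := fun i hi => (single_le_sum (fun j _ => hy j) hi).trans hY
  have hX0 : 0 ≤ X := (sum_nonneg (fun i _ => hx i)).trans hX
  have hY0 : 0 ≤ Y := (sum_nonneg (fun i _ => hy i)).trans hY
  by_cases hz : X = 0 ∨ Y = 0
  · have : ∑ i ∈ S, ∑ j ∈ S, M i j * (x i * y j) ^ (3/4 : ℝ) = 0 := by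
      refine sum_eq_zero fun i hi => sum_eq_zero fun j hj => ?_
      have : x i * y j = 0 := by
        rcases hz with h | h
        · rw [le_antisymm (h ▸ hxX i hi) (hx i)]; ring
        · rw [le_antisymm (h ▸ hyY j hj) (hy j)]; ring
      rw [this, Real.zero_rpow (by norm_num), mul_zero]
    rw [this]; positivity
  push Not at hz
  have hXp : 0 < X := lt_of_le_of_ne hX0 hz.1.symm
  have hYp : 0 < Y := lt_of_le_of_ne hY0 hz.2.symm
  have key : ∀ i ∈ S, ∀ j ∈ S, M i j * (x i * y j) ^ (3/4 : ℝ) ≤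
      (X * Y) ^ (3/4 : ℝ) * (M i j * (x i / X) / 2 + M i j * (y j / Y) / 2) := by
    intro i hi j hj
    have e : x i * y j = (X * Y) * ((x i / X) * (y j / Y)) := by field_simp
    have := amgm34 (x i / X) (y j / Y) (div_nonneg (hx i) hX0) (div_nonneg (hy j) hY0)
      ((div_le_one hXp).2 (hxX i hi)) ((div_le_one hYp).2 (hyY j hj))
    rw [e, mul_rpow (by positivity) (mul_nonneg (div_nonneg (hx i) hX0) (div_nonneg (hy j) hY0))]
    have h3 : 0 ≤ (X * Y) ^ (3/4 : ℝ) := by positivity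
    calc _ = (X * Y) ^ (3/4 : ℝ) * M i j * (x i / X * (y j / Y)) ^ (3/4 : ℝ) := by ring
      _ ≤ (X * Y) ^ (3/4 : ℝ) * M i j * ((x i / X + y j / Y) / 2) := by
        apply mul_le_mul_of_nonneg_left this (mul_nonneg h3 (hM i j))
      _ = _ := by ring
  have s1 : ∑ i ∈ S, x i / X ≤ 1 := by rw [← sum_div]; exact (div_le_one hXp).2 hX
  have s2 : ∑ i ∈ S, y i / Y ≤ 1 := by rw [← sum_div]; exact (div_le_one hYp).2 hY
  calc _ ≤ ∑ i ∈ S, ∑ j ∈ S, (X * Y) ^ (3/4 : ℝ) * (M i j * (x i / X) / 2 + M i j * (y j / Y) / 2) :=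
        sum_le_sum fun i hi => sum_le_sum fun j hj => key i hi j hj
    _ = (X * Y) ^ (3/4 : ℝ) * (∑ i ∈ S, (x i / X) * (∑ j ∈ S, M i j) / 2 + ∑ j ∈ S, (y j / Y) * (∑ i ∈ S, M i j) / 2) := by
        simp_rw [← mul_sum, sum_add_distrib]
        congr 2
        · refine sum_congr rfl fun i _ => ?_
          rw [mul_sum, sum_div]
          exact sum_congr rfl fun j _ => by ring
        · rw [sum_comm]
          refine sum_congr rfl fun i _ => ?_
          rw [mul_sum, sum_div]
          exact sum_congr rfl fun j _ => by ring
    _ ≤ (X * Y) ^ (3/4 : ℝ) * (∑ i ∈ S, (x i / X) * (R / 2) + ∑ j ∈ S, (y j / Y) * (R / 2)) := by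
        apply mul_le_mul_of_nonneg_left _ (by positivity)
        apply add_le_add <;> refine sum_le_sum fun i hi => ?_
        · rw [mul_div_assoc]
          exact mul_le_mul_of_nonneg_left (by linarith [h1 i hi]) (div_nonneg (hx i) hX0)
        · rw [mul_div_assoc]
          exact mul_le_mul_of_nonneg_left (by linarith [h2 i hi]) (div_nonneg (hy i) hY0)
    _ ≤ (X * Y) ^ (3/4 : ℝ) * R := by
        apply mul_le_mul_of_nonneg_left _ (by positivity)
        rw [← sum_mul, ← sum_mul]
        nlinarith
    _ = _ := mul_comm _ _

lemma L1 (H q : ℝ) (hH : 0 ≤ H) (h0 : 0 ≤ q) (h1 : q ≤ 1/2) (S : Finset ℕ)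
    (x y : ℕ → ℝ) (hx : ∀ i, 0 ≤ x i) (hy : ∀ i, 0 ≤ y i)
    (X Y : ℝ) (hX : ∑ i ∈ S, x i ≤ X) (hY : ∑ i ∈ S, y i ≤ Y) :
    ∑ i ∈ S, ∑ j ∈ S, Mk H q i j * (x i * y j) ^ (3/4 : ℝ) ≤ (1 + 4 * H * q) * (X * Y) ^ (3/4 : ℝ) := by
  refine schurM _ (Mk_nonneg H q hH h0) _ S (fun i _ => Mrow H q hH h0 h1 S i) (fun j _ => ?_) x y hx hy
    (by positivity) X Y hX hY
  simp_rw [Mk_symm H q _ j]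
  exact Mrow H q hH h0 h1 S j

lemma L2_alg (H q Δ : ℝ) (hH : 1 ≤ H) (h0 : 0 < q) (hsm : 1024 * H * q ≤ 1) (hΔ0 : 0 ≤ Δ) (hΔ : Δ ≤ 16 * H * q)
    (h : 1 < (1 - 3/4 * Δ) + 8 * H * q * Δ ^ (3/4 : ℝ) + 2 * (Δ * Δ) ^ (3/4 : ℝ)) :
    Δ ≤ (16 * H * q) ^ 4 := by
  set z := Δ ^ (1/4 : ℝ) with hz
  have hz0 : 0 ≤ z := by positivity
  have e4 : Δ = z ^ 4 := by
    rw [hz, ← rpow_natCast, ← rpow_mul hΔ0]; norm_num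
  have e3 : Δ ^ (3/4 : ℝ) = z ^ 3 := by
    rw [hz, ← rpow_natCast, ← rpow_mul hΔ0]; norm_num
  rw [mul_rpow hΔ0 hΔ0, e3] at h
  rw [e4] at h hΔ ⊢
  have hz2 : z ^ 2 ≤ 1/8 := by
    have : (z^2)^2 ≤ (1/8)^2 := by nlinarith
    exact (pow_le_pow_iff_left₀ (by positivity) (by norm_num) (by norm_num)).1 this
  have hz3 : 0 < z := by
    rcases hz0.lt_or_eq with h' | h'
    · exact h'
    · rw [← h'] at h; norm_num at h
  have : z ≤ 16 * H * q := by
    by_contra hcon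
    push Not at hcon
    have hp : 0 < z ^ 3 := by positivity
    have a1 : z ^ 3 * z ^ 3 ≤ z ^ 4 * (1/8) := by
      have : z ^ 3 * z ^ 3 = z ^ 4 * z ^ 2 := by ring
      rw [this]; gcongr
    have a2 : 16 * H * q * z ^ 3 ≤ z ^ 4 := by
      have : z ^ 4 = z * z ^ 3 := by ring
      rw [this]; gcongr
    linarith
  gcongr

lemma L2 (H q : ℝ) (hH : 1 ≤ H) (h0 : 0 < q) (hsm : 1024 * H * q ≤ 1) (S : Finset ℕ)
    (x y : ℕ → ℝ) (hx : ∀ i, 0 ≤ x i) (hy : ∀ i, 0 ≤ y i)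
    (hX : ∑ i ∈ S, x i = 1) (hY : ∑ i ∈ S, y i = 1)
    (h : 1 < ∑ i ∈ S, ∑ j ∈ S, Mk H q i j * (x i * y j) ^ (3/4 : ℝ)) :
    ∃ k, (∑ i ∈ S.erase k, ∑ j ∈ S.erase k, Mk H q i j * (x i * y j) ^ (3/4 : ℝ) ≤ 2 * (16 * H * q) ^ 6) ∧
      (∑ i ∈ S, ∑ j ∈ S, (if i = k ∧ j = k then 0 else Mk H q i j * (x i * y j) ^ (3/4 : ℝ)) ≤ 3 * (16 * H * q) ^ 4) := by
  have hH0 : 0 ≤ H := by linarith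
  have hHq : q ≤ H * q := by nlinarith
  have h1 : q ≤ 1/2 := by nlinarith
  have hx1 : ∀ i ∈ S, x i ≤ 1 := fun i hi => hX ▸ single_le_sum (fun j _ => hx j) hi
  have hy1 : ∀ i ∈ S, y i ≤ 1 := fun i hi => hY ▸ single_le_sum (fun j _ => hy j) hi
  have hSne : S.Nonempty := by
    rw [Finset.nonempty_iff_ne_empty]; rintro rfl; simp at hX
  -- split diagonal and off diagonal
  have hdiag : 1 - 4 * H * q < ∑ i ∈ S, (x i * y i) ^ (3/4 : ℝ) := by
    have hoff := schurM (fun i j => if i = j then 0 else Mk H q i j)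
      (fun i j => by split_ifs; exacts [le_rfl, Mk_nonneg H q hH0 h0.le i j]) (4 * H * q) S
      (fun i hi => by
        have := Mrow_erase H q hH0 h0.le h1 S i
        rw [← add_sum_erase _ _ hi, if_pos rfl, zero_add]
        refine (sum_le_sum fun j hj => ?_).trans this
        rw [if_neg (ne_of_mem_erase hj).symm])
      (fun i hi => by
        have := Mrow_erase H q hH0 h0.le h1 S i
        rw [← add_sum_erase _ _ hi, if_pos rfl, zero_add]
        refine (sum_le_sum fun j hj => ?_).trans this
        rw [if_neg (ne_of_mem_erase hj), Mk_symm])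
      x y hx hy (by positivity) 1 1 hX.le hY.le
    have e : ∑ i ∈ S, ∑ j ∈ S, Mk H q i j * (x i * y j) ^ (3/4 : ℝ) =
        ∑ i ∈ S, (x i * y i) ^ (3/4 : ℝ) + ∑ i ∈ S, ∑ j ∈ S, (if i = j then 0 else Mk H q i j) * (x i * y j) ^ (3/4 : ℝ) := by
      rw [← sum_add_distrib]
      refine sum_congr rfl fun i hi => ?_
      rw [← add_sum_erase _ _ hi, ← add_sum_erase (a := i) _ (fun j => (if i = j then 0 else Mk H q i j) * (x i * y j) ^ (3/4 : ℝ)) hi]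
      have : Mk H q i i = 1 := by simp [Mk]
      simp only [this, if_true]
      rw [one_mul, zero_mul, zero_add]
      congr 1
      refine sum_congr rfl fun j hj => ?_
      rw [if_neg (ne_of_mem_erase hj).symm]
    simp only [mul_one, Real.one_rpow] at hoff
    linarith
  obtain ⟨k, hk, hmax⟩ := exists_max_image S (fun i => x i * y i) hSne
  have hm0 : 0 ≤ x k * y k := mul_nonneg (hx k) (hy k)
  have hkk : 1 - 16 * H * q ≤ x k * y k := by
    set m := (x k * y k) ^ (1/4 : ℝ) with hm
    have hm00 : 0 ≤ m := by positivity
    have hle : ∑ i ∈ S, (x i * y i) ^ (3/4 : ℝ) ≤ m := by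
      have : ∀ i ∈ S, (x i * y i) ^ (3/4 : ℝ) ≤ m * ((x i + y i) / 2) := by
        intro i hi
        have hi0 : 0 ≤ x i * y i := mul_nonneg (hx i) (hy i)
        have e : (x i * y i) ^ (3/4 : ℝ) = (x i * y i) ^ (1/4 : ℝ) * (x i * y i) ^ (1/2 : ℝ) := by
          rw [← Real.rpow_add_of_nonneg hi0 (by norm_num) (by norm_num)]; norm_num
        rw [e]
        apply mul_le_mul
        · exact rpow_le_rpow hi0 (hmax i hi) (by norm_num)
        · rw [← sqrt_eq_rpow, sqrt_le_left (by linarith [hx i, hy i])]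
          nlinarith [sq_nonneg (x i - y i)]
        · positivity
        · exact hm00
      refine (sum_le_sum this).trans ?_
      rw [← mul_sum, ← sum_div, sum_add_distrib, hX, hY]
      norm_num
    have hm4 : x k * y k = m ^ 4 := by
      rw [hm, ← rpow_natCast, ← rpow_mul hm0]; norm_num
    rw [hm4]
    have hb : 1 - 4 * H * q ≤ m := by linarith
    have hb0 : 0 ≤ 1 - 4 * H * q := by linarith
    calc 1 - 16 * H * q ≤ (1 - 4 * H * q) ^ 4 := by
          have := one_add_mul_le_pow (a := -(4 * H * q)) (by linarith) 4
          push_cast at this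
          have e : (1 + -(4 * H * q)) = 1 - 4 * H * q := by ring
          rw [e] at this; linarith
      _ ≤ m ^ 4 := by gcongr
  set Δ := max (1 - x k) (1 - y k) with hΔ
  have hxk := hx1 k hk
  have hyk := hy1 k hk
  have hΔ0 : 0 ≤ Δ := le_max_of_le_left (by linarith)
  have hΔ1 : Δ ≤ 16 * H * q := max_le (by nlinarith [hx k, hy k]) (by nlinarith [hx k, hy k])
  have hΔle1 : Δ ≤ 1 := by linarith
  have sx : ∑ i ∈ S.erase k, x i ≤ Δ := by
    have := add_sum_erase S x hk
    linarith [le_max_left (1 - x k) (1 - y k)]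
  have sy : ∑ i ∈ S.erase k, y i ≤ Δ := by
    have := add_sum_erase S y hk
    linarith [le_max_right (1 - x k) (1 - y k)]
  have sxi : ∀ i ∈ S.erase k, x i ≤ Δ := fun i hi => (single_le_sum (fun j _ => hx j) hi).trans sx
  have syi : ∀ i ∈ S.erase k, y i ≤ Δ := fun i hi => (single_le_sum (fun j _ => hy j) hi).trans sy
  have t1 : (x k * y k) ^ (3/4 : ℝ) ≤ 1 - 3/4 * Δ := by
    have a : x k * y k ≤ 1 - Δ := by
      rcases max_choice (1 - x k) (1 - y k) with h' | h' <;> rw [hΔ, h'] <;> nlinarith [hx k, hy k]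
    have b : (1 + (-Δ)) ^ (3/4 : ℝ) ≤ 1 + 3/4 * (-Δ) :=
      rpow_one_add_le_one_add_mul_self (by linarith) (by norm_num) (by norm_num)
    calc _ ≤ (1 + (-Δ)) ^ (3/4 : ℝ) := rpow_le_rpow hm0 (by linarith) (by norm_num)
      _ ≤ _ := by linarith
  have t2 : ∑ j ∈ S.erase k, Mk H q k j * (x k * y j) ^ (3/4 : ℝ) ≤ 4 * H * q * Δ ^ (3/4 : ℝ) := by
    calc _ ≤ ∑ j ∈ S.erase k, Mk H q k j * Δ ^ (3/4 : ℝ) := by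
          refine sum_le_sum fun j hj => mul_le_mul_of_nonneg_left ?_ (Mk_nonneg H q hH0 h0.le _ _)
          apply rpow_le_rpow (mul_nonneg (hx k) (hy j)) _ (by norm_num)
          nlinarith [hx k, hy j, syi j hj]
      _ ≤ _ := by
          rw [← sum_mul]
          exact mul_le_mul_of_nonneg_right (Mrow_erase H q hH0 h0.le h1 S k) (by positivity)
  have t3 : ∑ i ∈ S.erase k, Mk H q i k * (x i * y k) ^ (3/4 : ℝ) ≤ 4 * H * q * Δ ^ (3/4 : ℝ) := by
    calc _ ≤ ∑ j ∈ S.erase k, Mk H q k j * Δ ^ (3/4 : ℝ) := by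
          refine sum_le_sum fun j hj => ?_
          rw [Mk_symm]
          refine mul_le_mul_of_nonneg_left ?_ (Mk_nonneg H q hH0 h0.le _ _)
          apply rpow_le_rpow (mul_nonneg (hx j) (hy k)) _ (by norm_num)
          nlinarith [hx j, hy k, sxi j hj]
      _ ≤ _ := by
          rw [← sum_mul]
          exact mul_le_mul_of_nonneg_right (Mrow_erase H q hH0 h0.le h1 S k) (by positivity)
  have t4 : ∑ i ∈ S.erase k, ∑ j ∈ S.erase k, Mk H q i j * (x i * y j) ^ (3/4 : ℝ) ≤ 2 * (Δ * Δ) ^ (3/4 : ℝ) := by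
    refine (L1 H q hH0 h0.le h1 (S.erase k) x y hx hy Δ Δ sx sy).trans ?_
    apply mul_le_mul_of_nonneg_right _ (by positivity)
    linarith
  have hsplit : ∀ F : ℕ → ℕ → ℝ, ∑ i ∈ S, ∑ j ∈ S, F i j = F k k + ∑ j ∈ S.erase k, F k j +
      ∑ i ∈ S.erase k, F i k + ∑ i ∈ S.erase k, ∑ j ∈ S.erase k, F i j := by
    intro F
    have e1 : ∀ i, ∑ j ∈ S, F i j = F i k + ∑ j ∈ S.erase k, F i j := fun i =>
      (add_sum_erase _ _ hk).symm
    simp_rw [e1]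
    rw [← add_sum_erase _ _ hk, sum_add_distrib]
    ring
  have hkk1 : Mk H q k k = 1 := by simp [Mk]
  have hmain := hsplit (fun i j => Mk H q i j * (x i * y j) ^ (3/4 : ℝ))
  simp only [hkk1, one_mul] at hmain
  have hΔ4 : Δ ≤ (16 * H * q) ^ 4 := L2_alg H q Δ hH h0 hsm hΔ0 hΔ1 (by linarith)
  have hq0 : 0 ≤ 16 * H * q := by positivity
  have e34 : Δ ^ (3/4 : ℝ) ≤ (16 * H * q) ^ 3 := by
    calc _ ≤ ((16 * H * q) ^ 4) ^ (3/4 : ℝ) := rpow_le_rpow hΔ0 hΔ4 (by norm_num)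
      _ = _ := by
        rw [← rpow_natCast, ← rpow_mul hq0]; norm_num
  have e34' : (Δ * Δ) ^ (3/4 : ℝ) ≤ (16 * H * q) ^ 6 := by
    rw [mul_rpow hΔ0 hΔ0]
    calc _ ≤ (16 * H * q) ^ 3 * (16 * H * q) ^ 3 := by gcongr
      _ = _ := by ring
  have e6 : (16 * H * q) ^ 6 ≤ (16 * H * q) ^ 4 := pow_le_pow_of_le_one hq0 (by linarith) (by norm_num)
  refine ⟨k, by linarith, ?_⟩
  have hsp := hsplit (fun i j => if i = k ∧ j = k then 0 else Mk H q i j * (x i * y j) ^ (3/4 : ℝ))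
  rw [hsp, if_pos ⟨rfl, rfl⟩]
  have u2 : ∑ j ∈ S.erase k, (if k = k ∧ j = k then 0 else Mk H q k j * (x k * y j) ^ (3/4 : ℝ)) = ∑ j ∈ S.erase k, Mk H q k j * (x k * y j) ^ (3/4 : ℝ) :=
    sum_congr rfl fun j hj => by rw [if_neg]; simp [ne_of_mem_erase hj]
  have u3 : ∑ j ∈ S.erase k, (if j = k ∧ k = k then 0 else Mk H q j k * (x j * y k) ^ (3/4 : ℝ)) = ∑ j ∈ S.erase k, Mk H q j k * (x j * y k) ^ (3/4 : ℝ) :=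
    sum_congr rfl fun j hj => by rw [if_neg]; simp [ne_of_mem_erase hj]
  have u4 : ∑ i ∈ S.erase k, ∑ j ∈ S.erase k, (if i = k ∧ j = k then 0 else Mk H q i j * (x i * y j) ^ (3/4 : ℝ)) = ∑ i ∈ S.erase k, ∑ j ∈ S.erase k, Mk H q i j * (x i * y j) ^ (3/4 : ℝ) :=
    sum_congr rfl fun i hi => sum_congr rfl fun j hj => by rw [if_neg]; simp [ne_of_mem_erase hi]
  rw [u2, u3, u4]
  have : 8 * H * q * Δ ^ (3/4 : ℝ) ≤ (16 * H * q) ^ 4 := by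
    calc _ ≤ (16 * H * q) * (16 * H * q) ^ 3 := by
          apply mul_le_mul _ e34 (by positivity) hq0
          nlinarith
      _ = _ := by ring
  linarith

noncomputable def Fp (p i : ℕ) : ℝ := if i = 0 then 1 else 1 - 1 / (p : ℝ)
noncomputable def wt (P : Finset ℕ) (e : ℕ → ℕ → ℕ) (ψ : ℕ → ℝ) (a : ℕ) : ℝ := ψ a * ∏ p ∈ P, Fp p (e a p)
noncomputable def Hw (p : ℕ) : ℝ := exp (4 / √(p : ℝ))
noncomputable def hh (P : Finset ℕ) (u v : ℕ → ℕ) : ℝ := ∏ p ∈ P, if u p = v p then 1 else Hw p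
def Edge (P : Finset ℕ) (e f : ℕ → ℕ → ℕ) (ψ θ : ℕ → ℝ) (a b : ℕ) : Prop :=
  ψ a * ∏ p ∈ P, (p : ℝ) ^ (f b p - e a p) ≤ 1 ∧ θ b * ∏ p ∈ P, (p : ℝ) ^ (e a p - f b p) ≤ 1
open Classical in
noncomputable def tm (P : Finset ℕ) (e f : ℕ → ℕ → ℕ) (ψ θ : ℕ → ℝ) (a b : ℕ) : ℝ :=
  if Edge P e f ψ θ a b then wt P e ψ a * wt P f θ b * hh P (e a) (f b) else 0
def InjP (P : Finset ℕ) (e : ℕ → ℕ → ℕ) (A : Finset ℕ) : Prop :=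
  ∀ a ∈ A, ∀ b ∈ A, (∀ p ∈ P, e a p = e b p) → a = b
def DSst (P : Finset ℕ) (C : ℝ) : Prop :=
  ∀ (A B : Finset ℕ) (e f : ℕ → ℕ → ℕ) (ψ θ : ℕ → ℝ), (∀ a, 0 ≤ ψ a) → (∀ a, 0 ≤ θ a) →
    InjP P e A → InjP P f B →
    ∑ a ∈ A, ∑ b ∈ B, tm P e f ψ θ a b ≤ C * ((∑ a ∈ A, wt P e ψ a) * (∑ b ∈ B, wt P f θ b)) ^ (3/4 : ℝ)

lemma Fp_pos (p i : ℕ) (hp : p.Prime) : 0 < Fp p i := by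
  unfold Fp
  have : (2:ℝ) ≤ p := by exact_mod_cast hp.two_le
  split_ifs
  · norm_num
  · rw [sub_pos, div_lt_one (by linarith)]; linarith

lemma Fp_le (p i : ℕ) : Fp p i ≤ 1 := by
  unfold Fp
  split_ifs
  · norm_num
  · have : 0 ≤ 1 / (p:ℝ) := by positivity
    linarith

lemma Hw_one_le (p : ℕ) : 1 ≤ Hw p := one_le_exp (by positivity)

lemma Hw_le (p : ℕ) (hp : p.Prime) : Hw p ≤ exp 4 := by
  apply exp_le_exp.2
  have : (1:ℝ) ≤ p := by exact_mod_cast hp.one_lt.le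
  rw [div_le_iff₀ (by positivity)]
  have := Real.one_le_sqrt.2 this
  linarith

lemma hh_one_le (P : Finset ℕ) (u v) : 1 ≤ hh P u v := by
  unfold hh
  refine Finset.prod_induction _ (fun x => (1:ℝ) ≤ x) (fun a b ha hb => one_le_mul_of_one_le_of_one_le ha hb) le_rfl fun p _ => ?_
  split_ifs
  · exact le_rfl
  · exact Hw_one_le p

lemma wt_nonneg (P : Finset ℕ) (hP : ∀ p ∈ P, p.Prime) (e ψ) (hψ : ∀ a, 0 ≤ ψ a) (a) : 0 ≤ wt P e ψ a :=
  mul_nonneg (hψ a) (prod_nonneg fun p hp => (Fp_pos p _ (hP p hp)).le)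

lemma tm_nonneg (P : Finset ℕ) (hP : ∀ p ∈ P, p.Prime) (e f ψ θ) (hψ : ∀ a, 0 ≤ ψ a) (hθ : ∀ a, 0 ≤ θ a) (a b) :
    0 ≤ tm P e f ψ θ a b := by
  unfold tm
  split_ifs
  · exact mul_nonneg (mul_nonneg (wt_nonneg P hP _ _ hψ _) (wt_nonneg P hP _ _ hθ _)) (zero_le_one.trans (hh_one_le _ _ _))
  · exact le_rfl

noncomputable def qp (p : ℕ) : ℝ := (p : ℝ) ^ (-(1/4) : ℝ)

lemma step (P : Finset ℕ) (p : ℕ) (hp : p.Prime) (hpP : p ∉ P) (C : ℝ) (hC : 0 ≤ C)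
    (hST : DSst P C) (A B : Finset ℕ) (e f : ℕ → ℕ → ℕ) (ψ θ : ℕ → ℝ) (hψ : ∀ a, 0 ≤ ψ a) (hθ : ∀ a, 0 ≤ θ a)
    (hP : ∀ p ∈ P, p.Prime)
    (hA : InjP (insert p P) e A) (hB : InjP (insert p P) f B) (i j : ℕ) :
    ∑ a ∈ A with e a p = i, ∑ b ∈ B with f b p = j, tm (insert p P) e f ψ θ a b ≤
      C * (Mk (Hw p) (qp p) i j * ((∑ a ∈ A with e a p = i, wt (insert p P) e ψ a) *
        (∑ b ∈ B with f b p = j, wt (insert p P) f θ b)) ^ (3/4 : ℝ)) := by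
  have hp0 : (0:ℝ) < p := by exact_mod_cast hp.pos
  have hp1 : (1:ℝ) ≤ p := by exact_mod_cast hp.one_lt.le
  set ψ' : ℕ → ℝ := fun a => ψ a * (p:ℝ) ^ (j - i) with hψ'
  set θ' : ℕ → ℝ := fun b => θ b * (p:ℝ) ^ (i - j) with hθ'
  have key := hST (A.filter fun a => e a p = i) (B.filter fun b => f b p = j) e f ψ' θ'
    (fun a => mul_nonneg (hψ a) (by positivity)) (fun a => mul_nonneg (hθ a) (by positivity))
    (fun a ha b hb h => by
      rw [mem_filter] at ha hb
      refine hA a ha.1 b hb.1 fun r hr => ?_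
      rcases mem_insert.1 hr with rfl | hr
      · rw [ha.2, hb.2]
      · exact h r hr)
    (fun a ha b hb h => by
      rw [mem_filter] at ha hb
      refine hB a ha.1 b hb.1 fun r hr => ?_
      rcases mem_insert.1 hr with rfl | hr
      · rw [ha.2, hb.2]
      · exact h r hr)
  set hij : ℝ := if i = j then 1 else Hw p with hhij
  have hij0 : 0 ≤ hij := by rw [hhij]; split_ifs; exacts [zero_le_one, zero_le_one.trans (Hw_one_le p)]
  set Fi := Fp p i
  set Fj := Fp p j
  have hFi : 0 < Fi := Fp_pos p i hp
  have hFj : 0 < Fj := Fp_pos p j hp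
  have w1 : ∀ a ∈ A.filter (fun a => e a p = i), wt (insert p P) e ψ a * (p:ℝ) ^ (j - i) = Fi * wt P e ψ' a := by
    intro a ha
    rw [mem_filter] at ha
    simp only [wt, prod_insert hpP, ha.2, hψ', Fi]
    ring
  have w2 : ∀ b ∈ B.filter (fun b => f b p = j), wt (insert p P) f θ b * (p:ℝ) ^ (i - j) = Fj * wt P f θ' b := by
    intro a ha
    rw [mem_filter] at ha
    simp only [wt, prod_insert hpP, ha.2, hθ', Fj]
    ring
  set c : ℝ := Fi * Fj / ((p:ℝ) ^ (j - i) * (p:ℝ) ^ (i - j)) with hc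
  have hc0 : 0 < c := by positivity
  have t1 : ∀ a ∈ A.filter (fun a => e a p = i), ∀ b ∈ B.filter (fun b => f b p = j),
      tm (insert p P) e f ψ θ a b = hij * c * tm P e f ψ' θ' a b := by
    intro a ha b hb
    have h1 := w1 a ha
    have h2 := w2 b hb
    rw [mem_filter] at ha hb
    have hE : Edge (insert p P) e f ψ θ a b ↔ Edge P e f ψ' θ' a b := by
      simp only [Edge, prod_insert hpP, ha.2, hb.2, hψ', hθ', mul_assoc]
    have hH : hh (insert p P) (e a) (f b) = hij * hh P (e a) (f b) := by
      simp only [hh, prod_insert hpP, ha.2, hb.2, hhij]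
    unfold tm
    by_cases hEE : Edge P e f ψ' θ' a b
    · rw [if_pos (hE.2 hEE), if_pos hEE, hH]
      have h1' : wt (insert p P) e ψ a = Fi * wt P e ψ' a / (p:ℝ) ^ (j - i) := by
        rw [eq_div_iff (by positivity)]; exact h1
      have h2' : wt (insert p P) f θ b = Fj * wt P f θ' b / (p:ℝ) ^ (i - j) := by
        rw [eq_div_iff (by positivity)]; exact h2
      rw [h1', h2', hc]
      field_simp
    · rw [if_neg (fun h => hEE (hE.1 h)), if_neg hEE, mul_zero]
  set x := ∑ a ∈ A with e a p = i, wt (insert p P) e ψ a with hx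
  set y := ∑ b ∈ B with f b p = j, wt (insert p P) f θ b with hy
  have hPi : ∀ r ∈ insert p P, r.Prime := fun r hr => by
    rcases mem_insert.1 hr with rfl | hr
    exacts [hp, hP r hr]
  have hx0 : 0 ≤ x := sum_nonneg fun a _ => wt_nonneg _ hPi _ _ hψ a
  have hy0 : 0 ≤ y := sum_nonneg fun a _ => wt_nonneg _ hPi _ _ hθ a
  have X1 : (∑ a ∈ A with e a p = i, wt P e ψ' a) * (∑ b ∈ B with f b p = j, wt P f θ' b) = c⁻¹ * (x * y) := by
    have a1 : x * (p:ℝ) ^ (j - i) = Fi * ∑ a ∈ A with e a p = i, wt P e ψ' a := by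
      rw [hx, sum_mul, mul_sum]; exact sum_congr rfl w1
    have a2 : y * (p:ℝ) ^ (i - j) = Fj * ∑ b ∈ B with f b p = j, wt P f θ' b := by
      rw [hy, sum_mul, mul_sum]; exact sum_congr rfl w2
    rw [hc]
    field_simp
    linear_combination (-Fj) * (∑ b ∈ B with f b p = j, wt P f θ' b) * a1 - x * (p:ℝ) ^ (j - i) * a2
  rw [X1] at key
  have L : ∑ a ∈ A with e a p = i, ∑ b ∈ B with f b p = j, tm (insert p P) e f ψ θ a b =
      hij * c * ∑ a ∈ A with e a p = i, ∑ b ∈ B with f b p = j, tm P e f ψ' θ' a b := by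
    rw [mul_sum]
    refine sum_congr rfl fun a ha => ?_
    rw [mul_sum]
    exact sum_congr rfl fun b hb => t1 a ha b hb
  rw [L]
  have hc4 : c * (c⁻¹) ^ (3/4 : ℝ) ≤ (qp p) ^ ((i - j) + (j - i)) := by
    have e1 : c * (c⁻¹) ^ (3/4 : ℝ) = c ^ (1/4 : ℝ) := by
      rw [Real.inv_rpow hc0.le, ← rpow_neg hc0.le]
      nth_rewrite 1 [← rpow_one c]
      rw [← rpow_add hc0]; norm_num
    rw [e1]
    have e2 : c ≤ (p : ℝ) ^ (-(((i - j) + (j - i) : ℕ) : ℝ)) := by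
      rw [rpow_neg hp0.le, rpow_natCast, hc, pow_add, mul_comm ((p:ℝ)^(i-j)), ← one_div]
      gcongr
      have := Fp_le p i
      have := Fp_le p j
      nlinarith
    calc c ^ (1/4 : ℝ) ≤ ((p : ℝ) ^ (-(((i - j) + (j - i) : ℕ) : ℝ))) ^ (1/4 : ℝ) :=
          rpow_le_rpow hc0.le e2 (by norm_num)
      _ = _ := by
          rw [qp, ← rpow_natCast, ← rpow_mul hp0.le, ← rpow_mul hp0.le]
          congr 1; ring
  have hM : hij * (qp p) ^ ((i - j) + (j - i)) = Mk (Hw p) (qp p) i j := by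
    rw [hhij, Mk]
    split_ifs with h
    · subst h; simp
    · rfl
  calc _ ≤ hij * c * (C * (c⁻¹ * (x * y)) ^ (3/4 : ℝ)) := by gcongr
    _ = C * (hij * (c * (c⁻¹) ^ (3/4 : ℝ)) * (x * y) ^ (3/4 : ℝ)) := by
        rw [mul_rpow (by positivity) (by positivity)]; ring
    _ ≤ C * (hij * (qp p) ^ ((i - j) + (j - i)) * (x * y) ^ (3/4 : ℝ)) := by gcongr
    _ = _ := by rw [hM]

lemma fib (A : Finset ℕ) (g : ℕ → ℕ) (S : Finset ℕ) (hS : ∀ a ∈ A, g a ∈ S) (F : ℕ → ℝ) :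
    ∑ a ∈ A, F a = ∑ i ∈ S, ∑ a ∈ A with g a = i, F a :=
  (Finset.sum_fiberwise_of_maps_to hS F).symm

lemma fib2 (A B : Finset ℕ) (g h : ℕ → ℕ) (S : Finset ℕ) (hA : ∀ a ∈ A, g a ∈ S) (hB : ∀ a ∈ B, h a ∈ S) (F : ℕ → ℕ → ℝ) :
    ∑ a ∈ A, ∑ b ∈ B, F a b = ∑ i ∈ S, ∑ j ∈ S, ∑ a ∈ A with g a = i, ∑ b ∈ B with h b = j, F a b := by
  rw [fib A g S hA]
  refine sum_congr rfl fun i _ => ?_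
  rw [sum_congr rfl fun a _ => fib B h S hB (F a), sum_comm]

def vpl (P : Finset ℕ) (k u : ℕ → ℕ) : ℕ := ∏ p ∈ P, p ^ (u p - k p)
def vmi (P : Finset ℕ) (k u : ℕ → ℕ) : ℕ := ∏ p ∈ P, p ^ (k p - u p)

lemma vpl_pos (P : Finset ℕ) (hP : ∀ p ∈ P, p.Prime) (k u) : 0 < vpl P k u :=
  prod_pos fun p hp => pow_pos (hP p hp).pos _
lemma vmi_pos (P : Finset ℕ) (hP : ∀ p ∈ P, p.Prime) (k u) : 0 < vmi P k u :=
  prod_pos fun p hp => pow_pos (hP p hp).pos _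

lemma Fp_tele (p : ℕ) (k : ℕ) : ∑ l ∈ range (k+1), Fp p (k - l) / (p:ℝ) ^ l = 1 := by
  induction k with
  | zero => simp [Fp]
  | succ k ih =>
    rw [Finset.sum_range_succ']
    have : ∀ l ∈ range (k+1), Fp p (k + 1 - (l+1)) / (p:ℝ) ^ (l+1) = (Fp p (k - l) / (p:ℝ) ^ l) * (1/p) := by
      intro l _
      rw [Nat.add_sub_add_right, pow_succ, div_mul_div_comm, mul_one]
    rw [sum_congr rfl this, ← sum_mul, ih]
    simp [Fp]

lemma fact_prod (P : Finset ℕ) (hP : ∀ p ∈ P, p.Prime) (m : ℕ → ℕ) (q : ℕ) (hq : q ∈ P) :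
    (∏ p ∈ P, p ^ (m p)).factorization q = m q := by
  rw [Nat.factorization_prod (fun p hp => pow_ne_zero _ (hP p hp).ne_zero)]
  rw [Finsupp.finsetSum_apply, Finset.sum_eq_single q]
  · rw [(hP q hq).factorization_pow]; simp
  · intro p hp hpq
    rw [(hP p hp).factorization_pow]; simp [hpq]
  · intro h; exact absurd hq h

lemma count_le (P : Finset ℕ) (hP : ∀ p ∈ P, p.Prime) (k : ℕ → ℕ) (A : Finset ℕ) (e : ℕ → ℕ → ℕ)
    (hA : InjP P e A) (X : ℕ) (hX : ∀ a ∈ A, vpl P k (e a) ≤ X) :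
    ∑ a ∈ A, (∏ p ∈ P, Fp p (e a p)) / (vmi P k (e a) : ℝ) ≤ X := by
  classical
  set Φ : ℕ → ℕ × (∀ p ∈ P, ℕ) := fun a => (vpl P k (e a), fun p _ => k p - e a p) with hΦ
  set g : ℕ × (∀ p ∈ P, ℕ) → ℝ := fun x => ∏ p ∈ P.attach, (Fp p.1 (k p.1 - x.2 p.1 p.2) / (p.1:ℝ) ^ (x.2 p.1 p.2)) with hg
  have hg0 : ∀ x, 0 ≤ g x := fun x => prod_nonneg fun p _ =>
    div_nonneg (Fp_pos _ _ (hP _ p.2)).le (by positivity)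
  have h1 : ∀ a ∈ A, (∏ p ∈ P, Fp p (e a p)) / (vmi P k (e a) : ℝ) ≤ g (Φ a) := by
    intro a _
    simp only [hg, hΦ, vmi]
    rw [Finset.prod_attach P (fun p => Fp p (k p - (k p - e a p)) / (p:ℝ) ^ (k p - e a p)), Nat.cast_prod, ← Finset.prod_div_distrib]
    refine Finset.prod_le_prod (fun p hp => div_nonneg (Fp_pos _ _ (hP _ hp)).le (by positivity)) fun p hp => ?_
    rw [Nat.cast_pow]
    refine div_le_div_of_nonneg_right ?_ (by positivity)
    rcases le_or_gt (e a p) (k p) with h | h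
    · rw [Nat.sub_sub_self h]
    · rw [Nat.sub_eq_zero_of_le h.le, Nat.sub_zero]
      have : e a p ≠ 0 := by omega
      simp only [Fp, if_neg this]
      split_ifs
      · have : 0 ≤ 1 / (p:ℝ) := by positivity
        linarith
      · exact le_rfl
  have hinj : Set.InjOn Φ A := by
    intro a ha b hb hab
    simp only [hΦ, Prod.mk.injEq] at hab
    refine hA a ha b hb fun p hp => ?_
    have h2 := congrFun (congrFun hab.2 p) hp
    have h3 := congrArg (fun n => n.factorization p) hab.1
    simp only [vpl] at h3
    rw [fact_prod P hP _ p hp, fact_prod P hP _ p hp] at h3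
    omega
  calc _ ≤ ∑ a ∈ A, g (Φ a) := sum_le_sum h1
    _ = ∑ x ∈ A.image Φ, g x := (sum_image hinj).symm
    _ ≤ ∑ x ∈ (Icc 1 X) ×ˢ (P.pi fun p => range (k p + 1)), g x := by
        refine sum_le_sum_of_subset_of_nonneg ?_ fun x _ _ => hg0 x
        intro x hx
        obtain ⟨a, ha, rfl⟩ := mem_image.1 hx
        simp only [hΦ, mem_product, mem_Icc, Finset.mem_pi, mem_range]
        exact ⟨⟨vpl_pos P hP _ _, hX a ha⟩, fun p _ => by omega⟩
    _ = ∑ v ∈ Icc 1 X, ∏ p ∈ P, ∑ l ∈ range (k p + 1), Fp p (k p - l) / (p:ℝ) ^ l := by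
        rw [Finset.sum_product]
        refine sum_congr rfl fun v _ => ?_
        rw [Finset.prod_sum]
    _ = X := by
        simp [Fp_tele]

open Classical in
lemma removal (P : Finset ℕ) (hP : ∀ p ∈ P, p.Prime) (k : ℕ → ℕ) (e f : ℕ → ℕ → ℕ) (ψ θ : ℕ → ℝ)
    (hψ : ∀ a, 0 ≤ ψ a) (hθ : ∀ a, 0 ≤ θ a) (E : ℕ → ℕ → Prop)
    (hE1 : ∀ a b, E a b → ψ a * (vmi P k (e a) * vpl P k (f b)) ≤ 1)
    (hE2 : ∀ a b, E a b → θ b * (vmi P k (f b) * vpl P k (e a)) ≤ 1) (lam : ℝ) (hlam : 0 < lam) :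
    ∀ (n : ℕ) (A B : Finset ℕ), A.card + B.card = n → InjP P e A → InjP P f B →
    ∑ a ∈ A, ∑ b ∈ B, (if E a b then wt P e ψ a * wt P f θ b else 0) ≤
      lam * ∑ a ∈ A, wt P e ψ a + lam⁻¹ * ∑ b ∈ B, wt P f θ b := by
  have W1 := wt_nonneg P hP e ψ hψ
  have W2 := wt_nonneg P hP f θ hθ
  intro n
  induction n with
  | zero =>
    intro A B h _ _
    have hA : A = ∅ := Finset.card_eq_zero.1 (by omega)
    have hB : B = ∅ := Finset.card_eq_zero.1 (by omega)
    subst hA hB; simp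
  | succ n ih =>
    intro A B hc hA hB
    rcases A.eq_empty_or_nonempty with rfl | hne
    · simp only [Finset.sum_empty, mul_zero, zero_add]
      exact mul_nonneg (by positivity) (sum_nonneg fun b _ => W2 b)
    obtain ⟨v0, hv0, hmax⟩ := exists_max_image A (fun a => vpl P k (e a)) hne
    have remA : ∑ b ∈ B, (if E v0 b then wt P f θ b else 0) ≤ lam →
       ∑ a ∈ A, ∑ b ∈ B, (if E a b then wt P e ψ a * wt P f θ b else 0) ≤
        lam * ∑ a ∈ A, wt P e ψ a + lam⁻¹ * ∑ b ∈ B, wt P f θ b := by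
      intro hdeg
      have h1 := ih (A.erase v0) B (by rw [Finset.card_erase_of_mem hv0]; have := Finset.card_pos.2 hne; omega)
        (fun a ha b hb => hA a (mem_of_mem_erase ha) b (mem_of_mem_erase hb)) hB
      rw [← add_sum_erase A _ hv0, ← add_sum_erase A (fun a => wt P e ψ a) hv0]
      have h2 : ∑ b ∈ B, (if E v0 b then wt P e ψ v0 * wt P f θ b else 0) ≤ lam * wt P e ψ v0 := by
        calc _ = wt P e ψ v0 * ∑ b ∈ B, (if E v0 b then wt P f θ b else 0) := by
              rw [mul_sum]; exact sum_congr rfl fun b _ => by split_ifs <;> simp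
          _ ≤ wt P e ψ v0 * lam := mul_le_mul_of_nonneg_left hdeg (W1 _)
          _ = _ := mul_comm _ _
      rw [mul_add]; linarith
    set Nb := B.filter (fun b => E v0 b) with hNb
    rcases Nb.eq_empty_or_nonempty with hemp | hNne
    · apply remA
      rw [← sum_filter, ← hNb, hemp]; simpa using hlam.le
    obtain ⟨w0, hw0, hwmax⟩ := exists_max_image Nb (fun b => vpl P k (f b)) hNne
    have hw0B : w0 ∈ B := (mem_filter.1 hw0).1
    have pv : (0:ℝ) < vpl P k (e v0) := by exact_mod_cast vpl_pos P hP _ _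
    have pw : (0:ℝ) < vpl P k (f w0) := by exact_mod_cast vpl_pos P hP _ _
    have d1 : ∑ b ∈ B, (if E v0 b then wt P f θ b else 0) ≤ vpl P k (f w0) / vpl P k (e v0) := by
      rw [← sum_filter, ← hNb]
      have := count_le P hP k Nb f (fun a ha b hb => hB a (mem_filter.1 ha).1 b (mem_filter.1 hb).1)
        (vpl P k (f w0)) hwmax
      calc _ ≤ ∑ b ∈ Nb, ((∏ p ∈ P, Fp p (f b p)) / (vmi P k (f b) : ℝ)) / vpl P k (e v0) := by
            refine sum_le_sum fun b hb => ?_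
            have hE := hE2 v0 b (mem_filter.1 hb).2
            have pm : (0:ℝ) < vmi P k (f b) := by exact_mod_cast vmi_pos P hP _ _
            have pF : 0 ≤ ∏ p ∈ P, Fp p (f b p) := prod_nonneg fun p hp => (Fp_pos _ _ (hP _ hp)).le
            rw [div_div, le_div_iff₀ (by positivity), wt]
            nlinarith
        _ ≤ _ := by rw [← sum_div]; gcongr
    have d2 : ∑ a ∈ A, (if E a w0 then wt P e ψ a else 0) ≤ vpl P k (e v0) / vpl P k (f w0) := by
      rw [← sum_filter]
      have := count_le P hP k (A.filter fun a => E a w0) e (fun a ha b hb => hA a (mem_filter.1 ha).1 b (mem_filter.1 hb).1)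
        (vpl P k (e v0)) (fun a ha => hmax a (mem_filter.1 ha).1)
      calc _ ≤ ∑ a ∈ A with E a w0, ((∏ p ∈ P, Fp p (e a p)) / (vmi P k (e a) : ℝ)) / vpl P k (f w0) := by
            refine sum_le_sum fun b hb => ?_
            have hE := hE1 b w0 (mem_filter.1 hb).2
            have pm : (0:ℝ) < vmi P k (e b) := by exact_mod_cast vmi_pos P hP _ _
            have pF : 0 ≤ ∏ p ∈ P, Fp p (e b p) := prod_nonneg fun p hp => (Fp_pos _ _ (hP _ hp)).le
            rw [div_div, le_div_iff₀ (by positivity), wt]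
            nlinarith
        _ ≤ _ := by rw [← sum_div]; gcongr
    by_cases hl : (vpl P k (f w0) / vpl P k (e v0) : ℝ) ≤ lam
    · exact remA (d1.trans hl)
    push Not at hl
    have hl2 : (vpl P k (e v0) / vpl P k (f w0) : ℝ) ≤ lam⁻¹ := by
      rw [← inv_div]
      exact inv_anti₀ hlam hl.le
    have hdeg := d2.trans hl2
    have h1 := ih A (B.erase w0) (by rw [Finset.card_erase_of_mem hw0B]; have := Finset.card_pos.2 ⟨w0, hw0B⟩; omega)
      hA (fun a ha b hb => hB a (mem_of_mem_erase ha) b (mem_of_mem_erase hb))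
    rw [sum_comm] at h1 ⊢
    rw [← add_sum_erase B _ hw0B, ← add_sum_erase B (fun b => wt P f θ b) hw0B]
    have h2 : ∑ a ∈ A, (if E a w0 then wt P e ψ a * wt P f θ w0 else 0) ≤ lam⁻¹ * wt P f θ w0 := by
      calc _ = wt P f θ w0 * ∑ a ∈ A, (if E a w0 then wt P e ψ a else 0) := by
            rw [mul_sum]; exact sum_congr rfl fun b _ => by split_ifs <;> simp [mul_comm]
        _ ≤ wt P f θ w0 * lam⁻¹ := mul_le_mul_of_nonneg_left hdeg (W2 _)
        _ = _ := mul_comm _ _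
    rw [mul_add]; linarith

open Classical in
lemma finalArg (P : Finset ℕ) (hP : ∀ p ∈ P, p.Prime) (k : ℕ → ℕ) (e f : ℕ → ℕ → ℕ) (ψ θ : ℕ → ℝ)
    (hψ : ∀ a, 0 ≤ ψ a) (hθ : ∀ a, 0 ≤ θ a) (A B : Finset ℕ) (hA : InjP P e A) (hB : InjP P f B)
    (E : ℕ → ℕ → Prop) (hE : ∀ a b, E a b → Edge P e f ψ θ a b)
    (hk : ∀ a b, E a b → ∀ p ∈ P, e a p = k p ∨ f b p = k p) :
    ∑ a ∈ A, ∑ b ∈ B, (if E a b then wt P e ψ a * wt P f θ b else 0) ≤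
      2 * ((∑ a ∈ A, wt P e ψ a) * (∑ b ∈ B, wt P f θ b)) ^ (3/4 : ℝ) := by
  have W1 := wt_nonneg P hP e ψ hψ
  have W2 := wt_nonneg P hP f θ hθ
  set X := ∑ a ∈ A, wt P e ψ a with hX
  set Y := ∑ b ∈ B, wt P f θ b with hY
  have hX0 : 0 ≤ X := sum_nonneg fun a _ => W1 a
  have hY0 : 0 ≤ Y := sum_nonneg fun a _ => W2 a
  have triv : ∑ a ∈ A, ∑ b ∈ B, (if E a b then wt P e ψ a * wt P f θ b else 0) ≤ X * Y := by
    rw [hX, hY, sum_mul_sum]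
    refine sum_le_sum fun a _ => sum_le_sum fun b _ => ?_
    split_ifs
    · exact le_rfl
    · exact mul_nonneg (W1 a) (W2 b)
  have hXY : 0 ≤ X * Y := mul_nonneg hX0 hY0
  rcases le_or_gt (X * Y) 1 with h1 | h1
  · refine triv.trans ?_
    have : X * Y ≤ (X * Y) ^ (3/4 : ℝ) := by
      nth_rewrite 1 [← rpow_one (X*Y)]
      apply Real.rpow_le_rpow_of_exponent_ge_of_imp hXY h1 (by norm_num)
      intro _ h; norm_num at h
    have : 0 ≤ (X * Y) ^ (3/4 : ℝ) := by positivity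
    linarith
  have hXp : 0 < X := by
    rcases hX0.eq_or_lt with h | h
    · rw [← h] at h1; norm_num at h1
    · exact h
  have hYp : 0 < Y := by
    rcases hY0.eq_or_lt with h | h
    · rw [← h] at h1; norm_num at h1
    · exact h
  have e1 : ∀ a b, E a b → (∏ p ∈ P, (p:ℝ) ^ (f b p - e a p)) = vmi P k (e a) * vpl P k (f b) := by
    intro a b h
    rw [vmi, vpl, Nat.cast_prod, Nat.cast_prod, ← prod_mul_distrib]
    refine prod_congr rfl fun p hp => ?_
    rw [Nat.cast_pow, Nat.cast_pow, ← pow_add]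
    congr 1
    have := hk a b h p hp
    omega
  have e2 : ∀ a b, E a b → (∏ p ∈ P, (p:ℝ) ^ (e a p - f b p)) = vmi P k (f b) * vpl P k (e a) := by
    intro a b h
    rw [vmi, vpl, Nat.cast_prod, Nat.cast_prod, ← prod_mul_distrib]
    refine prod_congr rfl fun p hp => ?_
    rw [Nat.cast_pow, Nat.cast_pow, ← pow_add]
    congr 1
    have := hk a b h p hp
    omega
  have main := removal P hP k e f ψ θ hψ hθ E (fun a b h => by rw [← e1 a b h]; exact (hE a b h).1)
    (fun a b h => by rw [← e2 a b h]; exact (hE a b h).2) (√Y / √X) (by positivity) _ A B rfl hA hB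
  refine main.trans ?_
  rw [← hX, ← hY]
  have sX := mul_self_sqrt hX0
  have sY := mul_self_sqrt hY0
  have pX : 0 < √X := by positivity
  have pY : 0 < √Y := by positivity
  have : √Y / √X * X + (√Y / √X)⁻¹ * Y = 2 * √(X * Y) := by
    rw [Real.sqrt_mul hX0]
    nth_rewrite 2 [← sX]
    nth_rewrite 3 [← sY]
    field_simp
    ring
  rw [this, sqrt_eq_rpow]
  have : (X*Y) ^ (1/2:ℝ) ≤ (X*Y) ^ (3/4:ℝ) := Real.rpow_le_rpow_of_exponent_le h1.le (by norm_num)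
  linarith

lemma rowq (q : ℝ) (h0 : 0 ≤ q) (h1 : q < 1) (S : Finset ℕ) (i : ℕ) :
    ∑ j ∈ S, q ^ ((i - j) + (j - i)) ≤ 2 / (1 - q) := by
  have gen : ∀ (U : Finset ℕ) (g : ℕ → ℕ), Set.InjOn g U → ∑ j ∈ U, q ^ (g j) ≤ 1 / (1 - q) := by
    intro U g hg
    rw [← sum_image (f := fun n => q ^ n) hg, one_div, ← tsum_geometric_of_lt_one h0 h1]
    exact (summable_geometric_of_lt_one h0 h1).sum_le_tsum _ (fun _ _ => by positivity)
  rw [← Finset.sum_filter_add_sum_filter_not S (fun j => j ≤ i)]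
  have a1 := gen (S.filter fun j => j ≤ i) (fun j => (i - j) + (j - i)) (by
    intro a ha b hb hab
    have := (mem_filter.1 ha).2
    have := (mem_filter.1 hb).2
    simp only at hab
    omega)
  have a2 := gen (S.filter fun j => ¬ j ≤ i) (fun j => (i - j) + (j - i)) (by
    intro a ha b hb hab
    have := (mem_filter.1 ha).2
    have := (mem_filter.1 hb).2
    simp only at hab
    omega)
  calc _ ≤ 1 / (1 - q) + 1 / (1 - q) := add_le_add a1 a2
    _ = _ := by ring

lemma exS (A B : Finset ℕ) (g h : ℕ → ℕ) : ∃ S : Finset ℕ, (∀ a ∈ A, g a ∈ S) ∧ (∀ b ∈ B, h b ∈ S) :=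
  ⟨A.image g ∪ B.image h, fun _ ha => Finset.mem_union_left _ (Finset.mem_image_of_mem _ ha),
    fun _ ha => Finset.mem_union_right _ (Finset.mem_image_of_mem _ ha)⟩

lemma qp_pos (p : ℕ) (hp : p.Prime) : 0 < qp p := by
  have : (0:ℝ) < p := by exact_mod_cast hp.pos
  unfold qp; positivity

lemma qp_lt (p : ℕ) (hp : p.Prime) : qp p < 1 := by
  have : (1:ℝ) < p := by exact_mod_cast hp.one_lt
  exact Real.rpow_lt_one_of_one_lt_of_neg this (by norm_num)

lemma addsmall (p : ℕ) (hp : p.Prime) : ∃ K : ℝ, 1 ≤ K ∧ ∀ (P : Finset ℕ) (C : ℝ), p ∉ P → 0 ≤ C →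
    (∀ p ∈ P, p.Prime) → DSst P C → DSst (insert p P) (C * K) := by
  have q0 := qp_pos p hp
  have q1 := qp_lt p hp
  have H1 := Hw_one_le p
  have qq : 0 < 2 / (1 - qp p) := div_pos two_pos (by linarith)
  refine ⟨1 + Hw p * (2 / (1 - qp p)), by nlinarith, ?_⟩
  intro P C hpP hC hP hST A B e f ψ θ hψ hθ hA hB
  obtain ⟨S, hSA, hSB⟩ := exS A B (fun a => e a p) (fun b => f b p)
  rw [fib2 A B (fun a => e a p) (fun b => f b p) S hSA hSB]
  have hPi : ∀ r ∈ insert p P, r.Prime := fun r hr => by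
    rcases mem_insert.1 hr with rfl | hr
    exacts [hp, hP r hr]
  calc _ ≤ ∑ i ∈ S, ∑ j ∈ S, C * (Mk (Hw p) (qp p) i j * ((∑ a ∈ A with e a p = i, wt (insert p P) e ψ a) *
        (∑ b ∈ B with f b p = j, wt (insert p P) f θ b)) ^ (3/4 : ℝ)) :=
      sum_le_sum fun i _ => sum_le_sum fun j _ =>
        step P p hp hpP C hC hST A B e f ψ θ hψ hθ hP hA hB i j
    _ = C * ∑ i ∈ S, ∑ j ∈ S, Mk (Hw p) (qp p) i j * ((∑ a ∈ A with e a p = i, wt (insert p P) e ψ a) *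
        (∑ b ∈ B with f b p = j, wt (insert p P) f θ b)) ^ (3/4 : ℝ) := by simp_rw [mul_sum]
    _ ≤ C * ((1 + Hw p * (2 / (1 - qp p))) * ((∑ a ∈ A, wt (insert p P) e ψ a) * (∑ b ∈ B, wt (insert p P) f θ b)) ^ (3/4 : ℝ)) := by
      refine mul_le_mul_of_nonneg_left ?_ hC
      have row : ∀ i ∈ S, ∑ j ∈ S, Mk (Hw p) (qp p) i j ≤ 1 + Hw p * (2 / (1 - qp p)) := by
        intro i hi
        rw [← add_sum_erase _ _ hi]
        refine add_le_add (by simp [Mk]) ?_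
        refine le_trans (le_of_eq ?_) (mul_le_mul_of_nonneg_left (rowq (qp p) q0.le q1 (S.erase i) i) (by linarith))
        rw [mul_sum]
        refine sum_congr rfl fun j hj => ?_
        rw [Mk, if_neg (ne_of_mem_erase hj).symm]
      refine schurM _ (fun i j => Mk_nonneg _ _ (by linarith) q0.le i j) _ S row
        (fun j hj => by simp_rw [Mk_symm _ _ _ j]; exact row j hj) _ _
        (fun i => sum_nonneg fun a _ => wt_nonneg _ hPi _ _ hψ a)
        (fun i => sum_nonneg fun a _ => wt_nonneg _ hPi _ _ hθ a) (by nlinarith) _ _ ?_ ?_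
      · exact (fib A (fun a => e a p) S hSA _).ge
      · exact (fib B (fun a => f a p) S hSB _).ge
    _ = _ := by ring

open Classical in
lemma offk (P : Finset ℕ) (p : ℕ) (hp : p.Prime) (hpP : p ∉ P) (C : ℝ) (hC : 0 < C)
    (hST : DSst P C) (A B : Finset ℕ) (e f : ℕ → ℕ → ℕ) (ψ θ : ℕ → ℝ) (hψ : ∀ a, 0 ≤ ψ a) (hθ : ∀ a, 0 ≤ θ a)
    (hP : ∀ p ∈ P, p.Prime)
    (hA : InjP (insert p P) e A) (hB : InjP (insert p P) f B) (hsm : 1024 * Hw p * qp p ≤ 1)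
    (hX : 0 < ∑ a ∈ A, wt (insert p P) e ψ a) (hY : 0 < ∑ b ∈ B, wt (insert p P) f θ b)
    (T : ℝ) (hT : T = ∑ a ∈ A, ∑ b ∈ B, tm (insert p P) e f ψ θ a b)
    (hbig : C * ((∑ a ∈ A, wt (insert p P) e ψ a) * (∑ b ∈ B, wt (insert p P) f θ b)) ^ (3/4 : ℝ) < T) :
    ∃ k : ℕ, (∑ a ∈ A, ∑ b ∈ B, (if e a p ≠ k ∧ f b p ≠ k then tm (insert p P) e f ψ θ a b else 0) ≤ T * (2*(16*Hw p*qp p)^6)) ∧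
      (∑ a ∈ A, ∑ b ∈ B, (if e a p = k ∧ f b p = k then 0 else tm (insert p P) e f ψ θ a b) ≤ T * (3*(16*Hw p*qp p)^4)) := by
  have q0 := qp_pos p hp
  have H1 := Hw_one_le p
  have hPi : ∀ r ∈ insert p P, r.Prime := fun r hr => by
    rcases mem_insert.1 hr with rfl | hr
    exacts [hp, hP r hr]
  obtain ⟨S, hSA, hSB⟩ := exS A B (fun a => e a p) (fun b => f b p)
  set X := ∑ a ∈ A, wt (insert p P) e ψ a with hXd
  set Y := ∑ b ∈ B, wt (insert p P) f θ b with hYd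
  set x : ℕ → ℝ := fun i => (∑ a ∈ A with e a p = i, wt (insert p P) e ψ a) / X with hx
  set y : ℕ → ℝ := fun j => (∑ b ∈ B with f b p = j, wt (insert p P) f θ b) / Y with hy
  have hx0 : ∀ i, 0 ≤ x i := fun i => div_nonneg (sum_nonneg fun a _ => wt_nonneg _ hPi _ _ hψ a) hX.le
  have hy0 : ∀ i, 0 ≤ y i := fun i => div_nonneg (sum_nonneg fun a _ => wt_nonneg _ hPi _ _ hθ a) hY.le
  set Z := C * (X * Y) ^ (3/4 : ℝ) with hZ
  have hZ0 : 0 < Z := by positivity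
  have st : ∀ i j, ∑ a ∈ A with e a p = i, ∑ b ∈ B with f b p = j, tm (insert p P) e f ψ θ a b ≤
      Z * (Mk (Hw p) (qp p) i j * (x i * y j) ^ (3/4:ℝ)) := by
    intro i j
    refine (step P p hp hpP C hC.le hST A B e f ψ θ hψ hθ hP hA hB i j).trans (le_of_eq ?_)
    have : (∑ a ∈ A with e a p = i, wt (insert p P) e ψ a) * (∑ b ∈ B with f b p = j, wt (insert p P) f θ b)
      = (X * Y) * (x i * y j) := by simp only [hx, hy]; field_simp
    rw [this, mul_rpow (by positivity) (mul_nonneg (hx0 i) (hy0 j)), hZ]; ring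
  have hL := L2 (Hw p) (qp p) H1 q0 hsm S x y hx0 hy0
    (by rw [hx, ← sum_div, ← fib A (fun a => e a p) S hSA]; exact div_self hX.ne')
    (by rw [hy, ← sum_div, ← fib B (fun a => f a p) S hSB]; exact div_self hY.ne')
    (by
      rw [hT, fib2 A B (fun a => e a p) (fun b => f b p) S hSA hSB] at hbig
      have := hbig.trans_le (sum_le_sum fun i _ => sum_le_sum fun j _ => st i j)
      simp_rw [← mul_sum] at this
      nlinarith)
  obtain ⟨k, hk1, hk2⟩ := hL
  refine ⟨k, ?_, ?_⟩
  · rw [fib2 A B (fun a => e a p) (fun b => f b p) S hSA hSB]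
    calc _ ≤ ∑ i ∈ S, ∑ j ∈ S, (if i ≠ k ∧ j ≠ k then Z * (Mk (Hw p) (qp p) i j * (x i * y j) ^ (3/4:ℝ)) else 0) := by
          refine sum_le_sum fun i _ => sum_le_sum fun j _ => ?_
          split_ifs with h
          · refine le_trans (sum_le_sum fun a ha => sum_le_sum fun b hb => ?_) (st i j)
            rw [(mem_filter.1 ha).2, (mem_filter.1 hb).2, if_pos h]
          · refine sum_nonpos fun a ha => sum_nonpos fun b hb => ?_
            rw [(mem_filter.1 ha).2, (mem_filter.1 hb).2, if_neg h]
      _ = Z * ∑ i ∈ S.erase k, ∑ j ∈ S.erase k, Mk (Hw p) (qp p) i j * (x i * y j) ^ (3/4:ℝ) := by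
          simp_rw [mul_sum, ← Finset.filter_ne', sum_filter]
          refine sum_congr rfl fun i _ => ?_
          split_ifs with hi
          · exact sum_congr rfl fun j _ => by simp [hi]
          · exact sum_eq_zero fun j _ => by simp [hi]
      _ ≤ Z * (2*(16*Hw p*qp p)^6) := mul_le_mul_of_nonneg_left hk1 hZ0.le
      _ ≤ _ := mul_le_mul_of_nonneg_right hbig.le (by positivity)
  · rw [fib2 A B (fun a => e a p) (fun b => f b p) S hSA hSB]
    calc _ ≤ ∑ i ∈ S, ∑ j ∈ S, (if i = k ∧ j = k then 0 else Z * (Mk (Hw p) (qp p) i j * (x i * y j) ^ (3/4:ℝ))) := by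
          refine sum_le_sum fun i _ => sum_le_sum fun j _ => ?_
          split_ifs with h
          · refine sum_nonpos fun a ha => sum_nonpos fun b hb => ?_
            rw [(mem_filter.1 ha).2, (mem_filter.1 hb).2, if_pos h]
          · refine le_trans (sum_le_sum fun a ha => sum_le_sum fun b hb => ?_) (st i j)
            rw [(mem_filter.1 ha).2, (mem_filter.1 hb).2, if_neg h]
      _ = Z * ∑ i ∈ S, ∑ j ∈ S, (if i = k ∧ j = k then 0 else (Mk (Hw p) (qp p) i j * (x i * y j) ^ (3/4:ℝ))) := by
          simp_rw [mul_sum, mul_ite, mul_zero]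
      _ ≤ Z * (3*(16*Hw p*qp p)^4) := mul_le_mul_of_nonneg_left hk2 hZ0.le
      _ ≤ _ := mul_le_mul_of_nonneg_right hbig.le (by positivity)

/-- the total defect attached to a large prime -/
noncomputable def cc (p : ℕ) : ℝ := 2*(16*Hw p*qp p)^6 + 4/√(p:ℝ) * (3*(16*Hw p*qp p)^4)

lemma hh_log (P : Finset ℕ) (u v : ℕ → ℕ) : hh P u v = exp (∑ p ∈ P, if u p = v p then 0 else 4 / √(p:ℝ)) := by
  rw [hh, Real.exp_sum]
  refine prod_congr rfl fun p _ => ?_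
  split_ifs
  · simp
  · rfl

open Classical in
lemma large (P : Finset ℕ) (hP : ∀ p ∈ P, p.Prime) (hsm : ∀ p ∈ P, 1024 * Hw p * qp p ≤ 1)
    (hsum : ∑ p ∈ P, cc p ≤ 1/2) : DSst P (4 * exp 1) := by
  induction P using Finset.strongInduction with
  | H P ih =>
  intro A B e f ψ θ hψ hθ hA hB
  by_contra hcon
  push Not at hcon
  have W1 := wt_nonneg P hP e ψ hψ
  have W2 := wt_nonneg P hP f θ hθ
  set T := ∑ a ∈ A, ∑ b ∈ B, tm P e f ψ θ a b with hT
  set X := ∑ a ∈ A, wt P e ψ a with hX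
  set Y := ∑ b ∈ B, wt P f θ b with hY
  have hX0 : 0 ≤ X := sum_nonneg fun a _ => W1 a
  have hY0 : 0 ≤ Y := sum_nonneg fun a _ => W2 a
  have ex1 : 0 < exp 1 := exp_pos 1
  have hT0 : 0 < T := lt_of_le_of_lt (by positivity) hcon
  have hXp : 0 < X := by
    rcases hX0.eq_or_lt with h | h
    · exfalso
      rw [eq_comm, hX, Finset.sum_eq_zero_iff_of_nonneg (fun a _ => W1 a)] at h
      have : T = 0 := by
        refine sum_eq_zero fun a ha => sum_eq_zero fun b hb => ?_
        simp [tm, h a ha]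
      linarith
    · exact h
  have hYp : 0 < Y := by
    rcases hY0.eq_or_lt with h | h
    · exfalso
      rw [eq_comm, hY, Finset.sum_eq_zero_iff_of_nonneg (fun a _ => W2 a)] at h
      have : T = 0 := by
        refine sum_eq_zero fun a ha => sum_eq_zero fun b hb => ?_
        simp [tm, h b hb]
      linarith
    · exact h
  have hk : ∀ p ∈ P, ∃ k : ℕ, (∑ a ∈ A, ∑ b ∈ B, (if e a p ≠ k ∧ f b p ≠ k then tm P e f ψ θ a b else 0) ≤ T * (2*(16*Hw p*qp p)^6)) ∧
      (∑ a ∈ A, ∑ b ∈ B, (if e a p = k ∧ f b p = k then 0 else tm P e f ψ θ a b) ≤ T * (3*(16*Hw p*qp p)^4)) := by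
    intro p hp
    have cc0 : ∀ r ∈ P, 0 ≤ cc r := fun r hr => by
      have := (qp_pos r (hP r hr)).le
      have := Hw_one_le r
      unfold cc; positivity
    have hi := ih (P.erase p) (Finset.erase_ssubset hp) (fun r hr => hP r (mem_of_mem_erase hr))
      (fun r hr => hsm r (mem_of_mem_erase hr))
      ((sum_le_sum_of_subset_of_nonneg (Finset.erase_subset _ _) (fun r hr _ => cc0 r hr)).trans hsum)
    have := offk (P.erase p) p (hP p hp) (Finset.notMem_erase p P) _ (by positivity) hi A B e f ψ θ hψ hθ
      (fun r hr => hP r (mem_of_mem_erase hr))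
    rw [Finset.insert_erase hp] at this
    exact this hA hB (hsm p hp) hXp hYp T hT hcon
  choose! k hk1 hk2 using hk
  obtain ⟨E, hE⟩ : ∃ E : ℕ → ℕ → Prop, ∀ a b, E a b ↔ Edge P e f ψ θ a b ∧ (∀ p ∈ P, e a p = k p ∨ f b p = k p) ∧
    hh P (e a) (f b) ≤ exp 1 := ⟨_, fun _ _ => Iff.rfl⟩
  have FA := finalArg P hP k e f ψ θ hψ hθ A B hA hB E (fun a b h => ((hE a b).1 h).1) (fun a b h => ((hE a b).1 h).2.1)
  have pt : ∀ a b, tm P e f ψ θ a b ≤ exp 1 * (if E a b then wt P e ψ a * wt P f θ b else 0) +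
      ∑ p ∈ P, ((if e a p ≠ k p ∧ f b p ≠ k p then tm P e f ψ θ a b else 0) +
        4/√(p:ℝ) * (if e a p = k p ∧ f b p = k p then 0 else tm P e f ψ θ a b)) := by
    intro a b
    have t0 := tm_nonneg P hP e f ψ θ hψ hθ a b
    have s0 : ∀ p ∈ P, 0 ≤ ((if e a p ≠ k p ∧ f b p ≠ k p then tm P e f ψ θ a b else 0) +
        4/√(p:ℝ) * (if e a p = k p ∧ f b p = k p then 0 else tm P e f ψ θ a b)) := by
      intro p _
      refine add_nonneg ?_ (mul_nonneg (by positivity) ?_) <;> split_ifs <;> simp [t0]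
    have wn : 0 ≤ exp 1 * (if E a b then wt P e ψ a * wt P f θ b else 0) := by
      refine mul_nonneg ex1.le ?_
      split_ifs
      exacts [mul_nonneg (W1 a) (W2 b), le_rfl]
    by_cases h1 : ∀ p ∈ P, e a p = k p ∨ f b p = k p
    · by_cases h2 : hh P (e a) (f b) ≤ exp 1
      · refine le_trans ?_ (le_add_of_nonneg_right (sum_nonneg s0))
        unfold tm
        by_cases h3 : Edge P e f ψ θ a b
        · have : E a b := (hE a b).2 ⟨h3, h1, h2⟩
          rw [if_pos h3, if_pos this, mul_comm]
          exact mul_le_mul_of_nonneg_right h2 (mul_nonneg (W1 a) (W2 b))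
        · rw [if_neg h3]; exact wn
      · refine le_trans ?_ (le_add_of_nonneg_left wn)
        push Not at h2
        rw [hh_log, Real.exp_lt_exp] at h2
        calc tm P e f ψ θ a b ≤ (∑ p ∈ P, if e a p = f b p then 0 else 4 / √(p:ℝ)) * tm P e f ψ θ a b := by nlinarith
          _ ≤ _ := by
            rw [sum_mul]
            refine sum_le_sum fun p hp => ?_
            have q4 : 0 ≤ 4 / √(p:ℝ) := by positivity
            have q5 : 0 ≤ 4 / √(p:ℝ) * tm P e f ψ θ a b := by positivity
            by_cases h5 : e a p = k p ∧ f b p = k p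
            · simp [h5.1, h5.2]
            · rw [if_neg h5]
              split_ifs <;> linarith
    · refine le_trans ?_ (le_add_of_nonneg_left wn)
      push Not at h1
      obtain ⟨p, hp, h⟩ := h1
      refine le_trans ?_ (single_le_sum s0 hp)
      rw [if_pos h]
      refine le_add_of_nonneg_right (mul_nonneg (by positivity) ?_)
      split_ifs <;> simp [t0]
  have total : T ≤ exp 1 * (2 * (X * Y) ^ (3/4:ℝ)) + T * (1/2) := by
    calc T ≤ ∑ a ∈ A, ∑ b ∈ B, (exp 1 * (if E a b then wt P e ψ a * wt P f θ b else 0) +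
      ∑ p ∈ P, ((if e a p ≠ k p ∧ f b p ≠ k p then tm P e f ψ θ a b else 0) +
        4/√(p:ℝ) * (if e a p = k p ∧ f b p = k p then 0 else tm P e f ψ θ a b))) :=
          sum_le_sum fun a _ => sum_le_sum fun b _ => pt a b
      _ = exp 1 * ∑ a ∈ A, ∑ b ∈ B, (if E a b then wt P e ψ a * wt P f θ b else 0) +
        ∑ p ∈ P, (∑ a ∈ A, ∑ b ∈ B, (if e a p ≠ k p ∧ f b p ≠ k p then tm P e f ψ θ a b else 0) +
          4/√(p:ℝ) * ∑ a ∈ A, ∑ b ∈ B, (if e a p = k p ∧ f b p = k p then 0 else tm P e f ψ θ a b)) := by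
          simp_rw [sum_add_distrib, mul_sum]
          congr 1
          congr 1
          · rw [sum_comm]
            refine (sum_congr rfl fun a _ => sum_comm).trans ?_
            rw [sum_comm, sum_congr rfl fun p _ => sum_comm]
          · rw [sum_comm]
            refine (sum_congr rfl fun a _ => sum_comm).trans ?_
            rw [sum_comm, sum_congr rfl fun p _ => sum_comm]
      _ ≤ exp 1 * (2 * (X * Y) ^ (3/4:ℝ)) + ∑ p ∈ P, T * cc p := by
          refine add_le_add (mul_le_mul_of_nonneg_left FA ex1.le) (sum_le_sum fun p hp => ?_)
          have q4 : 0 ≤ 4 / √(p:ℝ) := by positivity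
          have := mul_le_mul_of_nonneg_left (hk2 p hp) q4
          have := hk1 p hp
          unfold cc
          nlinarith
      _ ≤ _ := by
          rw [← mul_sum]
          gcongr
  linarith

lemma cc_le (p : ℕ) (hp : p.Prime) : cc p ≤ (2*(16*exp 4)^6 + 12*(16*exp 4)^4) * (p:ℝ) ^ (-(3/2):ℝ) := by
  have hp0 : (0:ℝ) < p := by exact_mod_cast hp.pos
  have hH := Hw_le p hp
  have H1 := Hw_one_le p
  have e1 : (qp p) ^ 6 = (p:ℝ) ^ (-(3/2):ℝ) := by
    rw [qp, ← rpow_natCast, ← rpow_mul hp0.le]; norm_num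
  have e2 : 1 / √(p:ℝ) * (qp p) ^ 4 = (p:ℝ) ^ (-(3/2):ℝ) := by
    rw [qp, ← rpow_natCast, ← rpow_mul hp0.le, sqrt_eq_rpow, one_div, ← rpow_neg hp0.le,
      ← rpow_add hp0]; norm_num
  unfold cc
  have a1 : 2*(16*Hw p*qp p)^6 = 2*(16*Hw p)^6 * (p:ℝ) ^ (-(3/2):ℝ) := by rw [← e1]; ring
  have a2 : 4/√(p:ℝ) * (3*(16*Hw p*qp p)^4) = 12*(16*Hw p)^4 * (p:ℝ) ^ (-(3/2):ℝ) := by rw [← e2]; ring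
  rw [a1, a2, ← add_mul]
  gcongr

theorem thmM0 : ∃ p0 : ℕ, ∀ P : Finset ℕ, (∀ p ∈ P, p.Prime ∧ p0 < p) → DSst P (4 * exp 1) := by
  set K := (2*(16*exp 4)^6 + 12*(16*exp 4)^4) with hK
  have hK0 : 0 < K := by positivity
  have hs : Summable (fun n : ℕ => (n:ℝ) ^ (-(3/2):ℝ)) := Real.summable_nat_rpow.2 (by norm_num)
  obtain ⟨s, hs⟩ := summable_iff_vanishing_norm.1 hs (1/(2*K)) (by positivity)
  have ht : Filter.Tendsto (fun n : ℕ => (n:ℝ) ^ (-(1/4):ℝ)) Filter.atTop (nhds 0) :=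
    (tendsto_rpow_neg_atTop (by norm_num)).comp tendsto_natCast_atTop_atTop
  obtain ⟨m, hm⟩ := Filter.eventually_atTop.1 (ht.eventually (gt_mem_nhds (show (0:ℝ) < 1/(1024 * exp 4) by positivity)))
  refine ⟨max m (s.sup id), fun P hP => large P (fun p hp => (hP p hp).1) ?_ ?_⟩
  · intro p hp
    have h := hm p ((le_max_left _ _).trans (hP p hp).2.le)
    rw [lt_div_iff₀ (by positivity)] at h
    have := Hw_le p (hP p hp).1
    have := qp_pos p (hP p hp).1
    have h' : qp p * (1024 * exp 4) < 1 := h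
    nlinarith
  · have hd : Disjoint P s := by
      rw [Finset.disjoint_left]
      intro a ha has
      have := (hP a ha).2
      have h3 : a ≤ s.sup id := Finset.le_sup (f := id) has
      have := le_max_right m (s.sup id)
      omega
    have h := hs P hd
    have h1 : ∑ p ∈ P, (p:ℝ) ^ (-(3/2):ℝ) ≤ 1/(2*K) := (le_abs_self _).trans h.le
    calc _ ≤ ∑ p ∈ P, K * (p:ℝ) ^ (-(3/2):ℝ) := sum_le_sum fun p hp => cc_le p (hP p hp).1
      _ ≤ K * (1/(2*K)) := by rw [← mul_sum]; gcongr
      _ = 1/2 := by field_simp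

theorem thmM : ∃ C : ℝ, 0 < C ∧ ∀ P : Finset ℕ, (∀ p ∈ P, p.Prime) → DSst P C := by
  obtain ⟨p0, h0⟩ := thmM0
  have mono : ∀ P C C', C ≤ C' → (∀ p ∈ P, p.Prime) → DSst P C → DSst P C' := by
    intro P C C' hC hP h A B e f ψ θ hψ hθ hA hB
    refine (h A B e f ψ θ hψ hθ hA hB).trans (mul_le_mul_of_nonneg_right hC ?_)
    exact rpow_nonneg (mul_nonneg (sum_nonneg fun a _ => wt_nonneg _ hP _ _ hψ a)
      (sum_nonneg fun a _ => wt_nonneg _ hP _ _ hθ a)) _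
  have : ∀ n : ℕ, ∃ C : ℝ, 0 < C ∧ ∀ P : Finset ℕ, (∀ p ∈ P, p.Prime ∧ p0 < p + n) → DSst P C := by
    intro n
    induction n with
    | zero => exact ⟨_, by positivity, h0⟩
    | succ n ih =>
      obtain ⟨C, hC, h⟩ := ih
      by_cases hpp : (p0 - n).Prime
      · obtain ⟨K, hK1, hK⟩ := addsmall _ hpp
        refine ⟨C * K, by positivity, fun P hP => ?_⟩
        by_cases hin : (p0 - n) ∈ P
        · rw [← Finset.insert_erase hin]
          refine hK _ C (Finset.notMem_erase _ _) hC.le (fun p hp => (hP p (mem_of_mem_erase hp)).1) (h _ fun p hp => ?_)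
          have := hP p (mem_of_mem_erase hp)
          have := ne_of_mem_erase hp
          have := hpp.pos
          exact ⟨(hP p (mem_of_mem_erase hp)).1, by omega⟩
        · refine mono P C _ (by nlinarith) (fun p hp => (hP p hp).1) (h P fun p hp => ⟨(hP p hp).1, ?_⟩)
          have := (hP p hp).2
          have : p ≠ p0 - n := fun h => hin (h ▸ hp)
          omega
      · refine ⟨C, hC, fun P hP => h P fun p hp => ⟨(hP p hp).1, ?_⟩⟩
        have := (hP p hp).2
        have : p ≠ p0 - n := fun h => hpp (h ▸ (hP p hp).1)
        omega
  obtain ⟨C, hC, h⟩ := this p0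
  exact ⟨C, hC, fun P hP => h P fun p hp => ⟨hP p hp, by have := (hP p hp).pos; omega⟩⟩

noncomputable def muw (ψ : ℕ → ℝ) (n : ℕ) : ℝ := (Nat.totient n : ℝ) * ψ n / n
noncomputable def Dd (ψ : ℕ → ℝ) (q r : ℕ) : ℝ := max ((r:ℝ) * ψ q) ((q:ℝ) * ψ r) / (Nat.gcd q r : ℝ)
def Pd (q r : ℕ) : Finset ℕ := ((q / Nat.gcd q r) * (r / Nat.gcd q r)).primeFactors
noncomputable def hP (q r : ℕ) : ℝ := exp (4 * ∑ p ∈ Pd q r, 1 / √(p:ℝ))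

lemma divg_fact (q r : ℕ) (hq : q ≠ 0) (hr : r ≠ 0) (p : ℕ) :
    (r / Nat.gcd q r).factorization p = r.factorization p - q.factorization p := by
  rw [Nat.factorization_div (Nat.gcd_dvd_right q r), Nat.factorization_gcd hq hr]
  simp only [Finsupp.coe_tsub, Pi.sub_apply, Finsupp.inf_apply]
  omega

lemma divg_ne (q r : ℕ) (hr : r ≠ 0) : r / Nat.gcd q r ≠ 0 :=
  (Nat.div_pos (Nat.le_of_dvd (Nat.pos_of_ne_zero hr) (Nat.gcd_dvd_right q r)) (Nat.gcd_pos_of_pos_right _ (Nat.pos_of_ne_zero hr))).ne'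

lemma divg_ne' (q r : ℕ) (hq : q ≠ 0) : q / Nat.gcd q r ≠ 0 := by
  rw [Nat.gcd_comm]; exact divg_ne r q hq

lemma divg_fact' (q r : ℕ) (hq : q ≠ 0) (hr : r ≠ 0) (p : ℕ) :
    (q / Nat.gcd q r).factorization p = q.factorization p - r.factorization p := by
  rw [Nat.gcd_comm]; exact divg_fact r q hr hq p

lemma mem_Pd (q r : ℕ) (hq : q ≠ 0) (hr : r ≠ 0) (p : ℕ) :
    p ∈ Pd q r ↔ p.Prime ∧ q.factorization p ≠ r.factorization p := by
  unfold Pd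
  have h1 := divg_ne q r hr
  have h2 := divg_ne' q r hq
  rw [← Nat.support_factorization, Finsupp.mem_support_iff, Nat.factorization_mul h2 h1, Finsupp.add_apply,
    divg_fact q r hq hr, divg_fact' q r hq hr]
  constructor
  · intro h
    refine ⟨?_, by omega⟩
    by_contra hp
    rw [Nat.factorization_eq_zero_of_not_prime _ hp, Nat.factorization_eq_zero_of_not_prime _ hp] at h
    exact h rfl
  · intro h; omega

lemma prod_P_fact (N n : ℕ) (hn : n ≠ 0) (hN : n ≤ N) :
    (∏ p ∈ (range (N+1)).filter Nat.Prime, p ^ n.factorization p) = n := by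
  conv_rhs => rw [← Nat.prod_factorization_pow_eq_self hn]
  rw [Finsupp.prod]
  symm
  refine Finset.prod_subset ?_ fun p _ hp => ?_
  · intro p hp
    rw [Nat.support_factorization] at hp
    rw [mem_filter, mem_range]
    exact ⟨Nat.lt_succ_of_le ((Nat.le_of_mem_primeFactors hp).trans hN), Nat.prime_of_mem_primeFactors hp⟩
  · rw [Finsupp.notMem_support_iff.1 hp, pow_zero]

lemma prod_divg (N q r : ℕ) (hq : q ≠ 0) (hr : r ≠ 0) (hN : r ≤ N) :
    (∏ p ∈ (range (N+1)).filter Nat.Prime, (p:ℝ) ^ (r.factorization p - q.factorization p)) = (r:ℝ) / (Nat.gcd q r : ℝ) := by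
  have h := prod_P_fact N (r / Nat.gcd q r) (divg_ne q r hr) ((Nat.div_le_self _ _).trans hN)
  simp_rw [divg_fact q r hq hr] at h
  rw [← Nat.cast_div (Nat.gcd_dvd_right q r) (by
    have := Nat.gcd_pos_of_pos_right q (Nat.pos_of_ne_zero hr)
    exact_mod_cast this.ne')]
  rw [← h]; push_cast; rfl

lemma totient_ratio (n : ℕ) : (Nat.totient n : ℝ) = n * ∏ p ∈ n.primeFactors, (1 - 1/(p:ℝ)) := by
  have h := Nat.totient_eq_mul_prod_factors n
  have h2 := congrArg (fun x : ℚ => (x:ℝ)) h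
  push_cast at h2
  simpa [one_div] using h2

lemma prod_Fp (N n : ℕ) (hn : n ≠ 0) (hN : n ≤ N) :
    (∏ p ∈ (range (N+1)).filter Nat.Prime, Fp p (n.factorization p)) = (Nat.totient n : ℝ) / n := by
  have : (n:ℝ) ≠ 0 := by exact_mod_cast hn
  rw [totient_ratio, mul_div_cancel_left₀ _ this]
  rw [← Finset.prod_subset (s₁ := n.primeFactors)]
  · refine prod_congr rfl fun p hp => ?_
    have : n.factorization p ≠ 0 := by
      rw [← Finsupp.mem_support_iff, Nat.support_factorization]; exact hp
    simp [Fp, this]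
  · intro p hp
    rw [mem_filter, mem_range]
    exact ⟨Nat.lt_succ_of_le ((Nat.le_of_mem_primeFactors hp).trans hN), Nat.prime_of_mem_primeFactors hp⟩
  · intro p _ hp
    have : n.factorization p = 0 := by
      rw [← Nat.support_factorization] at hp
      exact Finsupp.notMem_support_iff.1 hp
    simp [Fp, this]

lemma hh_hP (N q r : ℕ) (hq : q ≠ 0) (hr : r ≠ 0) (hN : q ≤ N) (hN' : r ≤ N) :
    hh ((range (N+1)).filter Nat.Prime) (fun p => q.factorization p) (fun p => r.factorization p) = hP q r := by
  rw [hh_log, hP, mul_sum]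
  congr 1
  rw [← sum_subset (s₁ := Pd q r)]
  · refine sum_congr rfl fun p hp => ?_
    rw [if_neg ((mem_Pd q r hq hr p).1 hp).2]; ring
  · intro p hp
    have h := (mem_Pd q r hq hr p).1 hp
    rw [mem_filter, mem_range]
    refine ⟨?_, h.1⟩
    by_contra hc
    apply h.2
    rw [Nat.factorization_eq_zero_of_lt (by omega), Nat.factorization_eq_zero_of_lt (by omega)]
  · intro p hp hpn
    rw [mem_Pd q r hq hr] at hpn
    rw [if_pos]
    by_contra hc
    exact hpn ⟨(mem_filter.1 hp).2, hc⟩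

open Classical in
theorem transfer : ∃ C : ℝ, 0 < C ∧ ∀ (ψ : ℕ → ℝ), (∀ n, 0 ≤ ψ n) → ∀ (N : ℕ) (t : ℝ), 0 < t →
    ∑ q ∈ Icc 1 N, ∑ r ∈ Icc 1 N, (if Dd ψ q r ≤ t then muw ψ q * muw ψ r * hP q r else 0) ≤
      C * t ^ (1/2:ℝ) * (∑ n ∈ Icc 1 N, muw ψ n) ^ (3/2:ℝ) := by
  obtain ⟨C, hC, h⟩ := thmM
  refine ⟨C, hC, fun ψ hψ N t ht => ?_⟩
  set P := (range (N+1)).filter Nat.Prime with hPd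
  set e : ℕ → ℕ → ℕ := fun n p => n.factorization p with he
  have hPp : ∀ p ∈ P, p.Prime := fun p hp => (mem_filter.1 hp).2
  have inj : InjP P e (Icc 1 N) := by
    intro a ha b hb hab
    rw [mem_Icc] at ha hb
    rw [← prod_P_fact N a (by omega) ha.2, ← prod_P_fact N b (by omega) hb.2]
    exact prod_congr rfl fun p hp => by rw [show a.factorization p = b.factorization p from hab p hp]
  have main := h P hPp (Icc 1 N) (Icc 1 N) e e (fun n => ψ n / t) (fun n => ψ n / t)
    (fun a => div_nonneg (hψ a) ht.le) (fun a => div_nonneg (hψ a) ht.le) inj inj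
  have w : ∀ n ∈ Icc 1 N, wt P e (fun n => ψ n / t) n = muw ψ n / t := by
    intro n hn
    rw [mem_Icc] at hn
    rw [wt, prod_Fp N n (by omega) hn.2, muw]; ring
  rw [sum_congr rfl w, ← sum_div] at main
  set M := ∑ n ∈ Icc 1 N, muw ψ n with hM
  have hM0 : 0 ≤ M := sum_nonneg fun n _ => by
    have := hψ n
    unfold muw; positivity
  have e1 : (M / t * (M / t)) ^ (3/4:ℝ) = M ^ (3/2:ℝ) / t ^ (3/2:ℝ) := by
    rw [← div_rpow hM0 ht.le, ← sq, ← rpow_natCast, ← rpow_mul (by positivity)]; norm_num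
  rw [e1] at main
  have e2 : ∀ q ∈ Icc 1 N, ∀ r ∈ Icc 1 N,
      (if Dd ψ q r ≤ t then muw ψ q * muw ψ r * hP q r else 0) = t ^ 2 * tm P e e (fun n => ψ n / t) (fun n => ψ n / t) q r := by
    intro q hq r hr
    have wq := w q hq
    have wr := w r hr
    rw [mem_Icc] at hq hr
    have hq0 : q ≠ 0 := by omega
    have hr0 : r ≠ 0 := by omega
    have hg : (0:ℝ) < Nat.gcd q r := by exact_mod_cast Nat.gcd_pos_of_pos_right q (Nat.pos_of_ne_zero hr0)
    have hE : Edge P e e (fun n => ψ n / t) (fun n => ψ n / t) q r ↔ Dd ψ q r ≤ t := by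
      unfold Edge
      simp only [he]
      rw [prod_divg N q r hq0 hr0 hr.2, prod_divg N r q hr0 hq0 hq.2, Dd, Nat.gcd_comm r q, div_le_iff₀ hg, max_le_iff]
      rw [div_mul_div_comm, div_mul_div_comm, div_le_one (by positivity), div_le_one (by positivity)]
      rw [mul_comm (ψ q), mul_comm (ψ r)]
    unfold tm
    by_cases hc : Dd ψ q r ≤ t
    · rw [if_pos hc, if_pos (hE.2 hc), wq, wr, hh_hP N q r hq0 hr0 hq.2 hr.2]
      field_simp
    · rw [if_neg hc, if_neg (fun h => hc (hE.1 h)), mul_zero]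
  rw [sum_congr rfl fun q hq => sum_congr rfl fun r hr => e2 q hq r hr]
  simp_rw [← mul_sum]
  calc _ ≤ t ^ 2 * (C * (M ^ (3/2:ℝ) / t ^ (3/2:ℝ))) := by gcongr
    _ = C * (t ^ 2 / t ^ (3/2:ℝ)) * M ^ (3/2:ℝ) := by ring
    _ = _ := by
      rw [← rpow_natCast t 2, ← Real.rpow_sub ht]; norm_num

/-- CRT averaging -/
lemma perm_sum (p r t : ℕ) (hr : 0 < r) (hpr : Nat.Coprime p r) (G : ℕ → ℝ) (hG : ∀ j, G (j % r) = G j) :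
    ∑ i ∈ range r, G (t + p * i) = ∑ i ∈ range r, G i := by
  have himg : (range r).image (fun i => (t + p * i) % r) = range r := by
    apply Finset.eq_of_subset_of_card_le
    · intro x hx
      obtain ⟨i, _, rfl⟩ := mem_image.1 hx
      exact mem_range.2 (Nat.mod_lt _ hr)
    · rw [Finset.card_image_of_injOn]
      intro i hi j hj hij
      have hi' := mem_range.1 hi
      have hj' := mem_range.1 hj
      have h1 : t + p * i ≡ t + p * j [MOD r] := hij
      have h2 : p * i ≡ p * j [MOD r] := Nat.ModEq.add_left_cancel' t h1
      have h3 : i ≡ j [MOD r] := Nat.ModEq.cancel_left_of_coprime (by rw [Nat.coprime_comm] at hpr; exact hpr) h2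
      rw [Nat.ModEq, Nat.mod_eq_of_lt hi', Nat.mod_eq_of_lt hj'] at h3
      exact h3
  have hinj : Set.InjOn (fun i => (t + p * i) % r) (range r) := by
    apply Finset.injOn_of_card_image_eq
    rw [himg]
  conv_rhs => rw [← himg]
  rw [sum_image hinj]
  exact sum_congr rfl fun i _ => (hG _).symm

lemma crt_sum (Q : Finset ℕ) : (∀ p ∈ Q, p.Prime) → ∀ (M : ℕ) (_ : (∏ p ∈ Q, p) ∣ M)
    (G : ℕ → ℕ → ℝ) (_ : ∀ p ∈ Q, ∀ j, G p (j % p) = G p j),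
    ∑ j ∈ range M, ∏ p ∈ Q, G p j = M * ∏ p ∈ Q, ((∑ i ∈ range p, G p i) / p) := by
  induction Q using Finset.induction_on with
  | empty => intro _ M _ G _; simp
  | insert p Q hpQ ih =>
    intro hQ M hM G hG
    have hp := hQ p (mem_insert_self _ _)
    rw [prod_insert hpQ] at hM
    obtain ⟨c, hc⟩ := hM
    obtain ⟨M', hM', hQM'⟩ : ∃ M', M = M' * p ∧ (∏ p ∈ Q, p) ∣ M' := ⟨(∏ p ∈ Q, p) * c, by rw [hc]; ring, Dvd.intro _ rfl⟩
    subst hM'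
    have split : ∀ F : ℕ → ℝ, ∑ j ∈ range (M' * p), F j = ∑ t ∈ range p, ∑ i ∈ range M', F (t + p * i) := by
      intro F
      rw [sum_comm]
      clear hQM' hc
      induction M' with
      | zero => simp
      | succ n ihn =>
        rw [Nat.succ_mul, Finset.sum_range_add, ihn, sum_range_succ]
        congr 1
        exact sum_congr rfl fun i _ => by rw [mul_comm n p, add_comm]
    rw [split]
    have h1 : ∀ t ∈ range p, ∑ i ∈ range M', ∏ r ∈ insert p Q, G r (t + p * i) =
        G p t * (M' * ∏ r ∈ Q, ((∑ i ∈ range r, G r i) / r)) := by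
      intro t _
      have hI := ih (fun r hr => hQ r (mem_insert_of_mem hr)) M' hQM' (fun r i => G r (t + p * i)) (by
        intro r hr j
        rw [← hG r (mem_insert_of_mem hr) (t + p * (j % r)), ← hG r (mem_insert_of_mem hr) (t + p * j)]
        congr 1
        exact Nat.ModEq.add_left t (Nat.ModEq.mul_left p (Nat.mod_modEq j r)))
      have h2 : ∀ r ∈ Q, ∑ i ∈ range r, G r (t + p * i) = ∑ i ∈ range r, G r i := by
        intro r hr
        have hrp := hQ r (mem_insert_of_mem hr)
        refine perm_sum p r t hrp.pos ((Nat.coprime_primes hp hrp).2 ?_) _ (hG r (mem_insert_of_mem hr))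
        rintro rfl; exact hpQ hr
      rw [prod_congr rfl fun r hr => by rw [h2 r hr]] at hI
      rw [← hI, mul_sum]
      refine sum_congr rfl fun i _ => ?_
      rw [prod_insert hpQ]
      congr 1
      rw [← hG p (mem_insert_self _ _) (t + p * i), Nat.add_mul_mod_self_left, hG p (mem_insert_self _ _)]
    rw [sum_congr rfl h1, ← sum_mul, prod_insert hpQ]
    have : (p:ℝ) ≠ 0 := by exact_mod_cast hp.ne_zero
    push_cast
    field_simp

open Classical in
lemma one_root (p : ℕ) (hp : p.Prime) (α β : ℤ) (hβ : ¬ (p:ℤ) ∣ β) :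
    ∑ j ∈ range p, (if (p:ℤ) ∣ α + j * β then (1:ℝ) else 0) = 1 := by
  have := Fact.mk hp
  have hb : (β : ZMod p) ≠ 0 := fun h => hβ ((ZMod.intCast_zmod_eq_zero_iff_dvd β p).1 h)
  have key : ∀ j : ℕ, (p:ℤ) ∣ α + j * β ↔ ((j:ℕ) : ZMod p) = -(α : ZMod p) / β := by
    intro j
    rw [← ZMod.intCast_zmod_eq_zero_iff_dvd, eq_div_iff hb]
    push_cast
    constructor
    · intro h; linear_combination h
    · intro h; linear_combination h
  rw [Finset.sum_ite, Finset.sum_const_zero, add_zero, sum_const, nsmul_eq_mul, mul_one]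
  have : (range p).filter (fun j : ℕ => (p:ℤ) ∣ α + j * β) = {(-(α : ZMod p) / β).val} := by
    ext j
    rw [mem_filter, Finset.mem_singleton, mem_range, key]
    constructor
    · rintro ⟨h1, h2⟩
      rw [← h2, ZMod.val_cast_of_lt h1]
    · rintro rfl
      exact ⟨ZMod.val_lt _, by simp⟩
  rw [this]; simp

open Classical in
lemma count_nonpos (g : ℕ) (hg : 0 < g) (Q1 : Finset ℕ) (hQ1 : Q1 ⊆ g.primeFactors) (α β u v c : ℤ) (hc : c = α * v - β * u)
    (h1 : ∀ p ∈ Q1, ¬ ((p:ℤ) ∣ u) ∨ ¬ ((p:ℤ) ∣ v))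
    (h2 : ∀ p ∈ g.primeFactors \ Q1, ¬ ((p:ℤ) ∣ u) ∧ ¬ ((p:ℤ) ∣ v)) :
    (((range g).filter (fun j : ℕ => ∀ p ∈ g.primeFactors, ¬ ((p:ℤ) ∣ α + j * u) ∧ ¬ ((p:ℤ) ∣ β + j * v))).card : ℝ) ≤
      g * (∏ p ∈ Q1, (1 - 1/(p:ℝ))) * ∏ p ∈ g.primeFactors \ Q1, (1 - 2/(p:ℝ) + if (p:ℤ) ∣ c then 1/(p:ℝ) else 0) := by
  set G : ℕ → ℕ → ℝ := fun p j => if ¬ ((p:ℤ) ∣ α + j * u) ∧ ¬ ((p:ℤ) ∣ β + j * v) then 1 else 0 with hG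
  have hpr : ∀ p ∈ g.primeFactors, p.Prime := fun p hp => Nat.prime_of_mem_primeFactors hp
  have per : ∀ p ∈ g.primeFactors, ∀ j, G p (j % p) = G p j := by
    intro p _ j
    have aux : ∀ x y : ℤ, (p:ℤ) ∣ x + ((j % p : ℕ) : ℤ) * y ↔ (p:ℤ) ∣ x + j * y := by
      intro x y
      have : (p:ℤ) ∣ (x + j * y) - (x + ((j % p : ℕ) : ℤ) * y) := by
        have hj : (j:ℤ) = (p:ℤ) * ((j / p : ℕ):ℤ) + ((j % p : ℕ) : ℤ) := by
          exact_mod_cast (Nat.div_add_mod j p).symm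
        refine ⟨((j / p : ℕ):ℤ) * y, ?_⟩
        rw [hj]; push_cast; simp; ring
      exact (dvd_iff_dvd_of_dvd_sub this).symm
    simp only [hG, aux]
  have hcard : (((range g).filter (fun j : ℕ => ∀ p ∈ g.primeFactors, ¬ ((p:ℤ) ∣ α + j * u) ∧ ¬ ((p:ℤ) ∣ β + j * v))).card : ℝ)
      = ∑ j ∈ range g, ∏ p ∈ g.primeFactors, G p j := by
    rw [Finset.card_filter, Nat.cast_sum]
    refine sum_congr rfl fun j _ => ?_
    simp only [hG]
    split_ifs with h
    · rw [Finset.prod_eq_one]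
      · simp
      · intro p hp; rw [if_pos (h p hp)]
    · push Not at h
      obtain ⟨p, hp, hh⟩ := h
      rw [Finset.prod_eq_zero hp]
      · simp
      · rw [if_neg]; rintro ⟨h1, h2⟩; exact h2 (hh h1)
  rw [hcard, crt_sum g.primeFactors hpr g (Nat.prod_primeFactors_dvd g) G per]
  rw [← Finset.prod_sdiff hQ1, mul_comm (∏ p ∈ g.primeFactors \ Q1, _), ← mul_assoc]
  have G0 : ∀ p j, 0 ≤ G p j := fun p j => by simp only [hG]; split_ifs <;> norm_num
  have avg0 : ∀ p, 0 ≤ (∑ i ∈ range p, G p i) / p := fun p => div_nonneg (sum_nonneg fun i _ => G0 p i) (by positivity)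
  have b1 : ∀ p ∈ Q1, (∑ i ∈ range p, G p i) / p ≤ 1 - 1/(p:ℝ) := by
    intro p hp
    have hpp := hpr p (hQ1 hp)
    have hp0 : (0:ℝ) < p := by exact_mod_cast hpp.pos
    rw [div_le_iff₀ hp0, sub_mul, one_mul, one_div_mul_cancel hp0.ne']
    rcases h1 p hp with h | h
    · calc _ ≤ ∑ j ∈ range p, (1 - (if (p:ℤ) ∣ α + j * u then (1:ℝ) else 0)) := by
            refine sum_le_sum fun j _ => ?_
            simp only [hG]
            split_ifs <;> first | (exfalso; tauto) | norm_num
        _ = _ := by rw [sum_sub_distrib, one_root p hpp α u h]; simp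
    · calc _ ≤ ∑ j ∈ range p, (1 - (if (p:ℤ) ∣ β + j * v then (1:ℝ) else 0)) := by
            refine sum_le_sum fun j _ => ?_
            simp only [hG]
            split_ifs <;> first | (exfalso; tauto) | norm_num
        _ = _ := by rw [sum_sub_distrib, one_root p hpp β v h]; simp
  have b2 : ∀ p ∈ g.primeFactors \ Q1, (∑ i ∈ range p, G p i) / p ≤ 1 - 2/(p:ℝ) + if (p:ℤ) ∣ c then 1/(p:ℝ) else 0 := by
    intro p hp
    have hpp := hpr p (Finset.mem_sdiff.1 hp).1
    have hp0 : (0:ℝ) < p := by exact_mod_cast hpp.pos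
    obtain ⟨hu, hv⟩ := h2 p hp
    rw [div_le_iff₀ hp0]
    calc _ ≤ ∑ j ∈ range p, (1 - (if (p:ℤ) ∣ α + j * u then (1:ℝ) else 0) - (if (p:ℤ) ∣ β + j * v then (1:ℝ) else 0)
          + (if (p:ℤ) ∣ c then 1 else 0) * (if (p:ℤ) ∣ α + j * u then (1:ℝ) else 0)) := by
          refine sum_le_sum fun j _ => ?_
          have : (p:ℤ) ∣ α + j * u → (p:ℤ) ∣ β + j * v → (p:ℤ) ∣ c := by
            intro ha hb
            have e : c = (α + j * u) * v - (β + j * v) * u := by rw [hc]; ring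
            rw [e]
            exact dvd_sub (Dvd.dvd.mul_right ha _) (Dvd.dvd.mul_right hb _)
          simp only [hG]
          split_ifs <;> first | (exfalso; tauto) | norm_num
      _ = p - 1 - 1 + (if (p:ℤ) ∣ c then 1 else 0) := by
          rw [sum_add_distrib, sum_sub_distrib, sum_sub_distrib, ← mul_sum,
            one_root p hpp α u hu, one_root p hpp β v hv]; simp
      _ = _ := by
          split_ifs <;> field_simp <;> ring
  refine mul_le_mul (mul_le_mul_of_nonneg_left (Finset.prod_le_prod (fun p _ => avg0 p) b1) (by positivity))
    (Finset.prod_le_prod (fun p _ => avg0 p) b2) (prod_nonneg fun p _ => avg0 p)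
    (mul_nonneg (by positivity) (prod_nonneg fun p hp => (avg0 p).trans (b1 p hp)))

noncomputable def ovl (d1 d2 x : ℝ) : ℝ := max 0 (min (2 * min d1 d2) (d1 + d2 - |x|))
def Un (n : ℕ) : Finset ℕ := (range n).filter (fun a => Nat.Coprime a n)
noncomputable def I2 (ψ : ℕ → ℝ) (q r : ℕ) : ℝ :=
  ∑ a ∈ Un q, ∑ b ∈ Un r, ovl (ψ q / q) (ψ r / r) ((a:ℝ)/q - (b:ℝ)/r)
def Pe (q r : ℕ) : Finset ℕ := (Nat.gcd q r).primeFactors \ Pd q r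
noncomputable def Wf (Q : Finset ℕ) (c : ℕ) : ℝ := ∏ p ∈ Q, (1 - 2/(p:ℝ) + if p ∣ c then 1/(p:ℝ) else 0)
open Classical in
noncomputable def Wc (q r c : ℕ) : ℝ := if ∀ p ∈ Pd q r, ¬ p ∣ c then Wf (Pe q r) c else 0
noncomputable def kap (q r : ℕ) : ℝ := (Nat.gcd q r : ℝ) * ∏ p ∈ (Nat.gcd q r).primeFactors ∩ Pd q r, (1 - 1/(p:ℝ))

lemma fac1_nonneg (p : ℕ) : 0 ≤ 1 - 1/(p:ℝ) := by
  rcases Nat.eq_zero_or_pos p with rfl | h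
  · simp
  · have : (1:ℝ) ≤ p := by exact_mod_cast h
    rw [sub_nonneg, div_le_one (by linarith)]; exact this

lemma fac2_nonneg (p : ℕ) (hp : p.Prime) : 0 ≤ 1 - 2/(p:ℝ) := by
  have : (2:ℝ) ≤ p := by exact_mod_cast hp.two_le
  rw [sub_nonneg, div_le_one (by linarith)]; exact this

lemma kap_nonneg (q r : ℕ) : 0 ≤ kap q r :=
  mul_nonneg (by positivity) (prod_nonneg fun p _ => fac1_nonneg p)

lemma Pe_prime (q r p : ℕ) (hp : p ∈ Pe q r) : p.Prime := Nat.prime_of_mem_primeFactors (Finset.mem_sdiff.1 hp).1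
lemma Pd_prime (q r p : ℕ) (hp : p ∈ Pd q r) : p.Prime := Nat.prime_of_mem_primeFactors hp

lemma Wf_nonneg (Q : Finset ℕ) (hQ : ∀ p ∈ Q, p.Prime) (c : ℕ) : 0 ≤ Wf Q c := by
  refine prod_nonneg fun p hp => add_nonneg (fac2_nonneg p (hQ p hp)) ?_
  split_ifs <;> positivity

lemma Wc_nonneg (q r c : ℕ) : 0 ≤ Wc q r c := by
  unfold Wc
  split_ifs
  · exact Wf_nonneg _ (Pe_prime q r) _
  · exact le_rfl

lemma Ncount (q r : ℕ) (hq : 0 < q) (hr : 0 < r) (c : ℤ) :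
    ((((Un q) ×ˢ (Un r)).filter (fun x => (x.1:ℤ) * ((r / Nat.gcd q r : ℕ):ℤ) - (x.2:ℤ) * ((q / Nat.gcd q r : ℕ):ℤ) = c)).card : ℝ)
      ≤ kap q r * Wc q r c.natAbs := by
  classical
  set g := Nat.gcd q r with hg
  have hg0 : 0 < g := Nat.gcd_pos_of_pos_left _ hq
  set q' := q / g with hq'
  set r' := r / g with hr'
  have hqg : q = g * q' := (Nat.mul_div_cancel' (Nat.gcd_dvd_left q r)).symm
  have hrg : r = g * r' := (Nat.mul_div_cancel' (Nat.gcd_dvd_right q r)).symm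
  have hcop : Nat.Coprime q' r' := Nat.coprime_div_gcd_div_gcd hg0
  have hq'0 : 0 < q' := Nat.pos_of_ne_zero (divg_ne' q r hq.ne')
  have hr'0 : 0 < r' := Nat.pos_of_ne_zero (divg_ne q r hr.ne')
  set F := ((Un q) ×ˢ (Un r)).filter (fun x => (x.1:ℤ) * (r':ℤ) - (x.2:ℤ) * (q':ℤ) = c) with hF
  rcases F.eq_empty_or_nonempty with he | ⟨⟨a0, b0⟩, h0⟩
  · rw [he]; simpa using mul_nonneg (kap_nonneg q r) (Wc_nonneg q r _)
  have memF : ∀ a b, (a, b) ∈ F → a < q ∧ Nat.Coprime a q ∧ b < r ∧ Nat.Coprime b r ∧ (a:ℤ) * r' - (b:ℤ) * q' = c := by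
    intro a b h
    simp only [hF, Un, mem_filter, mem_product, mem_range] at h
    exact ⟨h.1.1.1, h.1.1.2, h.1.2.1, h.1.2.2, h.2⟩
  obtain ⟨ha0, hca0, hb0, hcb0, hc0⟩ := memF a0 b0 h0
  have prC : ∀ p a n : ℕ, p.Prime → Nat.Coprime a n → p ∣ n → ¬ p ∣ a := by
    intro p a n hp hc hn ha
    exact hp.one_lt.ne' (Nat.dvd_one.1 (hc ▸ Nat.dvd_gcd ha hn))
  have hPdq : ∀ p ∈ Pd q r, (p ∣ q' ∧ ¬ p ∣ r') ∨ (p ∣ r' ∧ ¬ p ∣ q') := by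
    intro p hp
    have hpp := Pd_prime q r p hp
    have hd : p ∣ q' * r' := Nat.dvd_of_mem_primeFactors hp
    rcases (Nat.Prime.dvd_mul hpp).1 hd with h | h
    · exact Or.inl ⟨h, fun h2 => hpp.one_lt.ne' (Nat.dvd_one.1 (hcop ▸ Nat.dvd_gcd h h2))⟩
    · exact Or.inr ⟨h, fun h2 => hpp.one_lt.ne' (Nat.dvd_one.1 (hcop ▸ Nat.dvd_gcd h2 h))⟩
  have hW : ∀ p ∈ Pd q r, ¬ p ∣ c.natAbs := by
    intro p hp hpc
    have hpp := Pd_prime q r p hp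
    have hpc' : (p:ℤ) ∣ c := Int.natCast_dvd.2 hpc
    rcases hPdq p hp with ⟨h1, h2⟩ | ⟨h1, h2⟩
    · have : (p:ℤ) ∣ (a0:ℤ) * r' := by
        have e : (a0:ℤ) * r' = c + b0 * q' := by linarith
        rw [e]; exact dvd_add hpc' (Dvd.dvd.mul_left (Int.natCast_dvd_natCast.2 h1) _)
      have : p ∣ a0 * r' := by exact_mod_cast this
      rcases (Nat.Prime.dvd_mul hpp).1 this with h | h
      · exact prC p a0 q hpp hca0 (hqg ▸ Dvd.dvd.mul_left h1 _) h
      · exact h2 h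
    · have : (p:ℤ) ∣ (b0:ℤ) * q' := by
        have e : (b0:ℤ) * q' = a0 * r' - c := by linarith
        rw [e]; exact dvd_sub (Dvd.dvd.mul_left (Int.natCast_dvd_natCast.2 h1) _) hpc'
      have : p ∣ b0 * q' := by exact_mod_cast this
      rcases (Nat.Prime.dvd_mul hpp).1 this with h | h
      · exact prC p b0 r hpp hcb0 (hrg ▸ Dvd.dvd.mul_left h1 _) h
      · exact h2 h
  have hWc : Wc q r c.natAbs = ∏ p ∈ g.primeFactors \ (g.primeFactors ∩ Pd q r), (1 - 2/(p:ℝ) + if (p:ℤ) ∣ c then 1/(p:ℝ) else 0) := by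
    rw [Wc, if_pos hW, Wf, Pe, ← hg, Finset.sdiff_inter_self_left]
    refine prod_congr rfl fun p _ => ?_
    simp only [Int.natCast_dvd]
  set α : ℤ := ((a0 % q' : ℕ) : ℤ) with hα
  set β : ℤ := (b0:ℤ) - ((a0 / q' : ℕ):ℤ) * r' with hβ
  have hq'z : (q':ℤ) ≠ 0 := by exact_mod_cast hq'0.ne'
  have hdm0 : (a0:ℤ) = (q':ℤ) * ((a0 / q' : ℕ):ℤ) + ((a0 % q' : ℕ) : ℤ) := by
    exact_mod_cast (Nat.div_add_mod a0 q').symm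
  have par : ∀ a b, (a, b) ∈ F → (a:ℤ) = α + ((a / q' : ℕ):ℤ) * q' ∧ (b:ℤ) = β + ((a / q' : ℕ):ℤ) * r' := by
    intro a b h
    obtain ⟨_, _, _, _, hc⟩ := memF a b h
    have hdm : (a:ℤ) = (q':ℤ) * ((a / q' : ℕ):ℤ) + ((a % q' : ℕ) : ℤ) := by
      exact_mod_cast (Nat.div_add_mod a q').symm
    have hd : (q':ℤ) ∣ ((a:ℤ) - a0) * r' := ⟨(b:ℤ) - b0, by linear_combination hc - hc0⟩
    have hd2 : (q':ℤ) ∣ (a:ℤ) - a0 := by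
      refine IsCoprime.dvd_of_dvd_mul_right (Nat.isCoprime_iff_coprime.2 hcop) hd
    have hmod : a % q' = a0 % q' := by
      have : (a0:ℤ) ≡ a [ZMOD q'] := (Int.modEq_iff_dvd.2 hd2)
      exact ((Int.natCast_modEq_iff.1 this)).symm
    have ea : (a:ℤ) = α + ((a / q' : ℕ):ℤ) * q' := by
      rw [hα, ← hmod]; linear_combination hdm
    refine ⟨ea, ?_⟩
    have : (b:ℤ) * q' = (β + ((a / q' : ℕ):ℤ) * r') * q' := by
      rw [hβ]
      linear_combination hc0 - hc + r' * ea - r' * hdm0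
    exact mul_right_cancel₀ hq'z this
  have hcv : c = α * r' - β * q' := by
    rw [hβ, hα]; linear_combination r' * hdm0 - hc0
  have bound := count_nonpos g hg0 (g.primeFactors ∩ Pd q r) Finset.inter_subset_left α β q' r' c hcv
    (by
      intro p hp
      rcases hPdq p (Finset.mem_inter.1 hp).2 with h | h
      · exact Or.inr fun hh => h.2 (Int.natCast_dvd_natCast.1 hh)
      · exact Or.inl fun hh => h.2 (Int.natCast_dvd_natCast.1 hh))
    (by
      intro p hp
      rw [Finset.sdiff_inter_self_left, Finset.mem_sdiff] at hp
      have hpp := Nat.prime_of_mem_primeFactors hp.1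
      constructor <;> intro hh <;> apply hp.2 <;> have h3 := Int.natCast_dvd_natCast.1 hh
      · exact Nat.mem_primeFactors.2 ⟨hpp, Dvd.dvd.mul_right h3 _, (Nat.mul_pos hq'0 hr'0).ne'⟩
      · exact Nat.mem_primeFactors.2 ⟨hpp, Dvd.dvd.mul_left h3 _, (Nat.mul_pos hq'0 hr'0).ne'⟩)
  rw [hWc, kap, ← hg]
  refine le_trans ?_ bound
  rw [Nat.cast_le]
  refine Finset.card_le_card_of_injOn (fun x => x.1 / q') ?_ ?_
  · rintro ⟨a, b⟩ hab
    obtain ⟨h1, h2, h3, h4, h5⟩ := memF a b hab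
    obtain ⟨p1, p2⟩ := par a b hab
    simp only [Finset.coe_filter, Set.mem_setOf_eq, mem_range]
    refine ⟨Nat.div_lt_of_lt_mul (by rw [mul_comm, ← hqg]; exact h1), fun p hp => ?_⟩
    rw [← p1, ← p2]
    have hpp := Nat.prime_of_mem_primeFactors hp
    have hpg := Nat.dvd_of_mem_primeFactors hp
    exact ⟨fun hh => prC p a q hpp h2 (hqg ▸ Dvd.dvd.mul_right hpg _) (Int.natCast_dvd_natCast.1 hh),
      fun hh => prC p b r hpp h4 (hrg ▸ Dvd.dvd.mul_right hpg _) (Int.natCast_dvd_natCast.1 hh)⟩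
  · rintro ⟨a, b⟩ hab ⟨a', b'⟩ hab' heq
    obtain ⟨p1, p2⟩ := par a b hab
    obtain ⟨p1', p2'⟩ := par a' b' hab'
    simp only at heq
    rw [heq] at p1 p2
    have e1 : (a:ℤ) = a' := by rw [p1, p1']
    have e2 : (b:ℤ) = b' := by rw [p2, p2']
    rw [Prod.mk.injEq]
    exact ⟨by exact_mod_cast e1, by exact_mod_cast e2⟩

lemma ovl_nonneg (a b x : ℝ) : 0 ≤ ovl a b x := le_max_left _ _

lemma I2_le (ψ : ℕ → ℝ) (q r : ℕ) (hq : 0 < q) (hr : 0 < r) (hne : q ≠ r) (M : ℕ) (hM : q * r ≤ M) :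
    I2 ψ q r ≤ 2 * kap q r * ∑ n ∈ Icc 1 M, Wc q r n *
      ovl (ψ q / q) (ψ r / r) ((n:ℝ) / ((q:ℝ) * r / Nat.gcd q r)) := by
  classical
  set g := Nat.gcd q r with hg
  have hg0 : 0 < g := Nat.gcd_pos_of_pos_left _ hq
  set q' := q / g with hq'
  set r' := r / g with hr'
  have hqg : q = g * q' := (Nat.mul_div_cancel' (Nat.gcd_dvd_left q r)).symm
  have hrg : r = g * r' := (Nat.mul_div_cancel' (Nat.gcd_dvd_right q r)).symm
  have hq'0 : 0 < q' := Nat.pos_of_ne_zero (divg_ne' q r hq.ne')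
  have hr'0 : 0 < r' := Nat.pos_of_ne_zero (divg_ne q r hr.ne')
  set cf : ℕ × ℕ → ℤ := fun x => (x.1:ℤ) * (r':ℤ) - (x.2:ℤ) * (q':ℤ) with hcf
  set w : ℕ → ℝ := fun n => ovl (ψ q / q) (ψ r / r) ((n:ℝ) / ((q:ℝ) * r / g)) with hw
  have hgR : (0:ℝ) < g := by exact_mod_cast hg0
  have hqR : (0:ℝ) < q := by exact_mod_cast hq
  have hrR : (0:ℝ) < r := by exact_mod_cast hr
  have hqgR : (q:ℝ) = g * q' := by exact_mod_cast hqg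
  have hrgR : (r:ℝ) = g * r' := by exact_mod_cast hrg
  have hq'R : (0:ℝ) < q' := by exact_mod_cast hq'0
  have hr'R : (0:ℝ) < r' := by exact_mod_cast hr'0
  have e1 : I2 ψ q r = ∑ x ∈ (Un q) ×ˢ (Un r), w (cf x).natAbs := by
    rw [I2, Finset.sum_product]
    refine sum_congr rfl fun a _ => sum_congr rfl fun b _ => ?_
    simp only [hw, ovl]
    congr 3
    have : (((cf (a,b)).natAbs : ℕ):ℝ) = |((cf (a,b) : ℤ):ℝ)| := by
      rw [Nat.cast_natAbs, Int.cast_abs]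
    rw [this, abs_div, abs_abs, abs_of_pos (show (0:ℝ) < (q:ℝ) * r / g by positivity), ← abs_of_pos (show (0:ℝ) < (q:ℝ) * r / g by positivity), ← abs_div]
    congr 1
    simp only [hcf]
    push_cast
    rw [hqgR, hrgR]
    field_simp
  have mt : ∀ x ∈ (Un q) ×ˢ (Un r), (cf x).natAbs ∈ range (M+1) := by
    rintro ⟨a, b⟩ hx
    simp only [Un, mem_product, mem_filter, mem_range] at hx
    rw [mem_range, Nat.lt_succ_iff]
    refine le_trans ?_ hM
    have h1 : a * r' ≤ q * r := Nat.mul_le_mul hx.1.1.le (Nat.div_le_self _ _)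
    have h2 : b * q' ≤ q * r := by rw [mul_comm q r]; exact Nat.mul_le_mul hx.2.1.le (Nat.div_le_self _ _)
    have h1' : (a:ℤ) * r' ≤ q * r := by exact_mod_cast h1
    have h2' : (b:ℤ) * q' ≤ q * r := by exact_mod_cast h2
    have h3 : (0:ℤ) ≤ (a:ℤ) * r' := by positivity
    have h4 : (0:ℤ) ≤ (b:ℤ) * q' := by positivity
    have : |cf (a,b)| ≤ ((q * r : ℕ) : ℤ) := by
      simp only [hcf]; push_cast
      rw [abs_le]; constructor <;> linarith
    rw [Int.abs_eq_natAbs] at this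
    exact_mod_cast this
  have hPne : ∃ p, p ∈ Pd q r := by
    by_contra hcon
    push Not at hcon
    apply hne
    refine Nat.eq_of_factorization_eq hq.ne' hr.ne' fun p => ?_
    by_contra hne2
    have hpp : p.Prime := by
      by_contra hp
      rw [Nat.factorization_eq_zero_of_not_prime _ hp, Nat.factorization_eq_zero_of_not_prime _ hp] at hne2
      exact hne2 rfl
    exact hcon p ((mem_Pd q r hq.ne' hr.ne' p).2 ⟨hpp, hne2⟩)
  have W0 : Wc q r 0 = 0 := by
    obtain ⟨p, hp⟩ := hPne
    rw [Wc, if_neg]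
    push Not
    exact ⟨p, hp, dvd_zero _⟩
  have hcount : ∀ n : ℕ, ((((Un q) ×ˢ (Un r)).filter (fun x => (cf x).natAbs = n)).card : ℝ) ≤ 2 * kap q r * Wc q r n := by
    intro n
    have hsub : ((Un q) ×ˢ (Un r)).filter (fun x => (cf x).natAbs = n) ⊆
        ((Un q) ×ˢ (Un r)).filter (fun x => cf x = (n:ℤ)) ∪ ((Un q) ×ˢ (Un r)).filter (fun x => cf x = -(n:ℤ)) := by
      intro x hx
      rw [mem_filter] at hx
      rw [mem_union, mem_filter, mem_filter]
      rcases Int.natAbs_eq (cf x) with h | h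
      · left; exact ⟨hx.1, by rw [h, hx.2]⟩
      · right; exact ⟨hx.1, by rw [h, hx.2]⟩
    have h1 := Ncount q r hq hr (n:ℤ)
    have h2 := Ncount q r hq hr (-(n:ℤ))
    rw [Int.natAbs_natCast] at h1
    rw [Int.natAbs_neg, Int.natAbs_natCast] at h2
    have h3 : (((((Un q) ×ˢ (Un r)).filter (fun x => (cf x).natAbs = n)).card : ℕ) : ℝ) ≤ _ :=
      Nat.cast_le.2 ((Finset.card_le_card hsub).trans (Finset.card_union_le _ _))
    rw [Nat.cast_add] at h3
    have h4 := add_le_add h1 h2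
    refine h3.trans (h4.trans (le_of_eq (by ring)))
  rw [e1, ← Finset.sum_fiberwise_of_maps_to mt]
  have w0 : ∀ n, 0 ≤ w n := fun n => ovl_nonneg _ _ _
  calc _ = ∑ n ∈ range (M+1), ((((Un q) ×ˢ (Un r)).filter (fun x => (cf x).natAbs = n)).card : ℝ) * w n := by
        refine sum_congr rfl fun n _ => ?_
        rw [sum_congr rfl fun x hx => by rw [(mem_filter.1 hx).2], sum_const, nsmul_eq_mul]
    _ ≤ ∑ n ∈ range (M+1), 2 * kap q r * Wc q r n * w n :=
        sum_le_sum fun n _ => mul_le_mul_of_nonneg_right (hcount n) (w0 n)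
    _ = 2 * kap q r * ∑ n ∈ range (M+1), Wc q r n * w n := by
        rw [mul_sum]; exact sum_congr rfl fun n _ => by ring
    _ = _ := by
        congr 1
        rw [Finset.range_eq_Ico, Finset.sum_eq_sum_Ico_succ_bot (by omega), W0, zero_mul, zero_add]
        rfl

lemma hinge_lo (h u v : ℝ) (hh : 0 ≤ h) (huv : u ≤ v) :
    ((max 0 u)^2 - (max 0 (u-h))^2)/2 - h * max 0 (u-h) ≤ ((max 0 v)^2 - (max 0 (v-h))^2)/2 - h * max 0 (v-h) := by
  have key : ∀ x : ℝ, ((max 0 x)^2 - (max 0 (x-h))^2)/2 - h * max 0 (x-h) = (min (max 0 x) h)^2/2 := by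
    intro x
    rcases le_total 0 x with h1 | h1 <;> rcases le_total 0 (x-h) with h2 | h2
    · rw [max_eq_right h1, max_eq_right h2, min_eq_right (by linarith)]; ring
    · rw [max_eq_right h1, max_eq_left h2, min_eq_left (by linarith)]; ring
    · have : x = 0 := by linarith
      have : h = 0 := by linarith
      subst this; simp
    · rw [max_eq_left h1, max_eq_left h2, min_eq_left hh]; ring
  rw [key, key]
  have : 0 ≤ min (max 0 u) h := le_min (le_max_left _ _) hh
  gcongr

lemma hinge_hi (h u v : ℝ) (hh : 0 ≤ h) (huv : u ≤ v) :
    h * max 0 u - ((max 0 u)^2 - (max 0 (u-h))^2)/2 ≤ h * max 0 v - ((max 0 v)^2 - (max 0 (v-h))^2)/2 := by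
  have key : ∀ x : ℝ, h * max 0 x - ((max 0 x)^2 - (max 0 (x-h))^2)/2 = h^2/2 - (h - min (max 0 x) h)^2/2 := by
    intro x
    rcases le_total 0 x with h1 | h1 <;> rcases le_total 0 (x-h) with h2 | h2
    · rw [max_eq_right h1, max_eq_right h2, min_eq_right (by linarith)]; ring
    · rw [max_eq_right h1, max_eq_left h2, min_eq_left (by linarith)]; ring
    · have : x = 0 := by linarith
      have : h = 0 := by linarith
      subst this; simp
    · rw [max_eq_left h1, max_eq_left h2, min_eq_left hh]; ring
  rw [key, key]
  have h3 : min (max 0 v) h ≤ h := min_le_right _ _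
  have : (h - min (max 0 v) h)^2 ≤ (h - min (max 0 u) h)^2 := by
    apply pow_le_pow_left₀ (by linarith)
    gcongr
  linarith

lemma ovl_hinge (d1 d2 x : ℝ) (h1 : 0 ≤ d1) (h2 : 0 ≤ d2) (hx : 0 ≤ x) :
    ovl d1 d2 x = max 0 (d1 + d2 - x) - max 0 (|d1 - d2| - x) := by
  unfold ovl
  rw [abs_of_nonneg hx]
  rcases le_total d1 d2 with h | h
  · rw [min_eq_left h, abs_of_nonpos (by linarith)]
    rcases le_total 0 (d1+d2-x) with h3 | h3
    · rw [max_eq_right h3]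
      rcases le_total 0 (-(d1-d2)-x) with h4 | h4
      · rw [max_eq_right h4, min_eq_left (by linarith), max_eq_right (by linarith)]; ring
      · rw [max_eq_left h4, min_eq_right (by linarith), max_eq_right h3]; ring
    · rw [max_eq_left h3, min_eq_right (by linarith), max_eq_left h3, max_eq_left (by linarith)]; ring
  · rw [min_eq_right h, abs_of_nonneg (by linarith)]
    rcases le_total 0 (d1+d2-x) with h3 | h3
    · rw [max_eq_right h3]
      rcases le_total 0 ((d1-d2)-x) with h4 | h4
      · rw [max_eq_right h4, min_eq_left (by linarith), max_eq_right (by linarith)]; ring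
      · rw [max_eq_left h4, min_eq_right (by linarith), max_eq_right h3]; ring
    · rw [max_eq_left h3, min_eq_right (by linarith), max_eq_left h3, max_eq_left (by linarith)]; ring

noncomputable def Gq (d1 d2 x : ℝ) : ℝ := ((max 0 (d1+d2-x))^2 - (max 0 (|d1-d2|-x))^2)/2

lemma abs_sub_le_add' (d1 d2 : ℝ) (h1 : 0 ≤ d1) (h2 : 0 ≤ d2) : |d1 - d2| ≤ d1 + d2 := by
  rw [abs_le]; constructor <;> linarith

lemma Gq_nonneg (d1 d2 x : ℝ) (h1 : 0 ≤ d1) (h2 : 0 ≤ d2) : 0 ≤ Gq d1 d2 x := by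
  unfold Gq
  have := abs_sub_le_add' d1 d2 h1 h2
  have h0 : 0 ≤ max 0 (|d1-d2|-x) := le_max_left _ _
  have : (max 0 (|d1-d2|-x))^2 ≤ (max 0 (d1+d2-x))^2 := by gcongr
  linarith

lemma Gq_step (d1 d2 x h : ℝ) (h1 : 0 ≤ d1) (h2 : 0 ≤ d2) (hx : 0 ≤ x) (hh : 0 ≤ h) :
    h * ovl d1 d2 (x+h) ≤ Gq d1 d2 x - Gq d1 d2 (x+h) ∧ Gq d1 d2 x - Gq d1 d2 (x+h) ≤ h * ovl d1 d2 x := by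
  rw [ovl_hinge d1 d2 _ h1 h2 hx, ovl_hinge d1 d2 _ h1 h2 (by linarith)]
  unfold Gq
  have a := hinge_lo h (|d1-d2|-x) (d1+d2-x) hh (by linarith [abs_sub_le_add' d1 d2 h1 h2])
  have b := hinge_hi h (|d1-d2|-x) (d1+d2-x) hh (by linarith [abs_sub_le_add' d1 d2 h1 h2])
  simp only [← sub_sub] 
  constructor <;> nlinarith

lemma Gq_zero (d1 d2 : ℝ) (h1 : 0 ≤ d1) (h2 : 0 ≤ d2) : Gq d1 d2 0 = 2 * d1 * d2 := by
  unfold Gq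
  rw [sub_zero, sub_zero, max_eq_right (by linarith), max_eq_right (abs_nonneg _), sq_abs]; ring

lemma ovl_zero (d1 d2 : ℝ) (h1 : 0 ≤ d1) (h2 : 0 ≤ d2) : ovl d1 d2 0 = 2 * min d1 d2 := by
  unfold ovl
  have : min d1 d2 ≤ d1 := min_le_left _ _
  have : min d1 d2 ≤ d2 := min_le_right _ _
  have : 0 ≤ min d1 d2 := le_min h1 h2
  rw [abs_zero, sub_zero, min_eq_left (by linarith), max_eq_right (by linarith)]

lemma ovl_le (d1 d2 x : ℝ) (h1 : 0 ≤ d1) (h2 : 0 ≤ d2) : ovl d1 d2 x ≤ 2 * min d1 d2 := by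
  have : 0 ≤ min d1 d2 := le_min h1 h2
  exact max_le (by linarith) (min_le_left _ _)

lemma ovl_eq_zero (d1 d2 x : ℝ) (hx : d1 + d2 ≤ |x|) : ovl d1 d2 x = 0 :=
  max_eq_left ((min_le_right _ _).trans (by linarith))

lemma sum_trap (d1 d2 h : ℝ) (h1 : 0 ≤ d1) (h2 : 0 ≤ d2) (hh : 0 < h) (J : ℕ) (hJ : d1 + d2 ≤ (J+1) * h) :
    |∑ j ∈ Icc 1 J, ovl d1 d2 (j * h) - 2 * d1 * d2 / h| ≤ 2 * min d1 d2 := by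
  have e1 : ∀ J : ℕ, h * ∑ j ∈ Icc 1 J, ovl d1 d2 (j * h) ≤ Gq d1 d2 0 - Gq d1 d2 (J * h) := by
    intro J
    induction J with
    | zero => simp
    | succ n ih =>
      rw [Finset.sum_Icc_succ_top (by omega), mul_add]
      have := (Gq_step d1 d2 (n*h) h h1 h2 (by positivity) hh.le).1
      have e : ((n+1:ℕ):ℝ) * h = n*h+h := by push_cast; ring
      rw [e]; linarith
  have e2 : ∀ J : ℕ, Gq d1 d2 0 - Gq d1 d2 ((J+1) * h) ≤ h * ∑ j ∈ Icc 1 J, ovl d1 d2 (j * h) + h * ovl d1 d2 0 := by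
    intro J
    induction J with
    | zero => 
      have := (Gq_step d1 d2 0 h h1 h2 le_rfl hh.le).2
      simpa using this
    | succ n ih =>
      rw [Finset.sum_Icc_succ_top (by omega), mul_add]
      have := (Gq_step d1 d2 ((n+1:ℕ)*h) h h1 h2 (by positivity) hh.le).2
      have e : (((n+1:ℕ):ℝ)+1) * h = (n+1:ℕ)*h+h := by push_cast; ring
      rw [e]; push_cast at *; linarith
  have hG : Gq d1 d2 ((J+1)*h) = 0 := by
    unfold Gq
    rw [max_eq_left (by linarith), max_eq_left (by linarith [abs_sub_le_add' d1 d2 h1 h2])]; simp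
  have a := e1 J
  have b := e2 J
  have c := Gq_nonneg d1 d2 (J*h) h1 h2
  rw [hG, Gq_zero _ _ h1 h2, ovl_zero _ _ h1 h2] at b
  rw [Gq_zero _ _ h1 h2] at a
  have a' : ∑ j ∈ Icc 1 J, ovl d1 d2 (j * h) ≤ 2 * d1 * d2 / h := by
    rw [le_div_iff₀ hh]; linarith
  have b' : 2 * d1 * d2 / h ≤ ∑ j ∈ Icc 1 J, ovl d1 d2 (j * h) + 2 * min d1 d2 := by
    rw [div_le_iff₀ hh]; linarith
  have := le_min h1 h2
  rw [abs_le]; constructor <;> linarith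

lemma sum_mult (M m : ℕ) (hm : 0 < m) (f : ℕ → ℝ) :
    ∑ c ∈ (Icc 1 M).filter (fun c => m ∣ c), f c = ∑ j ∈ Icc 1 (M/m), f (j*m) := by
  symm
  refine Finset.sum_bij (fun j _ => j * m) ?_ ?_ ?_ ?_
  · intro j hj
    simp only [mem_filter, mem_Icc] at *
    refine ⟨⟨Nat.mul_pos hj.1 hm, (Nat.le_div_iff_mul_le hm).1 hj.2⟩, dvd_mul_left _ _⟩
  · intro a _ b _ h
    exact Nat.eq_of_mul_eq_mul_right hm h
  · intro c hc
    simp only [mem_filter, mem_Icc] at *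
    obtain ⟨⟨h1, h2⟩, k, rfl⟩ := hc
    refine ⟨k, ⟨?_, ?_⟩, mul_comm _ _⟩
    · rcases Nat.eq_zero_or_pos k with rfl | h
      · simp at h1
      · exact h
    · rw [Nat.le_div_iff_mul_le hm, mul_comm]; exact h2
  · intros; rfl

lemma trap_sum (d1 d2 L : ℝ) (h1 : 0 ≤ d1) (h2 : 0 ≤ d2) (hL : 0 < L) (M : ℕ) (hM : (d1 + d2) * L ≤ M) (m : ℕ) (hm : 0 < m) :
    |∑ c ∈ (Icc 1 M).filter (fun c => m ∣ c), ovl d1 d2 ((c:ℝ)/L) - 2 * d1 * d2 * L / m| ≤ 2 * min d1 d2 := by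
  rw [sum_mult M m hm]
  have hm' : (0:ℝ) < m := by exact_mod_cast hm
  have := sum_trap d1 d2 (m/L) h1 h2 (by positivity) (M/m) (by
    have : M ≤ (M/m+1)*m := by
      have := Nat.div_add_mod M m
      have := Nat.mod_lt M hm
      nlinarith
    have : (M:ℝ) ≤ (((M/m:ℕ):ℝ)+1)*m := by exact_mod_cast this
    rw [← mul_div_assoc, le_div_iff₀ hL]; linarith)
  convert this using 3
  · refine sum_congr rfl fun j _ => ?_
    push_cast; rw [mul_div_assoc]
  · field_simp

lemma prodp_dvd_iff (d : Finset ℕ) (hd : ∀ p ∈ d, p.Prime) (c : ℕ) : (∏ p ∈ d, p) ∣ c ↔ ∀ p ∈ d, p ∣ c :=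
  ⟨fun h p hp => (Finset.dvd_prod_of_mem (fun p => p) hp).trans h,
   fun h => Finset.prod_primes_dvd c (fun p hp => (hd p hp).prime) h⟩

noncomputable def lamk (k i : ℕ) : ℝ := if i ≤ k then (-1)^i else 0

lemma sum_trunc (n k : ℕ) (f : ℕ → ℝ) : ∑ m ∈ range (n+1), (n.choose m : ℝ) * (if m ≤ k then f m else 0)
    = ∑ m ∈ range (k+1), (n.choose m : ℝ) * f m := by
  have h1 : ∑ m ∈ range (n+1), (n.choose m : ℝ) * (if m ≤ k then f m else 0)
     = ∑ m ∈ range (n+k+1), (n.choose m : ℝ) * (if m ≤ k then f m else 0) := by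
    refine sum_subset (Finset.range_mono (by omega)) fun m _ hm => ?_
    rw [mem_range, not_lt] at hm
    rw [Nat.choose_eq_zero_of_lt (by omega)]; simp
  rw [h1]
  symm
  have h2 : ∑ m ∈ range (k+1), (n.choose m : ℝ) * f m = ∑ m ∈ range (k+1), (n.choose m : ℝ) * (if m ≤ k then f m else 0) := by
    refine sum_congr rfl fun m hm => ?_
    rw [mem_range] at hm
    rw [if_pos (by omega)]
  rw [h2]
  refine sum_subset (Finset.range_mono (by omega)) fun m _ hm => ?_
  rw [mem_range, not_lt] at hm
  rw [if_neg (by omega)]; simp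

lemma bonf0 (k : ℕ) (hk : Even k) (A : Finset ℕ) : (if A = ∅ then (1:ℝ) else 0) ≤ ∑ d ∈ A.powerset, lamk k d.card := by
  rw [Finset.sum_powerset_apply_card (fun m => lamk k m)]
  simp only [nsmul_eq_mul, lamk]
  rw [sum_trunc]
  split_ifs with h
  · subst h
    rw [Finset.card_empty, Finset.sum_range_succ']
    simp
  · obtain ⟨n, hn⟩ := Nat.exists_eq_succ_of_ne_zero (Finset.card_ne_zero_of_mem (Finset.nonempty_iff_ne_empty.2 h).choose_spec)
    rw [hn]
    have := @Int.alternating_sum_range_choose_eq_choose n k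
    have h2 : ∑ m ∈ range (k+1), ((n.succ.choose m : ℕ) : ℝ) * (-1)^m = (((-1)^k * n.choose k : ℤ) : ℝ) := by
      rw [← this]; push_cast
      exact sum_congr rfl fun m _ => by rw [mul_comm]
    rw [h2, hk.neg_one_pow]
    push_cast; positivity

open Classical in
lemma bonf (k : ℕ) (hk : Even k) (Q : Finset ℕ) (hQ : ∀ p ∈ Q, p.Prime) (c : ℕ) :
    (if ∀ p ∈ Q, ¬ p ∣ c then (1:ℝ) else 0) ≤ ∑ d ∈ Q.powerset, lamk k d.card * (if (∏ p ∈ d, p) ∣ c then 1 else 0) := by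
  have h := bonf0 k hk (Q.filter (fun p => p ∣ c))
  have e : (Q.filter (fun p => p ∣ c) = ∅) ↔ ∀ p ∈ Q, ¬ p ∣ c := Finset.filter_eq_empty_iff
  rw [if_congr e rfl rfl] at h
  refine h.trans (le_of_eq ?_)
  simp only [mul_ite, mul_one, mul_zero]
  rw [← sum_filter]
  refine sum_congr ?_ fun _ _ => rfl
  ext d
  simp only [mem_powerset, mem_filter]
  constructor
  · intro hd
    have : d ⊆ Q := hd.trans (filter_subset _ _)
    exact ⟨this, (prodp_dvd_iff d (fun p hp => hQ p (this hp)) c).2 fun p hp => (mem_filter.1 (hd hp)).2⟩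
  · rintro ⟨h1, h2⟩ p hp
    exact mem_filter.2 ⟨h1 hp, (prodp_dvd_iff d (fun p hp => hQ p (h1 hp)) c).1 h2 p hp⟩

noncomputable def bet (Q s : Finset ℕ) : ℝ := (∏ p ∈ s, 1/(p:ℝ)) * ∏ p ∈ Q \ s, (1 - 2/(p:ℝ))

lemma bet_nonneg (Q s : Finset ℕ) (hQ : ∀ p ∈ Q, p.Prime) : 0 ≤ bet Q s :=
  mul_nonneg (prod_nonneg fun p _ => by positivity)
    (prod_nonneg fun p hp => fac2_nonneg p (hQ p (Finset.mem_sdiff.1 hp).1))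

lemma Wf_expand (Q : Finset ℕ) (hQ : ∀ p ∈ Q, p.Prime) (c : ℕ) :
    Wf Q c = ∑ s ∈ Q.powerset, bet Q s * (if (∏ p ∈ s, p) ∣ c then 1 else 0) := by
  unfold Wf
  have : ∀ p ∈ Q, (1 - 2/(p:ℝ) + if p ∣ c then 1/(p:ℝ) else 0) = (if p ∣ c then 1/(p:ℝ) else 0) + (1 - 2/(p:ℝ)) := fun p _ => add_comm _ _
  rw [prod_congr rfl this, prod_add]
  refine sum_congr rfl fun s hs => ?_
  rw [mem_powerset] at hs
  unfold bet
  have := prodp_dvd_iff s (fun p hp => hQ p (hs hp)) c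
  split_ifs with h
  · rw [mul_one]
    congr 1
    exact prod_congr rfl fun p hp => if_pos (this.1 h p hp)
  · rw [mul_zero]
    rw [this] at h
    push Not at h
    obtain ⟨p, hp, hpc⟩ := h
    rw [Finset.prod_eq_zero hp (if_neg hpc), zero_mul]

lemma bet_sum (Q : Finset ℕ) : ∑ s ∈ Q.powerset, bet Q s = ∏ p ∈ Q, (1 - 1/(p:ℝ)) := by
  unfold bet
  rw [← prod_add]
  exact prod_congr rfl fun p _ => by ring

lemma bet_sum2 (Q : Finset ℕ) : ∑ s ∈ Q.powerset, bet Q s / ((∏ p ∈ s, p : ℕ):ℝ) = ∏ p ∈ Q, (1 - 1/(p:ℝ))^2 := by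
  have : ∀ s ∈ Q.powerset, bet Q s / ((∏ p ∈ s, p : ℕ):ℝ) = (∏ p ∈ s, 1/(p:ℝ)^2) * ∏ p ∈ Q \ s, (1 - 2/(p:ℝ)) := by
    intro s _
    unfold bet
    push_cast
    rw [div_eq_mul_inv, ← Finset.prod_inv_distrib, mul_right_comm, ← prod_mul_distrib]
    congr 1
    exact prod_congr rfl fun p _ => by rw [pow_two]; field_simp
  rw [sum_congr rfl this, ← prod_add]
  exact prod_congr rfl fun p _ => by ring

lemma lam_sum (Q : Finset ℕ) (hQ : ∀ p ∈ Q, p.Prime) (k : ℕ) :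
    ∑ d ∈ Q.powerset, lamk k d.card / ((∏ p ∈ d, p : ℕ):ℝ) ≤ ∏ p ∈ Q, (1 - 1/(p:ℝ)) + (1/2)^k * ∏ p ∈ Q, (1 + 2/(p:ℝ)) := by
  have e1 : ∏ p ∈ Q, (1 - 1/(p:ℝ)) = ∑ d ∈ Q.powerset, (-1)^d.card / ((∏ p ∈ d, p : ℕ):ℝ) := by
    have : ∀ p ∈ Q, (1 - 1/(p:ℝ)) = 1 + (-(1/(p:ℝ))) := fun p _ => by ring
    rw [prod_congr rfl this, Finset.prod_one_add]
    refine sum_congr rfl fun d _ => ?_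
    rw [Finset.prod_neg, div_eq_mul_inv]; push_cast
    rw [← Finset.prod_inv_distrib]; simp
  have e2 : ∏ p ∈ Q, (1 + 2/(p:ℝ)) = ∑ d ∈ Q.powerset, 2^d.card / ((∏ p ∈ d, p : ℕ):ℝ) := by
    rw [Finset.prod_one_add]
    refine sum_congr rfl fun d _ => ?_
    rw [Finset.prod_div_distrib, Finset.prod_const]; push_cast; rfl
  rw [e1, e2, mul_sum, ← sum_add_distrib]
  refine sum_le_sum fun d _ => ?_
  rw [← mul_div_assoc, ← add_div]
  gcongr
  unfold lamk
  split_ifs with h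
  · have : (0:ℝ) ≤ (1/2)^k * 2^d.card := by positivity
    linarith
  · have h1 : (-1:ℝ) ≤ (-1)^d.card := by
      rcases neg_one_pow_eq_or ℝ d.card with h | h <;> rw [h] <;> norm_num
    have : (1:ℝ) ≤ (1/2)^k * 2^d.card := by
      calc (1:ℝ) = (1/2)^k*2^k := by rw [← mul_pow]; norm_num
        _ ≤ _ := by gcongr; · norm_num
                    · omega
    linarith

lemma num_sets (n k : ℕ) : ∑ m ∈ range (k+1), (n.choose m : ℝ) ≤ ((n:ℝ)+1)^k := by
  induction k with
  | zero => simp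
  | succ k ih =>
    rw [sum_range_succ]
    have h1 : (n.choose (k+1) : ℝ) ≤ n * n.choose k := by
      have h2 := Nat.choose_succ_right_eq n k
      have : n.choose (k+1) ≤ n * n.choose k := by
        calc n.choose (k+1) ≤ n.choose (k+1) * (k+1) := Nat.le_mul_of_pos_right _ (by omega)
          _ = n.choose k * (n-k) := h2
          _ ≤ n.choose k * n := Nat.mul_le_mul_left _ (by omega)
          _ = _ := mul_comm _ _
      exact_mod_cast this
    have h2 : (n.choose k : ℝ) ≤ ∑ m ∈ range (k+1), (n.choose m : ℝ) :=
      single_le_sum (f := fun m => (n.choose m : ℝ)) (fun _ _ => by positivity) (mem_range.2 (by omega))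
    rw [pow_succ]
    nlinarith [(Nat.cast_nonneg n : (0:ℝ) ≤ n)]

lemma lam_abs (Q : Finset ℕ) (k : ℕ) : ∑ d ∈ Q.powerset, |lamk k d.card| ≤ ((Q.card:ℝ)+1)^k := by
  rw [Finset.sum_powerset_apply_card (fun m => |lamk k m|)]
  simp only [nsmul_eq_mul, lamk, apply_ite abs, abs_pow, abs_neg, abs_one, one_pow, abs_zero]
  rw [sum_trunc]
  simpa using num_sets Q.card k

lemma V_lower (T : ℕ) (hT : 1 ≤ T) (Q : Finset ℕ) (hQ : ∀ p ∈ Q, p.Prime) (hQT : ∀ p ∈ Q, p ≤ T) :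
    1 / (T:ℝ) ≤ ∏ p ∈ Q, (1 - 1/(p:ℝ)) := by
  have h1 : ∏ p ∈ Icc 2 T, (1 - 1/(p:ℝ)) = 1/(T:ℝ) := by
    induction T, hT using Nat.le_induction with
    | base => simp
    | succ n hn ih =>
      rw [Finset.prod_Icc_succ_top (by omega)]
      by_cases h : n = 1
      · subst h; norm_num
      have ih' : ∏ p ∈ Icc 2 n, (1 - 1/(p:ℝ)) = 1/(n:ℝ) := by
        clear ih hQT
        induction n, hn using Nat.le_induction with
        | base => simp
        | succ n hn ih =>
          rw [Finset.prod_Icc_succ_top (by omega)]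
          by_cases h : n = 1
          · subst h; norm_num
          rw [ih h]
          have : (n:ℝ) ≠ 0 := by positivity
          push_cast; field_simp; ring
      rw [ih']
      have : (n:ℝ) ≠ 0 := by positivity
      push_cast; field_simp; ring
  rw [← h1]
  have hs : Q ⊆ Icc 2 T := fun p hp => mem_Icc.2 ⟨(hQ p hp).two_le, hQT p hp⟩
  rw [← Finset.prod_sdiff hs]
  refine mul_le_of_le_one_left (prod_nonneg fun p _ => fac1_nonneg p) ?_
  refine Finset.prod_le_one (fun p _ => fac1_nonneg p) fun p _ => ?_
  have : (0:ℝ) ≤ 1/(p:ℝ) := by positivity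
  linarith

lemma V_card (T : ℕ) (Q : Finset ℕ) (hQ : ∀ p ∈ Q, p.Prime) (hQT : ∀ p ∈ Q, p ≤ T) : Q.card ≤ T := by
  have hs : Q ⊆ Icc 1 T := fun p hp => mem_Icc.2 ⟨(hQ p hp).one_lt.le, hQT p hp⟩
  simpa using Finset.card_le_card hs

open Classical in
lemma sieveSum (Q1 Q2 : Finset ℕ) (h1 : ∀ p ∈ Q1, p.Prime) (h2 : ∀ p ∈ Q2, p.Prime) (hdis : Disjoint Q1 Q2)
    (T : ℕ) (hT : 1 ≤ T) (h1T : ∀ p ∈ Q1, p ≤ T) (h2T : ∀ p ∈ Q2, p ≤ T) (k : ℕ) (hk : Even k)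
    (M : ℕ) (w : ℕ → ℝ) (hw : ∀ c, 0 ≤ w c) (I E : ℝ) (hI : 0 ≤ I) (hE : 0 ≤ E)
    (hcount : ∀ m : ℕ, 0 < m → |∑ c ∈ (Icc 1 M).filter (fun c => m ∣ c), w c - I / m| ≤ E) :
    ∑ c ∈ Icc 1 M, (if ∀ p ∈ Q1, ¬ p ∣ c then Wf Q2 c else 0) * w c ≤
      (∏ p ∈ Q1, (1 - 1/(p:ℝ))) * (∏ p ∈ Q2, (1 - 1/(p:ℝ))^2) * (I * (1 + (T:ℝ)^3 * (1/2)^k) + E * ((T:ℝ)^2 * ((T:ℝ)+1)^k)) := by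
  set V1 := ∏ p ∈ Q1, (1 - 1/(p:ℝ)) with hV1
  set V2 := ∏ p ∈ Q2, (1 - 1/(p:ℝ)) with hV2
  have hT0 : (0:ℝ) < T := by exact_mod_cast hT
  have v1 : 1 ≤ V1 * T := by have := V_lower T hT Q1 h1 h1T; rwa [div_le_iff₀ hT0] at this
  have v2 : 1 ≤ V2 * T := by have := V_lower T hT Q2 h2 h2T; rwa [div_le_iff₀ hT0] at this
  have v10 : 0 < V1 := by by_contra h; nlinarith
  have v20 : 0 < V2 := by by_contra h; nlinarith
  have hs1 : ∑ c ∈ Icc 1 M, (if ∀ p ∈ Q1, ¬ p ∣ c then Wf Q2 c else 0) * w c ≤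
      ∑ c ∈ Icc 1 M, (∑ d ∈ Q1.powerset, lamk k d.card * (if (∏ p ∈ d, p) ∣ c then 1 else 0)) * (∑ s ∈ Q2.powerset, bet Q2 s * (if (∏ p ∈ s, p) ∣ c then 1 else 0)) * w c := by
    refine sum_le_sum fun c _ => ?_
    refine mul_le_mul_of_nonneg_right ?_ (hw c)
    rw [← Wf_expand Q2 h2 c]
    have := mul_le_mul_of_nonneg_right (bonf k hk Q1 h1 c) (Wf_nonneg Q2 h2 c)
    simpa only [ite_mul, one_mul, zero_mul] using this
  have hs2 : ∑ c ∈ Icc 1 M, (∑ d ∈ Q1.powerset, lamk k d.card * (if (∏ p ∈ d, p) ∣ c then 1 else 0)) * (∑ s ∈ Q2.powerset, bet Q2 s * (if (∏ p ∈ s, p) ∣ c then 1 else 0)) * w c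
      = ∑ d ∈ Q1.powerset, ∑ s ∈ Q2.powerset, lamk k d.card * bet Q2 s * ∑ c ∈ (Icc 1 M).filter (fun c => ((∏ p ∈ d, p) * ∏ p ∈ s, p) ∣ c), w c := by
    simp_rw [sum_mul_sum, sum_mul]
    rw [sum_comm]
    refine sum_congr rfl fun d hd => ?_
    rw [sum_comm]
    refine sum_congr rfl fun s hs => ?_
    rw [mem_powerset] at hd hs
    rw [sum_filter, mul_sum]
    refine sum_congr rfl fun c _ => ?_
    have hc : Nat.Coprime (∏ p ∈ d, p) (∏ p ∈ s, p) := by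
      refine Nat.Coprime.prod_left fun p hp => Nat.Coprime.prod_right fun q hq => ?_
      rw [Nat.coprime_primes (h1 p (hd hp)) (h2 q (hs hq))]
      rintro rfl
      exact Finset.disjoint_left.1 hdis (hd hp) (hs hq)
    have : ((∏ p ∈ d, p) * ∏ p ∈ s, p) ∣ c ↔ (∏ p ∈ d, p) ∣ c ∧ (∏ p ∈ s, p) ∣ c :=
      ⟨fun h => ⟨(dvd_mul_right _ _).trans h, (dvd_mul_left _ _).trans h⟩, fun h => hc.mul_dvd_of_dvd_of_dvd h.1 h.2⟩
    by_cases ha : (∏ p ∈ d, p) ∣ c <;> by_cases hb : (∏ p ∈ s, p) ∣ c <;> simp [this, ha, hb]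
  have hs3 : ∑ d ∈ Q1.powerset, ∑ s ∈ Q2.powerset, lamk k d.card * bet Q2 s * ∑ c ∈ (Icc 1 M).filter (fun c => ((∏ p ∈ d, p) * ∏ p ∈ s, p) ∣ c), w c
      ≤ ∑ d ∈ Q1.powerset, ∑ s ∈ Q2.powerset, (I * ((lamk k d.card / ((∏ p ∈ d, p : ℕ):ℝ)) * (bet Q2 s / ((∏ p ∈ s, p : ℕ):ℝ))) + E * (|lamk k d.card| * bet Q2 s)) := by
    refine sum_le_sum fun d hd => sum_le_sum fun s hs => ?_
    rw [mem_powerset] at hd hs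
    have hm : 0 < (∏ p ∈ d, p) * ∏ p ∈ s, p := Nat.mul_pos (prod_pos fun p hp => (h1 p (hd hp)).pos) (prod_pos fun p hp => (h2 p (hs hp)).pos)
    have := hcount _ hm
    set X := ∑ c ∈ (Icc 1 M).filter (fun c => ((∏ p ∈ d, p) * ∏ p ∈ s, p) ∣ c), w c
    have hb := bet_nonneg Q2 s h2
    have e : I * ((lamk k d.card / ((∏ p ∈ d, p : ℕ):ℝ)) * (bet Q2 s / ((∏ p ∈ s, p : ℕ):ℝ))) = lamk k d.card * bet Q2 s * (I / (((∏ p ∈ d, p) * ∏ p ∈ s, p : ℕ):ℝ)) := by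
      rw [Nat.cast_mul]; field_simp
    rw [e]
    have : lamk k d.card * bet Q2 s * (X - I / (((∏ p ∈ d, p) * ∏ p ∈ s, p : ℕ):ℝ)) ≤ E * (|lamk k d.card| * bet Q2 s) := by
      refine (le_abs_self _).trans ?_
      rw [abs_mul, abs_mul, abs_of_nonneg hb, mul_comm E]
      exact mul_le_mul_of_nonneg_left this (by positivity)
    linarith
  have hs4 : ∑ d ∈ Q1.powerset, ∑ s ∈ Q2.powerset, (I * ((lamk k d.card / ((∏ p ∈ d, p : ℕ):ℝ)) * (bet Q2 s / ((∏ p ∈ s, p : ℕ):ℝ))) + E * (|lamk k d.card| * bet Q2 s))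
      = I * ((∑ d ∈ Q1.powerset, lamk k d.card / ((∏ p ∈ d, p : ℕ):ℝ)) * V2^2) + E * ((∑ d ∈ Q1.powerset, |lamk k d.card|) * V2) := by
    rw [hV2, ← prod_pow, ← bet_sum2, ← bet_sum, sum_mul_sum, sum_mul_sum, mul_sum, mul_sum, ← sum_add_distrib]
    refine sum_congr rfl fun d _ => ?_
    rw [mul_sum, mul_sum, ← sum_add_distrib]
  rw [prod_pow]
  refine hs1.trans (hs2.trans_le (hs3.trans (hs4.trans_le ?_)))
  have hP : (∏ p ∈ Q1, (1 + 2/(p:ℝ))) ≤ (T:ℝ)^3 * V1 := by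
    have a : (∏ p ∈ Q1, (1 + 2/(p:ℝ))) * V1^2 ≤ 1 := by
      rw [hV1, ← prod_pow, ← prod_mul_distrib]
      refine Finset.prod_le_one (fun p _ => by positivity) fun p hp => ?_
      have hx : 0 ≤ 1/(p:ℝ) := by positivity
      have hx1 := fac1_nonneg p
      have e : (2:ℝ)/p = 2*(1/p) := by ring
      rw [e]
      set x := 1/(p:ℝ)
      nlinarith [mul_nonneg hx (mul_nonneg hx hx1), mul_nonneg hx hx]
    have b : (1:ℝ) ≤ (V1*T)^3 := one_le_pow₀ v1
    have c : V1^2 * (∏ p ∈ Q1, (1 + 2/(p:ℝ))) ≤ V1^2 * ((T:ℝ)^3 * V1) := by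
      calc _ ≤ 1 := by linarith
        _ ≤ (V1*T)^3 := b
        _ = _ := by ring
    exact le_of_mul_le_mul_left c (by positivity)
  have l1 : ∑ d ∈ Q1.powerset, lamk k d.card / ((∏ p ∈ d, p : ℕ):ℝ) ≤ V1 * (1 + (T:ℝ)^3 * (1/2)^k) := by
    have := lam_sum Q1 h1 k
    have h3 : (1/2:ℝ)^k * ∏ p ∈ Q1, (1 + 2/(p:ℝ)) ≤ (1/2)^k * ((T:ℝ)^3 * V1) := by gcongr
    calc _ ≤ _ := this
      _ ≤ V1 + (1/2)^k * ((T:ℝ)^3 * V1) := by linarith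
      _ = _ := by ring
  have l2 : ∑ d ∈ Q1.powerset, |lamk k d.card| ≤ ((T:ℝ)+1)^k := by
    refine (lam_abs Q1 k).trans ?_
    have : (Q1.card:ℝ) ≤ T := by exact_mod_cast V_card T Q1 h1 h1T
    gcongr
  have l3 : V2 ≤ V1 * V2^2 * (T:ℝ)^2 := by
    calc V2 = V2 * 1 * 1 := by ring
      _ ≤ V2 * (V1 * T) * (V2 * T) := by gcongr
      _ = _ := by ring
  calc _ ≤ I * ((V1 * (1 + (T:ℝ)^3 * (1/2)^k)) * V2^2) + E * (((T:ℝ)+1)^k * (V1 * V2^2 * (T:ℝ)^2)) := by gcongr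
    _ = _ := by ring

noncomputable def VV (Q : Finset ℕ) : ℝ := ∏ p ∈ Q, (1 - 1/(p:ℝ))

lemma VV_pos (Q : Finset ℕ) (hQ : ∀ p ∈ Q, p.Prime) : 0 < VV Q := by
  refine prod_pos fun p hp => ?_
  have : (2:ℝ) ≤ p := by exact_mod_cast (hQ p hp).two_le
  rw [sub_pos, div_lt_one (by linarith)]; linarith

lemma VV_exp (Q : Finset ℕ) (hQ : ∀ p ∈ Q, p.Prime) : 1 ≤ VV Q * exp (2 * ∑ p ∈ Q, 1/(p:ℝ)) := by
  unfold VV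
  rw [mul_sum, Real.exp_sum, ← prod_mul_distrib]
  have : (1:ℝ) = ∏ p ∈ Q, 1 := by simp
  conv_lhs => rw [this]
  refine Finset.prod_le_prod (fun _ _ => zero_le_one) fun p hp => ?_
  have h2 : (2:ℝ) ≤ p := by exact_mod_cast (hQ p hp).two_le
  have hx : 0 ≤ 1/(p:ℝ) := by positivity
  have hx2 : 1/(p:ℝ) ≤ 1/2 := by gcongr
  set x := 1/(p:ℝ)
  have := Real.quadratic_le_exp_of_nonneg (x := 2*x) (by positivity)
  calc (1:ℝ) ≤ (1-x)*(1+2*x+(2*x)^2/2) := by nlinarith [mul_nonneg hx hx, mul_nonneg hx (sub_nonneg.2 hx2), mul_nonneg (mul_nonneg hx hx) (sub_nonneg.2 hx2)]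
    _ ≤ _ := mul_le_mul_of_nonneg_left this (by linarith)

lemma prod_qr (q r : ℕ) (hq : q ≠ 0) (hr : r ≠ 0) :
    VV q.primeFactors * VV r.primeFactors = VV ((Nat.gcd q r).primeFactors ∩ Pd q r) * VV (Pd q r) * VV (Pe q r) ^ 2 := by
  have hg : Nat.gcd q r ≠ 0 := Nat.gcd_ne_zero_left hq
  have hi : q.primeFactors ∩ r.primeFactors = (Nat.gcd q r).primeFactors := by
    ext p
    simp only [Finset.mem_inter, Nat.mem_primeFactors, Nat.dvd_gcd_iff]
    tauto
  have fz : ∀ n p : ℕ, n ≠ 0 → p.Prime → (p ∣ n ↔ n.factorization p ≠ 0) := by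
    intro n p hn hp
    rw [Ne, Nat.factorization_eq_zero_iff]
    simp [hp, hn]
  have hu : q.primeFactors ∪ r.primeFactors = Pd q r ∪ Pe q r := by
    ext p
    simp only [Pe, mem_union, Finset.mem_sdiff, Nat.mem_primeFactors, Nat.dvd_gcd_iff, mem_Pd q r hq hr]
    by_cases hp : p.Prime
    · simp only [hp, true_and, fz q p hq hp, fz r p hr hp]
      simp
      omega
    · simp [hp]
  have hd : Disjoint (Pd q r) (Pe q r) := Finset.disjoint_sdiff
  unfold VV
  rw [← Finset.prod_union_inter, hi, hu, Finset.prod_union hd]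
  have : ∏ p ∈ (Nat.gcd q r).primeFactors, (1 - 1/(p:ℝ)) = (∏ p ∈ (Nat.gcd q r).primeFactors ∩ Pd q r, (1 - 1/(p:ℝ))) * ∏ p ∈ Pe q r, (1 - 1/(p:ℝ)) := by
    unfold Pe
    rw [Finset.prod_inter_mul_prod_sdiff]
  rw [this]; ring

lemma muw_eq (ψ : ℕ → ℝ) (n : ℕ) (hn : n ≠ 0) : muw ψ n = ψ n * VV n.primeFactors := by
  unfold muw VV
  rw [totient_ratio]
  have : (n:ℝ) ≠ 0 := by exact_mod_cast hn
  field_simp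

noncomputable def Iqr (ψ : ℕ → ℝ) (q r : ℕ) : ℝ := 2 * (ψ q / q) * (ψ r / r) * ((q:ℝ)*r/Nat.gcd q r)

lemma main_id (ψ : ℕ → ℝ) (q r : ℕ) (hq : q ≠ 0) (hr : r ≠ 0) :
    2 * kap q r * Iqr ψ q r * VV (Pd q r) * VV (Pe q r)^2 = 4 * (muw ψ q * muw ψ r) := by
  rw [muw_eq ψ q hq, muw_eq ψ r hr]
  have e : ψ q * VV q.primeFactors * (ψ r * VV r.primeFactors) = ψ q * ψ r * (VV q.primeFactors * VV r.primeFactors) := by ring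
  rw [e, prod_qr q r hq hr]
  unfold kap Iqr
  have hg : (Nat.gcd q r : ℝ) ≠ 0 := by exact_mod_cast Nat.gcd_ne_zero_left hq
  have : (q:ℝ) ≠ 0 := by exact_mod_cast hq
  have : (r:ℝ) ≠ 0 := by exact_mod_cast hr
  change 2 * (_ * VV _) * _ * _ * _ = _
  field_simp; ring

lemma Dd_eq (ψ : ℕ → ℝ) (q r : ℕ) (hq : q ≠ 0) (hr : r ≠ 0) :
    Dd ψ q r = max (ψ q / q) (ψ r / r) * ((q:ℝ)*r/Nat.gcd q r) := by
  unfold Dd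
  have : (q:ℝ) ≠ 0 := by exact_mod_cast hq
  have : (r:ℝ) ≠ 0 := by exact_mod_cast hr
  rw [max_mul_of_nonneg _ _ (by positivity), ← max_div_div_right (Nat.cast_nonneg _)]
  congr 1 <;> field_simp

lemma Iqr_eq (ψ : ℕ → ℝ) (q r : ℕ) (hq : q ≠ 0) (hr : r ≠ 0) :
    Iqr ψ q r = 2 * min (ψ q / q) (ψ r / r) * Dd ψ q r := by
  rw [Dd_eq ψ q r hq hr, ← mul_assoc, mul_assoc 2 (min _ _), min_mul_max]
  unfold Iqr; ring

lemma Wf_bound (Q : Finset ℕ) (hQ : ∀ p ∈ Q, p.Prime) (c : ℕ) :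
    Wf Q c * VV (Q.filter (fun p => p ∣ c)) ≤ VV Q ^ 2 := by
  unfold Wf VV
  rw [Finset.prod_filter, ← prod_mul_distrib, ← prod_pow]
  refine Finset.prod_le_prod (fun p hp => ?_) fun p hp => ?_
  · refine mul_nonneg (add_nonneg (fac2_nonneg p (hQ p hp)) ?_) ?_
    · split_ifs <;> positivity
    · split_ifs
      · exact fac1_nonneg p
      · norm_num
  · split_ifs
    · apply le_of_eq; ring
    · have : 0 ≤ 1/(p:ℝ) := by positivity
      have e : (2:ℝ)/p = 2*(1/p) := by ring
      rw [e]; nlinarith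

lemma Wc_le (q r c : ℕ) : Wc q r c ≤ Wf (Pe q r) c := by
  unfold Wc
  split_ifs
  · exact le_rfl
  · exact Wf_nonneg _ (Pe_prime q r) _

lemma crude (ψ : ℕ → ℝ) (hψ : ∀ n, 0 ≤ ψ n) (q r : ℕ) (hq : 0 < q) (hr : 0 < r) (hne : q ≠ r) :
    I2 ψ q r ≤ 16 * Dd ψ q r * (muw ψ q * muw ψ r * exp (2 * ∑ p ∈ Pd q r, 1/√(p:ℝ))) := by
  have hd1 : 0 ≤ ψ q / q := div_nonneg (hψ q) (by positivity)
  have hd2 : 0 ≤ ψ r / r := div_nonneg (hψ r) (by positivity)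
  have hL : 0 < (q:ℝ)*r/Nat.gcd q r := by
    have := Nat.gcd_pos_of_pos_left r hq
    positivity
  have hI := Iqr_eq ψ q r hq.ne' hr.ne'
  have hD := Dd_eq ψ q r hq.ne' hr.ne'
  have hid := main_id ψ q r hq.ne' hr.ne'
  set d1 := ψ q / q
  set d2 := ψ r / r
  set L := (q:ℝ)*r/Nat.gcd q r
  set D := Dd ψ q r
  have hD0 : 0 ≤ D := by rw [hD]; exact mul_nonneg (hd1.trans (le_max_left _ _)) hL.le
  have hVe := VV_pos (Pe q r) (Pe_prime q r)
  have hVd := VV_pos (Pd q r) (Pd_prime q r)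
  have hδ : 0 ≤ min d1 d2 := le_min hd1 hd2
  have hI0 : 0 ≤ Iqr ψ q r := by rw [hI]; positivity
  have key : ∑ n ∈ Icc 1 (q*r), Wc q r n * ovl d1 d2 ((n:ℝ)/L) ≤ 4 * D * Iqr ψ q r * VV (Pe q r)^2 := by
    have : ∀ n ∈ Icc 1 (q*r), Wc q r n * ovl d1 d2 ((n:ℝ)/L) ≤ if n ∈ Icc 1 ⌊2*D⌋₊ then (VV (Pe q r)^2 * (2*D)) * (2 * min d1 d2) else 0 := by
      intro n hn
      rw [mem_Icc] at hn
      split_ifs with h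
      · refine mul_le_mul ((Wc_le q r n).trans ?_) (ovl_le _ _ _ hd1 hd2) (ovl_nonneg _ _ _) (by positivity)
        have hn2 : (n:ℝ) ≤ 2*D := (Nat.le_floor_iff (by positivity)).1 (mem_Icc.1 h).2
        have h1 := Wf_bound (Pe q r) (Pe_prime q r) n
        have h2 : 1/(n:ℝ) ≤ VV ((Pe q r).filter (fun p => p ∣ n)) := by
          refine V_lower n hn.1 _ (fun p hp => Pe_prime q r p (mem_filter.1 hp).1) fun p hp => Nat.le_of_dvd hn.1 (mem_filter.1 hp).2
        have hn0 : (0:ℝ) < n := by exact_mod_cast hn.1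
        have h3 := mul_le_mul_of_nonneg_left h2 (Wf_nonneg (Pe q r) (Pe_prime q r) n)
        have h4 : Wf (Pe q r) n * (1/(n:ℝ)) ≤ VV (Pe q r)^2 := h3.trans h1
        rw [mul_one_div, div_le_iff₀ hn0] at h4
        exact h4.trans (by gcongr)
      · rw [ovl_eq_zero, mul_zero]
        rw [mem_Icc, not_and, not_le] at h
        have := Nat.lt_of_floor_lt (h hn.1)
        rw [abs_of_nonneg (by positivity), le_div_iff₀ hL]
        have : (d1+d2)*L ≤ 2*D := by
          rw [hD]
          have := le_max_left d1 d2
          have := le_max_right d1 d2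
          nlinarith
        linarith
    refine (sum_le_sum this).trans ?_
    rw [← sum_filter]
    have hs : ((Icc 1 (q*r)).filter (fun n => n ∈ Icc 1 ⌊2*D⌋₊)) ⊆ Icc 1 ⌊2*D⌋₊ := fun n hn => (mem_filter.1 hn).2
    refine (sum_le_sum_of_subset_of_nonneg hs fun _ _ _ => by positivity).trans ?_
    rw [sum_const, nsmul_eq_mul, Nat.card_Icc, Nat.add_sub_cancel]
    have := Nat.floor_le (a := 2*D) (by positivity)
    rw [hI]
    calc _ ≤ (2*D) * (VV (Pe q r)^2 * (2*D) * (2 * min d1 d2)) := by gcongr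
      _ = _ := by ring
  have hk := kap_nonneg q r
  have h1 := VV_exp (Pd q r) (Pd_prime q r)
  set H := exp (2 * ∑ p ∈ Pd q r, 1/√(p:ℝ)) with hH
  have h2 : exp (2 * ∑ p ∈ Pd q r, 1/(p:ℝ)) ≤ H := by
    apply exp_le_exp.2
    have : ∑ p ∈ Pd q r, 1/(p:ℝ) ≤ ∑ p ∈ Pd q r, 1/√(p:ℝ) := by
      refine sum_le_sum fun p hp => ?_
      have h1 : (1:ℝ) ≤ p := by exact_mod_cast (Pd_prime q r p hp).one_lt.le
      have h2 : 0 < √(p:ℝ) := Real.sqrt_pos.2 (by linarith)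
      refine one_div_le_one_div_of_le h2 ?_
      rw [sqrt_le_left (by linarith)]; nlinarith
    linarith
  have h3 : 1 ≤ VV (Pd q r) * H := h1.trans (by gcongr)
  calc I2 ψ q r ≤ _ := I2_le ψ q r hq hr hne (q*r) le_rfl
    _ ≤ 2 * kap q r * (4 * D * Iqr ψ q r * VV (Pe q r)^2) := by gcongr
    _ = 4 * D * (2 * kap q r * Iqr ψ q r * VV (Pe q r)^2) * 1 := by ring
    _ ≤ 4 * D * (2 * kap q r * Iqr ψ q r * VV (Pe q r)^2) * (VV (Pd q r) * H) := by gcongr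
    _ = 4 * D * (2 * kap q r * Iqr ψ q r * VV (Pd q r) * VV (Pe q r)^2) * H := by ring
    _ = _ := by rw [hid]; ring

lemma VV_split (Q : Finset ℕ) (T : ℕ) : VV Q = VV (Q.filter (fun p => p ≤ T)) * VV (Q.filter (fun p => ¬ p ≤ T)) :=
  (Finset.prod_filter_mul_prod_filter_not Q (fun p => p ≤ T) _).symm

lemma Wf_split (Q : Finset ℕ) (T c : ℕ) : Wf Q c = Wf (Q.filter (fun p => p ≤ T)) c * Wf (Q.filter (fun p => ¬ p ≤ T)) c :=
  (Finset.prod_filter_mul_prod_filter_not Q (fun p => p ≤ T) _).symm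

lemma Wf_large (Q : Finset ℕ) (hQ : ∀ p ∈ Q, p.Prime) (T : ℕ) (hT : 0 < T) (hQT : ∀ p ∈ Q, ¬ p ≤ T) (c J : ℕ) (hc : 0 < c) (hcJ : c < 2^J) :
    Wf Q c ≤ VV Q ^2 * exp (2*J/T) := by
  have h1 := Wf_bound Q hQ c
  set R := Q.filter (fun p => p ∣ c)
  have hR : ∀ p ∈ R, p.Prime := fun p hp => hQ p (mem_filter.1 hp).1
  have h2 := VV_exp R hR
  have hT' : (0:ℝ) < T := by exact_mod_cast hT
  have hcard : R.card ≤ J := by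
    have a : 2^R.card ≤ ∏ p ∈ R, p := by
      rw [← Finset.prod_const]
      exact Finset.prod_le_prod' fun p hp => (hR p hp).two_le
    have b : ∏ p ∈ R, p ≤ c := Nat.le_of_dvd hc ((prodp_dvd_iff R hR c).2 fun p hp => (mem_filter.1 hp).2)
    exact ((Nat.pow_lt_pow_iff_right (by norm_num : 1 < 2)).1 (a.trans_lt (b.trans_lt hcJ))).le
  have h3 : 2 * ∑ p ∈ R, 1/(p:ℝ) ≤ 2*J/T := by
    have : ∑ p ∈ R, 1/(p:ℝ) ≤ ∑ p ∈ R, 1/(T:ℝ) := by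
      refine sum_le_sum fun p hp => ?_
      have := hQT p (mem_filter.1 hp).1
      have : (T:ℝ) ≤ p := by exact_mod_cast (not_le.1 this).le
      gcongr
    rw [sum_const, nsmul_eq_mul] at this
    have h4 : (R.card:ℝ) ≤ J := by exact_mod_cast hcard
    calc 2 * ∑ p ∈ R, 1/(p:ℝ) ≤ 2 * ((R.card:ℝ) * (1/T)) := by gcongr
      _ ≤ 2 * (J * (1/T)) := by gcongr
      _ = _ := by ring
  have hVR := VV_pos R hR
  have hW := Wf_nonneg Q hQ c
  calc Wf Q c = Wf Q c * 1 := by ring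
    _ ≤ Wf Q c * (VV R * exp (2 * ∑ p ∈ R, 1/(p:ℝ))) := by gcongr
    _ ≤ Wf Q c * (VV R * exp (2*J/T)) := by gcongr
    _ = (Wf Q c * VV R) * exp (2*J/T) := by ring
    _ ≤ _ := by gcongr

lemma sieveB (ψ : ℕ → ℝ) (hψ : ∀ n, 0 ≤ ψ n) (q r : ℕ) (hq : 0 < q) (hr : 0 < r) (hne : q ≠ r)
    (j T k : ℕ) (hk : Even k) (hT : 1 ≤ T) (hj : (2:ℝ)^j ≤ Dd ψ q r) (hj' : Dd ψ q r < (2:ℝ)^(j+1)) :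
    I2 ψ q r ≤ 4 * (muw ψ q * muw ψ r) * (exp (2 * ∑ p ∈ (Pd q r).filter (fun p => ¬ p ≤ T), 1/(p:ℝ)) *
      exp (2*((j+2:ℕ):ℝ)/T) * (1 + (T:ℝ)^3*(1/2)^k + (T:ℝ)^2*((T:ℝ)+1)^k/2^j)) := by
  classical
  have hd1 : 0 ≤ ψ q / q := div_nonneg (hψ q) (by positivity)
  have hd2 : 0 ≤ ψ r / r := div_nonneg (hψ r) (by positivity)
  have hL : 0 < (q:ℝ)*r/Nat.gcd q r := by
    have := Nat.gcd_pos_of_pos_left r hq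
    positivity
  have hI := Iqr_eq ψ q r hq.ne' hr.ne'
  have hD := Dd_eq ψ q r hq.ne' hr.ne'
  have hid := main_id ψ q r hq.ne' hr.ne'
  have hId : Iqr ψ q r = 2 * (ψ q / q) * (ψ r / r) * ((q:ℝ)*r/Nat.gcd q r) := rfl
  have hI2 := I2_le ψ q r hq hr hne
  set d1 := ψ q / q
  set d2 := ψ r / r
  set L := (q:ℝ)*r/Nat.gcd q r
  set D := Dd ψ q r
  set I := Iqr ψ q r
  have hD0 : 0 < D := lt_of_lt_of_le (by positivity) hj
  have hVe := VV_pos (Pe q r) (Pe_prime q r)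
  have hVd := VV_pos (Pd q r) (Pd_prime q r)
  have hδ : 0 ≤ min d1 d2 := le_min hd1 hd2
  have hI0 : 0 ≤ I := by rw [hI]; positivity
  set M := q * r + ⌈(d1+d2)*L⌉₊
  have hM : (d1+d2)*L ≤ M := by
    refine (Nat.le_ceil _).trans ?_
    exact_mod_cast Nat.le_add_left _ _
  set Q1 := (Pd q r).filter (fun p => p ≤ T) with hQ1
  set Q1' := (Pd q r).filter (fun p => ¬ p ≤ T) with hQ1'
  set Q2 := (Pe q r).filter (fun p => p ≤ T) with hQ2
  set Q2' := (Pe q r).filter (fun p => ¬ p ≤ T) with hQ2'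
  have p1 : ∀ p ∈ Q1, p.Prime := fun p hp => Pd_prime q r p (mem_filter.1 hp).1
  have p1' : ∀ p ∈ Q1', p.Prime := fun p hp => Pd_prime q r p (mem_filter.1 hp).1
  have p2 : ∀ p ∈ Q2, p.Prime := fun p hp => Pe_prime q r p (mem_filter.1 hp).1
  have p2' : ∀ p ∈ Q2', p.Prime := fun p hp => Pe_prime q r p (mem_filter.1 hp).1
  have hdis : Disjoint Q1 Q2 := Finset.disjoint_of_subset_left (filter_subset _ _) (Finset.disjoint_of_subset_right (filter_subset _ _) Finset.disjoint_sdiff)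
  have hsv := sieveSum Q1 Q2 p1 p2 hdis T hT (fun p hp => (mem_filter.1 hp).2) (fun p hp => (mem_filter.1 hp).2) k hk M
    (fun c => ovl d1 d2 ((c:ℝ)/L)) (fun c => ovl_nonneg _ _ _) I (2 * min d1 d2) hI0 (by positivity)
    (fun m hm => by rw [hId]; exact trap_sum d1 d2 L hd1 hd2 hL M hM m hm)
  have hE : 2 * min d1 d2 ≤ I / 2^j := by
    rw [le_div_iff₀ (by positivity), hI]; gcongr
  have V1 := VV_pos Q1 p1
  have V1' := VV_pos Q1' p1'
  have V2 := VV_pos Q2 p2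
  have V2' := VV_pos Q2' p2'
  rw [prod_pow] at hsv
  change _ ≤ VV Q1 * VV Q2 ^2 * _ at hsv
  set X := exp (2*((j+2:ℕ):ℝ)/T)
  have step1 : ∑ n ∈ Icc 1 M, Wc q r n * ovl d1 d2 ((n:ℝ)/L) ≤
      (VV Q2'^2 * X) * ∑ c ∈ Icc 1 M, (if ∀ p ∈ Q1, ¬ p ∣ c then Wf Q2 c else 0) * ovl d1 d2 ((c:ℝ)/L) := by
    rw [mul_sum]
    refine sum_le_sum fun n hn => ?_
    rw [mem_Icc] at hn
    rw [← mul_assoc]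
    by_cases hz : d1 + d2 ≤ |(n:ℝ)/L|
    · rw [ovl_eq_zero _ _ _ hz]; simp
    refine mul_le_mul_of_nonneg_right ?_ (ovl_nonneg _ _ _)
    rw [not_le, abs_of_nonneg (by positivity), div_lt_iff₀ hL] at hz
    have hn2 : n < 2^(j+2) := by
      have : (d1+d2)*L ≤ 2*D := by
        rw [hD]
        have := le_max_left d1 d2
        have := le_max_right d1 d2
        nlinarith
      have : (n:ℝ) < 2^(j+2) := by
        calc (n:ℝ) < 2 * D := by linarith
          _ < 2 * 2^(j+1) := by linarith
          _ = _ := by ring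
      exact_mod_cast this
    unfold Wc
    by_cases h : ∀ p ∈ Pd q r, ¬ p ∣ n
    · rw [if_pos h, if_pos (fun p hp => h p (mem_filter.1 hp).1), Wf_split _ T, mul_comm]
      refine mul_le_mul_of_nonneg_right ?_ (Wf_nonneg Q2 p2 n)
      exact Wf_large Q2' p2' T hT (fun p hp => (mem_filter.1 hp).2) n (j+2) hn.1 hn2
    · rw [if_neg h]
      refine mul_nonneg (by positivity) ?_
      split_ifs
      · exact Wf_nonneg Q2 p2 n
      · exact le_rfl
  have hX : 0 < X := exp_pos _
  have h1 := VV_exp Q1' p1'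
  set Y := exp (2 * ∑ p ∈ Q1', 1/(p:ℝ))
  have hk0 := kap_nonneg q r
  set Z := (1 + (T:ℝ)^3*(1/2)^k + (T:ℝ)^2*((T:ℝ)+1)^k/2^j) with hZ
  have hZ0 : 0 ≤ Z := by positivity
  calc I2 ψ q r ≤ _ := hI2 M (Nat.le_add_right _ _)
    _ ≤ 2 * kap q r * ((VV Q2'^2 * X) * (VV Q1 * VV Q2 ^2 * (I * (1 + (T:ℝ)^3 * (1/2)^k) + I/2^j * ((T:ℝ)^2 * ((T:ℝ)+1)^k)))) := by
      refine mul_le_mul_of_nonneg_left (step1.trans (mul_le_mul_of_nonneg_left (hsv.trans ?_) (by positivity))) (by positivity)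
      gcongr
    _ = (2 * kap q r * I * VV Q1 * (VV Q2 * VV Q2')^2) * X * Z * 1 := by rw [hZ]; ring
    _ ≤ (2 * kap q r * I * VV Q1 * (VV Q2 * VV Q2')^2) * X * Z * (VV Q1' * Y) := by gcongr
    _ = (2 * kap q r * I * (VV Q1 * VV Q1') * (VV Q2 * VV Q2')^2) * (Y * X * Z) := by ring
    _ = _ := by rw [← VV_split, ← VV_split, hid]

lemma rpow_ev (a b K : ℝ) (hab : a < b) : ∀ᶠ x : ℝ in Filter.atTop, K * x^a ≤ x^b := by
  filter_upwards [(tendsto_rpow_atTop (sub_pos.2 hab)).eventually_ge_atTop K, Filter.eventually_ge_atTop 1] with x hx h1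
  have : x^b = x^(b-a) * x^a := by rw [← rpow_add (by linarith)]; ring_nf
  rw [this]
  exact mul_le_mul_of_nonneg_right hx (rpow_nonneg (by linarith) _)

lemma params_alg (j : ℕ) (y : ℝ) (hj : 4 ≤ (j:ℝ)) (hy : 80 ≤ y) (h1 : log j ≤ y/16) (h2 : 100*y ≤ √(j:ℝ)) :
    ∃ T k : ℕ, Even k ∧ 1 ≤ T ∧ (j:ℝ) ≤ (T:ℝ)^(1/4:ℝ) ∧
      exp (2*(T:ℝ)^(-(1/4):ℝ)) * exp (2*((j+2:ℕ):ℝ)/T) * (1 + (T:ℝ)^3*(1/2)^k + (T:ℝ)^2*((T:ℝ)+1)^k/2^j) ≤ 1 + exp (-(y/8)) := by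
  set T := ⌈exp y⌉₊ with hT
  set m := ⌈√(j:ℝ)⌉₊ with hm
  have ey1 : 1 ≤ exp y := one_le_exp (by linarith)
  have hTlo : exp y ≤ T := Nat.le_ceil _
  have hThi : (T:ℝ) ≤ 2 * exp y := by
    have := Nat.ceil_lt_add_one (a := exp y) (by positivity)
    linarith
  have hj0 : (0:ℝ) < j := by linarith
  have hjexp : (j:ℝ) ≤ exp (y/16) := by
    rw [← Real.log_le_iff_le_exp hj0]; exact h1
  have hT1 : 1 ≤ T := by
    have : (1:ℝ) ≤ T := ey1.trans hTlo
    exact_mod_cast this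
  have hT0 : (0:ℝ) < T := by positivity
  have hlow : exp (y/4) ≤ (T:ℝ)^(1/4:ℝ) := by
    calc exp (y/4) = (exp y)^(1/4:ℝ) := by rw [← exp_mul]; ring_nf
      _ ≤ _ := rpow_le_rpow (by positivity) hTlo (by norm_num)
  refine ⟨T, 2*m, even_two_mul m, hT1, hjexp.trans ((exp_le_exp.2 (by linarith)).trans hlow), ?_⟩
  set z := exp (-(y/4)) with hz
  have hz0 : 0 < z := exp_pos _
  have a1 : (T:ℝ)^(-(1/4):ℝ) ≤ z := by
    rw [rpow_neg hT0.le, hz, exp_neg]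
    exact inv_anti₀ (exp_pos _) hlow
  have e8 : (8:ℝ) ≤ exp (y/8) := by
    have := add_one_le_exp (y/8); linarith
  have a2 : 2*((j+2:ℕ):ℝ)/T ≤ z := by
    rw [div_le_iff₀ hT0]
    have : z * exp y ≤ z * T := by gcongr
    refine le_trans ?_ this
    rw [hz, ← exp_add]
    push_cast
    have h3 : 2*((j:ℝ)+2) ≤ 3*j := by linarith
    have h4 : 8 * exp (y/16) ≤ exp (-(y/4)+y) := by
      calc 8 * exp (y/16) ≤ exp (y/8) * exp (y/16) := by gcongr
        _ = exp (y/8+y/16) := by rw [exp_add]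
        _ ≤ _ := exp_le_exp.2 (by linarith)
    nlinarith [exp_pos (y/16)]
  have hmlo : √(j:ℝ) ≤ m := Nat.le_ceil _
  have hmhi : (m:ℝ) ≤ √(j:ℝ) + 1 := (Nat.ceil_lt_add_one (Real.sqrt_nonneg _)).le
  have a3 : (T:ℝ)^3*(1/2)^(2*m) ≤ z := by
    have b1 : (T:ℝ)^3 ≤ 8 * exp (3*y) := by
      calc (T:ℝ)^3 ≤ (2*exp y)^3 := by gcongr
        _ = 8 * exp (3*y) := by rw [mul_pow, ← exp_nat_mul]; norm_num
    have b2 : (1/2:ℝ)^(2*m) ≤ exp (-√(j:ℝ)) := by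
      rw [pow_mul]
      calc ((1/2:ℝ)^2)^m ≤ (exp (-1))^m := by
            gcongr
            have := exp_one_lt_d9
            rw [exp_neg]
            rw [show ((1:ℝ)/2)^2 = (4:ℝ)⁻¹ by norm_num]
            exact inv_anti₀ (exp_pos _) (by linarith)
        _ = exp (-m) := by rw [← exp_nat_mul]; ring_nf
        _ ≤ _ := exp_le_exp.2 (by linarith)
    calc (T:ℝ)^3*(1/2)^(2*m) ≤ (8 * exp (3*y)) * exp (-√(j:ℝ)) := by gcongr
      _ ≤ (exp (y/8) * exp (3*y)) * exp (-√(j:ℝ)) := by gcongr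
      _ = exp (y/8+3*y + -√(j:ℝ)) := by rw [exp_add, exp_add]
      _ ≤ z := exp_le_exp.2 (by linarith)
  have a4 : (T:ℝ)^2*((T:ℝ)+1)^(2*m)/2^j ≤ z := by
    have b0 : (T:ℝ)+1 ≤ exp (2*y) := by
      have : 3 ≤ exp y := by have := add_one_le_exp y; linarith
      calc (T:ℝ)+1 ≤ 3 * exp y := by linarith
        _ ≤ exp y * exp y := by gcongr
        _ = _ := by rw [← exp_add]; ring_nf
    have b1 : (T:ℝ)^2*((T:ℝ)+1)^(2*m) ≤ exp (6*√(j:ℝ)*y) := by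
      calc (T:ℝ)^2*((T:ℝ)+1)^(2*m) ≤ ((T:ℝ)+1)^2*((T:ℝ)+1)^(2*m) := by gcongr; linarith
        _ = ((T:ℝ)+1)^(2+2*m) := by rw [pow_add]
        _ ≤ (exp (2*y))^(2+2*m) := by gcongr
        _ = exp ((2+2*m)*(2*y)) := by rw [← exp_nat_mul]; push_cast; rfl
        _ ≤ _ := by
          apply exp_le_exp.2
          have : (2+2*(m:ℝ))*2 ≤ 6*√(j:ℝ) := by linarith
          nlinarith
    have b2 : exp ((j:ℝ)/2) ≤ 2^j := by
      calc exp ((j:ℝ)/2) = (exp (1/2))^j := by rw [← exp_nat_mul]; ring_nf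
        _ ≤ 2^j := by
          gcongr
          have h := exp_one_lt_d9
          have : exp (1/2) * exp (1/2) = exp 1 := by rw [← exp_add]; norm_num
          nlinarith [exp_pos (1/2)]
    rw [div_le_iff₀ (by positivity)]
    calc _ ≤ exp (6*√(j:ℝ)*y) := b1
      _ ≤ exp (-(y/4) + (j:ℝ)/2) := by
        apply exp_le_exp.2
        have hs : √(j:ℝ)*√(j:ℝ) = j := mul_self_sqrt hj0.le
        have : 1 ≤ √(j:ℝ) := by linarith
        nlinarith [mul_le_mul_of_nonneg_left h2 (Real.sqrt_nonneg (j:ℝ))]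
      _ = z * exp ((j:ℝ)/2) := by rw [exp_add]
      _ ≤ _ := by gcongr
  have a5 : 10 * z ≤ exp (-(y/8)) := by
    have : (10:ℝ) ≤ exp (y/8) := by
      have := add_one_le_exp (y/8); linarith
    calc 10*z ≤ exp (y/8) * z := by gcongr
      _ = _ := by rw [hz, ← exp_add]; ring_nf
  have a6 : exp (5*z) ≤ 1 + 10*z := by
    have h8 : exp (-(y/8)) ≤ 1 := exp_le_one_iff.2 (by linarith)
    have := Real.abs_exp_sub_one_le (x := 5*z) (by rw [abs_of_pos (by positivity)]; linarith)
    rw [abs_of_pos (show 0 < 5*z by positivity)] at this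
    linarith [le_abs_self (exp (5*z) - 1)]
  calc _ ≤ exp (2*z) * exp z * (1+z+z) := by gcongr
    _ ≤ exp (2*z) * exp z * exp (2*z) := by
      gcongr
      have := add_one_le_exp (2*z); linarith
    _ = exp (5*z) := by rw [← exp_add, ← exp_add]; ring_nf
    _ ≤ _ := by linarith

lemma params (κ : ℝ) (hκ : 0 < κ) (hκ2 : κ < 1/2) : ∃ j1 : ℕ, ∀ j ≥ j1, 
    ∃ T k : ℕ, Even k ∧ 1 ≤ T ∧ (j:ℝ) ≤ (T:ℝ)^(1/4:ℝ) ∧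
      exp (2*(T:ℝ)^(-(1/4):ℝ)) * exp (2*((j+2:ℕ):ℝ)/T) * (1 + (T:ℝ)^3*(1/2)^k + (T:ℝ)^2*((T:ℝ)+1)^k/2^j) ≤ 1 + exp (-((j:ℝ)^κ/8)) := by
  have t1 : Filter.Tendsto (fun j : ℕ => (j:ℝ)^κ) Filter.atTop Filter.atTop := (tendsto_rpow_atTop hκ).comp tendsto_natCast_atTop_atTop
  have t2 : ∀ᶠ x : ℝ in Filter.atTop, log x ≤ x^κ/16 := by
    filter_upwards [(isLittleO_log_rpow_atTop hκ).bound (show (0:ℝ) < 1/16 by norm_num), Filter.eventually_ge_atTop 1] with x hx h1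
    rw [Real.norm_eq_abs, Real.norm_eq_abs, abs_of_nonneg (rpow_nonneg (by linarith) _)] at hx
    linarith [le_abs_self (log x)]
  have t3 : ∀ᶠ x : ℝ in Filter.atTop, 100 * x^κ ≤ √x := by
    filter_upwards [rpow_ev κ (1/2) 100 hκ2] with x hx
    rw [sqrt_eq_rpow]; exact hx
  have := (tendsto_natCast_atTop_atTop (R := ℝ)).eventually (t2.and t3)
  obtain ⟨j1, h⟩ := Filter.eventually_atTop.1 (this.and ((t1.eventually_ge_atTop 80).and ((tendsto_natCast_atTop_atTop (R := ℝ)).eventually_ge_atTop 4)))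
  exact ⟨j1, fun j hj => by
    obtain ⟨⟨a, b⟩, c, d⟩ := h j hj
    exact params_alg j _ d c a b⟩

lemma muw_nonneg (ψ : ℕ → ℝ) (hψ : ∀ n, 0 ≤ ψ n) (n : ℕ) : 0 ≤ muw ψ n :=
  div_nonneg (mul_nonneg (Nat.cast_nonneg _) (hψ n)) (Nat.cast_nonneg _)

lemma Dd_lt (ψ : ℕ → ℝ) (hψ : ∀ n, 0 ≤ ψ n) (hψ2 : ∀ n, ψ n ≤ 1/2) (N q r : ℕ) (hq : 0 < q) (hqN : q ≤ N) (hrN : r ≤ N) :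
    Dd ψ q r < 2^N := by
  unfold Dd
  have hg : (1:ℝ) ≤ Nat.gcd q r := by exact_mod_cast Nat.gcd_pos_of_pos_left r hq
  have h1 : (q:ℝ) ≤ N := by exact_mod_cast hqN
  have h2 : (r:ℝ) ≤ N := by exact_mod_cast hrN
  have h3 : (N:ℝ) < 2^N := by exact_mod_cast Nat.lt_two_pow_self
  have hq0 : (0:ℝ) ≤ q := by positivity
  have hr0 : (0:ℝ) ≤ r := by positivity
  have h4 : max ((r:ℝ) * ψ q) ((q:ℝ) * ψ r) ≤ N := by
    refine max_le ?_ ?_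
    · nlinarith [hψ2 q, hψ q]
    · nlinarith [hψ2 r, hψ r]
  have h5 : 0 ≤ max ((r:ℝ) * ψ q) ((q:ℝ) * ψ r) := (mul_nonneg hr0 (hψ q)).trans (le_max_left _ _)
  exact ((div_le_self h5 hg).trans h4).trans_lt h3

open Classical in
lemma pair_bound (κ : ℝ) (hκ : 0 < κ) (hκ2 : κ < 1/2) : ∃ j1 : ℕ, ∀ (ψ : ℕ → ℝ), (∀ n, 0 ≤ ψ n) → (∀ n, ψ n ≤ 1/2) →
    ∀ (N q r j0 : ℕ), j1 ≤ j0 → 0 < q → q ≤ N → 0 < r → r ≤ N → q ≠ r →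
    I2 ψ q r ≤ 16*2^j0 * (if Dd ψ q r ≤ 2^j0 then muw ψ q * muw ψ r * hP q r else 0) + 4 * (1 + exp (-((j0:ℝ)^κ/8))) * (muw ψ q * muw ψ r)
      + 32 * ∑ j ∈ range N, (1/2)^j * (if Dd ψ q r ≤ 2^(j+1) then muw ψ q * muw ψ r * hP q r else 0) := by
  obtain ⟨j1, hj1⟩ := params κ hκ hκ2
  refine ⟨j1, fun ψ hψ hψ2 N q r j0 hj0 hq hqN hr hrN hne => ?_⟩
  have hm : 0 ≤ muw ψ q * muw ψ r := mul_nonneg (muw_nonneg ψ hψ q) (muw_nonneg ψ hψ r)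
  have hh : 0 < hP q r := exp_pos _
  have hmh : 0 ≤ muw ψ q * muw ψ r * hP q r := by positivity
  have hcr := crude ψ hψ q r hq hr hne
  set σ := ∑ p ∈ Pd q r, 1/√(p:ℝ) with hσ
  have hσ0 : 0 ≤ σ := sum_nonneg fun _ _ => by positivity
  set D := Dd ψ q r with hD
  have n3 : 0 ≤ 32 * ∑ j ∈ range N, (1/2:ℝ)^j * (if D ≤ 2^(j+1) then muw ψ q * muw ψ r * hP q r else 0) := by
    refine mul_nonneg (by norm_num) (sum_nonneg fun j _ => mul_nonneg (by positivity) ?_)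
    split_ifs <;> positivity
  have n2 : 0 ≤ 4 * (1 + exp (-((j0:ℝ)^κ/8))) * (muw ψ q * muw ψ r) := by positivity
  by_cases hD0 : D ≤ 2^j0
  · rw [if_pos hD0]
    have : I2 ψ q r ≤ 16*2^j0 * (muw ψ q * muw ψ r * hP q r) := by
      refine hcr.trans ?_
      have : exp (2*σ) ≤ hP q r := exp_le_exp.2 (by linarith)
      gcongr
    linarith
  rw [if_neg hD0, mul_zero, zero_add]
  rw [not_le] at hD0
  have hD1 : 1 ≤ D := (one_le_pow₀ (by norm_num : (1:ℝ) ≤ 2)).trans hD0.le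
  obtain ⟨j, hja, hjb⟩ := exists_nat_pow_near hD1 (by norm_num : (1:ℝ) < 2)
  have hj0j : j0 ≤ j := by
    have : (2:ℝ)^j0 < 2^(j+1) := hD0.trans hjb
    have := (pow_lt_pow_iff_right₀ (by norm_num : (1:ℝ) < 2)).1 this
    omega
  have hjN : j < N := (pow_lt_pow_iff_right₀ (by norm_num : (1:ℝ) < 2)).1 (hja.trans_lt (Dd_lt ψ hψ hψ2 N q r hq hqN hrN))
  obtain ⟨T, k, hk, hT, hTj, hpar⟩ := hj1 j (hj0.trans hj0j)
  have hT0 : (0:ℝ) < T := by exact_mod_cast hT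
  by_cases hs : ∑ p ∈ (Pd q r).filter (fun p => ¬ p ≤ T), 1/(p:ℝ) ≤ (T:ℝ)^(-(1/4):ℝ)
  · have h1 := sieveB ψ hψ q r hq hr hne j T k hk hT hja hjb
    have h2 : I2 ψ q r ≤ 4 * (muw ψ q * muw ψ r) * (1 + exp (-((j0:ℝ)^κ/8))) := by
      refine h1.trans ?_
      refine mul_le_mul_of_nonneg_left ?_ (by positivity)
      calc _ ≤ exp (2*(T:ℝ)^(-(1/4):ℝ)) * exp (2*((j+2:ℕ):ℝ)/T) * (1 + (T:ℝ)^3*(1/2)^k + (T:ℝ)^2*((T:ℝ)+1)^k/2^j) := by gcongr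
        _ ≤ _ := hpar
        _ ≤ _ := by gcongr
    linarith
  · rw [not_le] at hs
    have h1 : (j:ℝ) ≤ σ := by
      refine hTj.trans ?_
      have a : √(T:ℝ) * ∑ p ∈ (Pd q r).filter (fun p => ¬ p ≤ T), 1/(p:ℝ) ≤ σ := by
        rw [mul_sum]
        calc _ ≤ ∑ p ∈ (Pd q r).filter (fun p => ¬ p ≤ T), 1/√(p:ℝ) := by
              refine sum_le_sum fun p hp => ?_
              have hpT : (T:ℝ) ≤ p := by exact_mod_cast (not_le.1 (mem_filter.1 hp).2).le
              have hp0 : (0:ℝ) < p := by linarith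
              have hsp : √(p:ℝ)*√(p:ℝ) = p := mul_self_sqrt hp0.le
              have : 0 < √(p:ℝ) := Real.sqrt_pos.2 hp0
              have : √(T:ℝ) ≤ √(p:ℝ) := Real.sqrt_le_sqrt hpT
              rw [mul_one_div, div_le_div_iff₀ hp0 (by positivity), one_mul]
              nlinarith
          _ ≤ σ := sum_le_sum_of_subset_of_nonneg (filter_subset _ _) fun _ _ _ => by positivity
      calc (T:ℝ)^(1/4:ℝ) = √(T:ℝ) * (T:ℝ)^(-(1/4):ℝ) := by
            rw [sqrt_eq_rpow, ← rpow_add hT0]; norm_num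
        _ ≤ √(T:ℝ) * ∑ p ∈ (Pd q r).filter (fun p => ¬ p ≤ T), 1/(p:ℝ) := by gcongr
        _ ≤ σ := a
    have h2 : exp (2*σ) * 2^j ≤ hP q r * (1/2)^j := by
      have e : hP q r = exp (2*σ) * exp (2*σ) := by
        rw [← exp_add]; unfold hP; rw [← hσ]; ring_nf
      have : (4:ℝ)^j ≤ exp (2*σ) := by
        calc (4:ℝ)^j ≤ (exp 2)^j := by
              gcongr
              have := exp_one_gt_d9
              have e2 : exp 2 = exp 1 * exp 1 := by rw [← exp_add]; norm_num
              nlinarith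
          _ = exp (2*j) := by rw [← exp_nat_mul]; ring_nf
          _ ≤ _ := exp_le_exp.2 (by linarith)
      rw [e, mul_assoc]
      refine mul_le_mul_of_nonneg_left ?_ (exp_pos _).le
      calc (2:ℝ)^j = 4^j * (1/2)^j := by rw [← mul_pow]; norm_num
        _ ≤ _ := by gcongr
    have h3 : I2 ψ q r ≤ 32 * ((1/2)^j * (muw ψ q * muw ψ r * hP q r)) := by
      calc I2 ψ q r ≤ _ := hcr
        _ ≤ 16 * 2^(j+1) * (muw ψ q * muw ψ r * exp (2*σ)) := by gcongr
        _ = 32 * (muw ψ q * muw ψ r) * (exp (2*σ) * 2^j) := by ring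
        _ ≤ 32 * (muw ψ q * muw ψ r) * (hP q r * (1/2)^j) := by gcongr
        _ = _ := by ring
    have h4 : (1/2:ℝ)^j * (muw ψ q * muw ψ r * hP q r) ≤ ∑ j ∈ range N, (1/2:ℝ)^j * (if D ≤ 2^(j+1) then muw ψ q * muw ψ r * hP q r else 0) := by
      have := single_le_sum (f := fun j => (1/2:ℝ)^j * (if D ≤ 2^(j+1) then muw ψ q * muw ψ r * hP q r else 0)) (s := range N)
        (fun j _ => mul_nonneg (by positivity) (by split_ifs <;> positivity)) (mem_range.2 hjN)
      simp only [if_pos hjb.le] at this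
      exact this
    linarith

lemma varsum0 (κ : ℝ) (hκ : 0 < κ) (hκ2 : κ < 1/2) : ∃ (C : ℝ) (j1 : ℕ), 0 < C ∧ ∀ (ψ : ℕ → ℝ), (∀ n, 0 ≤ ψ n) → (∀ n, ψ n ≤ 1/2) →
    ∀ (N j0 : ℕ), j1 ≤ j0 → 
    ∑ q ∈ Icc 1 N, ∑ r ∈ Icc 1 N, (if q = r then 0 else I2 ψ q r) ≤
      C * ((2:ℝ)^j0)^(3/2:ℝ) * (∑ n ∈ Icc 1 N, muw ψ n)^(3/2:ℝ) + 4 * (1 + exp (-((j0:ℝ)^κ/8))) * (∑ n ∈ Icc 1 N, muw ψ n)^2 := by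
  classical
  obtain ⟨C, hC, htr⟩ := transfer
  obtain ⟨j1, hpb⟩ := pair_bound κ hκ hκ2
  refine ⟨272*C, j1, by positivity, fun ψ hψ hψ2 N j0 hj0 => ?_⟩
  set X := ∑ n ∈ Icc 1 N, muw ψ n with hX
  have hX0 : 0 ≤ X := sum_nonneg fun n _ => muw_nonneg ψ hψ n
  set Y := X^(3/2:ℝ)
  have hY : 0 ≤ Y := rpow_nonneg hX0 _
  set t := (2:ℝ)^j0
  have ht1 : 1 ≤ t := one_le_pow₀ (by norm_num)
  set c4 := 4 * (1 + exp (-((j0:ℝ)^κ/8)))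
  have step1 : ∑ q ∈ Icc 1 N, ∑ r ∈ Icc 1 N, (if q = r then 0 else I2 ψ q r) ≤
      ∑ q ∈ Icc 1 N, ∑ r ∈ Icc 1 N, (16*t * (if Dd ψ q r ≤ t then muw ψ q * muw ψ r * hP q r else 0) + c4 * (muw ψ q * muw ψ r)
      + 32 * ∑ j ∈ range N, (1/2)^j * (if Dd ψ q r ≤ 2^(j+1) then muw ψ q * muw ψ r * hP q r else 0)) := by
    refine sum_le_sum fun q hq => sum_le_sum fun r hr => ?_
    rw [mem_Icc] at hq hr
    by_cases h : q = r
    · rw [if_pos h]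
      have hm : 0 ≤ muw ψ q * muw ψ r := mul_nonneg (muw_nonneg ψ hψ q) (muw_nonneg ψ hψ r)
      have hh : 0 < hP q r := exp_pos _
      have : 0 ≤ ∑ j ∈ range N, (1/2:ℝ)^j * (if Dd ψ q r ≤ 2^(j+1) then muw ψ q * muw ψ r * hP q r else 0) := 
        sum_nonneg fun j _ => mul_nonneg (by positivity) (by split_ifs <;> positivity)
      have h2 : 0 ≤ (if Dd ψ q r ≤ t then muw ψ q * muw ψ r * hP q r else 0) := by split_ifs <;> positivity
      positivity
    · rw [if_neg h]
      exact hpb ψ hψ hψ2 N q r j0 hj0 hq.1 hq.2 hr.1 hr.2 h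
  refine step1.trans ?_
  have e3 : ∑ q ∈ Icc 1 N, ∑ r ∈ Icc 1 N, ∑ j ∈ range N, (1/2:ℝ)^j * (if Dd ψ q r ≤ 2^(j+1) then muw ψ q * muw ψ r * hP q r else 0)
      = ∑ j ∈ range N, (1/2:ℝ)^j * ∑ q ∈ Icc 1 N, ∑ r ∈ Icc 1 N, (if Dd ψ q r ≤ 2^(j+1) then muw ψ q * muw ψ r * hP q r else 0) := by
    simp_rw [mul_sum]
    have : ∀ q ∈ Icc 1 N, ∑ r ∈ Icc 1 N, ∑ j ∈ range N, (1/2:ℝ)^j * (if Dd ψ q r ≤ 2^(j+1) then muw ψ q * muw ψ r * hP q r else 0)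
       = ∑ j ∈ range N, ∑ r ∈ Icc 1 N, (1/2:ℝ)^j * (if Dd ψ q r ≤ 2^(j+1) then muw ψ q * muw ψ r * hP q r else 0) := fun q _ => sum_comm
    rw [sum_congr rfl this, sum_comm]
  have e1 : ∑ i ∈ Icc 1 N, muw ψ i * ∑ i ∈ Icc 1 N, muw ψ i = X^2 := by
    rw [← sum_mul, pow_two]
  simp only [sum_add_distrib, ← mul_sum]
  rw [e1, e3]
  have b1 := htr ψ hψ N t (by positivity)
  have b3 : ∑ j ∈ range N, (1/2:ℝ)^j * ∑ q ∈ Icc 1 N, ∑ r ∈ Icc 1 N, (if Dd ψ q r ≤ 2^(j+1) then muw ψ q * muw ψ r * hP q r else 0) ≤ 8 * C * Y := by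
    have : ∀ j ∈ range N, (1/2:ℝ)^j * ∑ q ∈ Icc 1 N, ∑ r ∈ Icc 1 N, (if Dd ψ q r ≤ 2^(j+1) then muw ψ q * muw ψ r * hP q r else 0) ≤ (2*C*Y) * (3/4)^j := by
      intro j _
      have b := htr ψ hψ N (2^(j+1)) (by positivity)
      have s : ((2:ℝ)^(j+1))^(1/2:ℝ) ≤ 2*(3/2)^j := by
        rw [← sqrt_eq_rpow, sqrt_le_left (by positivity)]
        calc (2:ℝ)^(j+1) = 2 * 2^j := by ring
          _ ≤ 4 * (9/4)^j := by gcongr <;> norm_num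
          _ = _ := by rw [mul_pow, ← pow_mul, mul_comm j 2, pow_mul]; norm_num
      calc _ ≤ (1/2:ℝ)^j * (C * ((2:ℝ)^(j+1))^(1/2:ℝ) * Y) := by gcongr
        _ ≤ (1/2:ℝ)^j * (C * (2*(3/2)^j) * Y) := by gcongr
        _ = (2*C*Y) * ((1/2)^j*(3/2)^j) := by ring
        _ = _ := by rw [← mul_pow]; norm_num
    refine (sum_le_sum this).trans ?_
    rw [← mul_sum]
    have g : ∑ j ∈ range N, (3/4:ℝ)^j ≤ 4 := by
      have := Summable.sum_le_tsum (f := fun j : ℕ => (3/4:ℝ)^j) (range N) (fun _ _ => by positivity) (summable_geometric_of_lt_one (by norm_num) (by norm_num))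
      rw [tsum_geometric_of_lt_one (by norm_num) (by norm_num)] at this
      linarith
    calc _ ≤ (2*C*Y)*4 := by gcongr
      _ = _ := by ring
  have ht32 : t^(3/2:ℝ) = t * t^(1/2:ℝ) := by
    rw [show (3/2:ℝ) = 1 + 1/2 by norm_num, rpow_add (by linarith), rpow_one]
  have ht32' : 1 ≤ t^(3/2:ℝ) := Real.one_le_rpow ht1 (by norm_num)
  calc _ ≤ 16*t*(C * t^(1/2:ℝ) * Y) + c4*X^2 + 32*(8*C*Y) := by gcongr
    _ = 16*C*t^(3/2:ℝ)*Y + 256*C*Y*1 + c4*X^2 := by rw [ht32]; ring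
    _ ≤ 16*C*t^(3/2:ℝ)*Y + 256*C*Y*t^(3/2:ℝ) + c4*X^2 := by gcongr
    _ = _ := by ring

lemma varsum (κ : ℝ) (hκ : 0 < κ) (hκ2 : κ < 1/2) : ∃ X0 : ℝ, 1 ≤ X0 ∧ ∀ (ψ : ℕ → ℝ), (∀ n, 0 ≤ ψ n) → (∀ n, ψ n ≤ 1/2) →
    ∀ (N : ℕ), X0 ≤ ∑ n ∈ Icc 1 N, muw ψ n → 
    ∑ q ∈ Icc 1 N, ∑ r ∈ Icc 1 N, (if q = r then 0 else I2 ψ q r) ≤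
      (4 + exp (-(log (∑ n ∈ Icc 1 N, muw ψ n))^κ)) * (∑ n ∈ Icc 1 N, muw ψ n)^2 := by
  set κ' := (κ + 1/2)/2 with hκ'
  obtain ⟨C, j1, hC, h⟩ := varsum0 κ' (by linarith) (by linarith)
  have ev : ∀ᶠ u : ℝ in Filter.atTop, 12*((j1:ℝ)+1) ≤ u ∧ (2*8*12^κ') * u^κ ≤ u^κ' ∧ 8 * u^κ ≤ u^(1:ℝ) ∧ 3 + log (2*C) ≤ u^κ ∧ 3 ≤ u^κ := by
    filter_upwards [Filter.eventually_ge_atTop (12*((j1:ℝ)+1)), rpow_ev κ κ' (2*8*12^κ') (by linarith), rpow_ev κ 1 8 (by linarith),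
      (tendsto_rpow_atTop hκ).eventually_ge_atTop (3 + log (2*C)), (tendsto_rpow_atTop hκ).eventually_ge_atTop 3] with u a b c d e
    exact ⟨a, b, c, d, e⟩
  obtain ⟨X0, hX0⟩ := Filter.eventually_atTop.1 (tendsto_log_atTop.eventually ev)
  refine ⟨max 1 X0, le_max_left _ _, fun ψ hψ hψ2 N hX => ?_⟩
  obtain ⟨a, b, c, d, e⟩ := hX0 _ ((le_max_right _ _).trans hX)
  have hX1 := (le_max_left 1 X0).trans hX
  set X := ∑ n ∈ Icc 1 N, muw ψ n
  set u := log X with hu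
  have hX0 : 0 < X := by linarith
  have hXu : X = exp u := (exp_log hX0).symm
  have hj1 : (0:ℝ) ≤ j1 := Nat.cast_nonneg _
  have hu12 : 12 ≤ u := le_trans (by linarith only [hj1]) a
  have hu0 : 0 < u := by linarith only [hu12]
  set j0 := ⌊u/6⌋₊
  have hj0hi : (j0:ℝ) ≤ u/6 := Nat.floor_le (by positivity)
  have hj0lo : u/12 ≤ j0 := by
    have : u/6 < (j0:ℝ)+1 := Nat.lt_floor_add_one (u/6)
    linarith only [this, hu12]
  have hj0 : j1 ≤ j0 := Nat.le_floor (by linarith only [a, hj1])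
  have hm := h ψ hψ hψ2 N j0 hj0
  refine hm.trans ?_
  rw [rpow_one] at c
  set v := u^κ
  have t1 : C * ((2:ℝ)^j0)^(3/2:ℝ) * X^(3/2:ℝ) ≤ (exp (-v)/2) * X^2 := by
    have p1 : (2:ℝ)^j0 ≤ exp (u/6) := by
      calc (2:ℝ)^j0 ≤ (exp 1)^j0 := by
            gcongr
            have := exp_one_gt_d9; linarith
        _ = exp j0 := by rw [← exp_nat_mul]; ring_nf
        _ ≤ _ := exp_le_exp.2 hj0hi
    have p2 : ((2:ℝ)^j0)^(3/2:ℝ) ≤ exp (u/4) := by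
      calc _ ≤ (exp (u/6))^(3/2:ℝ) := rpow_le_rpow (by positivity) p1 (by norm_num)
        _ = _ := by rw [← exp_mul]; ring_nf
    have p3 : X^(3/2:ℝ) = exp (3*u/2) := by rw [hXu, ← exp_mul]; ring_nf
    have p4 : X^2 = exp (2*u) := by rw [hXu, ← exp_nat_mul]; norm_num
    have p5 : 2*C ≤ exp (v-3) := by
      rw [← Real.log_le_iff_le_exp (by positivity)]; linarith
    rw [p3, p4]
    have : 2 * C * exp (u/4) * exp (3*u/2) ≤ exp (-v) * exp (2*u) := by
      calc _ ≤ exp (v-3) * exp (u/4) * exp (3*u/2) := by gcongr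
        _ = exp (v-3+u/4+3*u/2) := by rw [exp_add, exp_add]
        _ ≤ exp (-v+2*u) := exp_le_exp.2 (by linarith)
        _ = _ := exp_add _ _
    calc _ ≤ C * exp (u/4) * exp (3*u/2) := by gcongr
      _ ≤ _ := by linarith
  have t2 : 4 * exp (-((j0:ℝ)^κ'/8)) ≤ exp (-v)/2 := by
    have p1 : 2*v ≤ (j0:ℝ)^κ'/8 := by
      have q1 : (u/12)^κ' ≤ (j0:ℝ)^κ' := rpow_le_rpow (by positivity) hj0lo (by linarith)
      rw [div_rpow hu0.le (by norm_num)] at q1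
      have h12 : (0:ℝ) < 12^κ' := by positivity
      have : 2*8*v ≤ u^κ'/12^κ' := by rw [le_div_iff₀ h12]; linarith
      linarith
    have p2 : (8:ℝ) ≤ exp v := by
      have : exp 3 ≤ exp v := exp_le_exp.2 e
      have e3 : exp 3 = exp 1 * exp 1 * exp 1 := by rw [← exp_add, ← exp_add]; norm_num
      have h1 := exp_one_gt_d9
      have h2 : (2:ℝ) ≤ exp 1 := by linarith
      have : (2:ℝ)*2*2 ≤ exp 1 * exp 1 * exp 1 := by gcongr
      linarith
    have p3 : exp (-((j0:ℝ)^κ'/8)) ≤ exp (-v) * exp (-v) := by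
      rw [← exp_add]; exact exp_le_exp.2 (by linarith)
    have p4 : exp (-v) * 8 ≤ 1 := by
      calc _ ≤ exp (-v) * exp v := by gcongr
        _ = 1 := by rw [← exp_add]; simp
    nlinarith [exp_pos (-v)]
  have hX2 : 0 ≤ X^2 := by positivity
  nlinarith

noncomputable def fI (ψ : ℕ → ℝ) (n a : ℕ) : ℝ → ℝ :=
  (Set.Icc ((a:ℝ)/n - ψ n/n) ((a:ℝ)/n + ψ n/n)).indicator (fun _ => (1:ℝ))

noncomputable def FF (ψ : ℕ → ℝ) (N : ℕ) (α : ℝ) : ℝ :=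
  ∑ n ∈ Icc 1 N, ∑ a ∈ Un n, fI ψ n a α

lemma fI_int (ψ : ℕ → ℝ) (n a : ℕ) : Integrable (fI ψ n a) := by
  unfold fI
  rw [integrable_indicator_iff measurableSet_Icc]
  exact continuousOn_const.integrableOn_compact isCompact_Icc

lemma fI_nonneg (ψ : ℕ → ℝ) (n a : ℕ) (x : ℝ) : 0 ≤ fI ψ n a x :=
  Set.indicator_nonneg (fun _ _ => zero_le_one) x

lemma fI_integral (ψ : ℕ → ℝ) (hψ : ∀ n, 0 ≤ ψ n) (n a : ℕ) : ∫ x, fI ψ n a x = 2 * (ψ n / n) := by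
  unfold fI
  rw [integral_indicator measurableSet_Icc, setIntegral_const]
  have : 0 ≤ ψ n / n := div_nonneg (hψ n) (Nat.cast_nonneg n)
  rw [Real.volume_real_Icc_of_le (by linarith)]
  simp; ring

lemma fI_mul (ψ : ℕ → ℝ) (q r a b : ℕ) : (fun x => fI ψ q a x * fI ψ r b x) =
   (Set.Icc (max ((a:ℝ)/q - ψ q/q) ((b:ℝ)/r - ψ r/r)) (min ((a:ℝ)/q + ψ q/q) ((b:ℝ)/r + ψ r/r))).indicator (fun _ => (1:ℝ)) := by
  unfold fI
  rw [← Set.Icc_inter_Icc]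
  ext x
  by_cases h1 : x ∈ Set.Icc ((a:ℝ)/q - ψ q/q) ((a:ℝ)/q + ψ q/q) <;>
  by_cases h2 : x ∈ Set.Icc ((b:ℝ)/r - ψ r/r) ((b:ℝ)/r + ψ r/r) <;>
  simp [Set.indicator, h1, h2, -Set.mem_Icc]

lemma fI_mul_int (ψ : ℕ → ℝ) (q r a b : ℕ) : Integrable (fun x => fI ψ q a x * fI ψ r b x) := by
  rw [fI_mul, integrable_indicator_iff measurableSet_Icc]
  exact continuousOn_const.integrableOn_compact isCompact_Icc

lemma fI_mul_integral (ψ : ℕ → ℝ) (q r a b : ℕ) :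
    ∫ x, fI ψ q a x * fI ψ r b x = ovl (ψ q/q) (ψ r/r) ((a:ℝ)/q-(b:ℝ)/r) := by
  rw [fI_mul, integral_indicator measurableSet_Icc, setIntegral_const, Real.volume_real_Icc]
  unfold ovl
  rw [smul_eq_mul, mul_one, max_comm]
  congr 1
  generalize ψ q/q = d1
  generalize ψ r/r = d2
  generalize (a:ℝ)/q = x
  generalize (b:ℝ)/r = y
  apply le_antisymm
  · refine le_min ?_ ?_
    · rcases min_cases d1 d2 with ⟨h,_⟩ | ⟨h,_⟩ <;> rw [h]
      · linarith [min_le_left (x+d1) (y+d2), le_max_left (x-d1) (y-d2)]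
      · linarith [min_le_right (x+d1) (y+d2), le_max_right (x-d1) (y-d2)]
    · rcases abs_cases (x-y) with ⟨h,_⟩ | ⟨h,_⟩ <;> rw [h]
      · linarith [min_le_right (x+d1) (y+d2), le_max_left (x-d1) (y-d2)]
      · linarith [min_le_left (x+d1) (y+d2), le_max_right (x-d1) (y-d2)]
  · have h1 := min_le_left (2*min d1 d2) (d1+d2-|x-y|)
    have h2 := min_le_right (2*min d1 d2) (d1+d2-|x-y|)
    have h3 := min_le_left d1 d2
    have h4 := min_le_right d1 d2
    have h5 := le_abs_self (x-y)
    have h6 := neg_abs_le (x-y)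
    rcases min_cases (x+d1) (y+d2) with ⟨h,_⟩ | ⟨h,_⟩ <;> rw [h] <;>
    rcases max_cases (x-d1) (y-d2) with ⟨h',_⟩ | ⟨h',_⟩ <;> rw [h'] <;> linarith

lemma I2_diag (ψ : ℕ → ℝ) (hψ : ∀ n, 0 ≤ ψ n) (hψ2 : ∀ n, ψ n ≤ 1/2) (q : ℕ) (hq : 1 ≤ q) : I2 ψ q q ≤ 2 * muw ψ q := by
  unfold I2
  have hq0 : (0:ℝ) < q := by exact_mod_cast hq
  have hd : 0 ≤ ψ q / q := div_nonneg (hψ q) hq0.le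
  have : ∀ a ∈ Un q, ∑ b ∈ Un q, ovl (ψ q/q) (ψ q/q) ((a:ℝ)/q-(b:ℝ)/q) = 2 * (ψ q/q) := by
    intro a ha
    rw [Finset.sum_eq_single a]
    · rw [sub_self, ovl_zero _ _ hd hd, min_self]
    · intro b _ hb
      apply ovl_eq_zero
      rw [← sub_div, abs_div, abs_of_pos hq0, ← add_div]
      apply div_le_div_of_nonneg_right _ hq0.le
      have : (1:ℝ) ≤ |(a:ℝ) - b| := by
        have h : (1:ℤ) ≤ |(a:ℤ) - b| := Int.one_le_abs (by intro h; apply hb; omega)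
        exact_mod_cast h
      linarith [hψ2 q]
    · exact fun h => absurd ha h
  rw [sum_congr rfl this, sum_const, nsmul_eq_mul]
  have hc : (Un q).card = Nat.totient q := by
    unfold Un; rw [Nat.totient]; congr 1; ext x; simp [Nat.coprime_comm]
  rw [hc, muw]
  apply le_of_eq; ring

lemma sum_fI_mem01 (ψ : ℕ → ℝ) (hψ2 : ∀ n, ψ n ≤ 1/2) (n a : ℕ) (hn : 2 ≤ n) (ha : a ∈ Un n) :
    Set.Icc ((a:ℝ)/n - ψ n/n) ((a:ℝ)/n + ψ n/n) ⊆ Set.Icc 0 1 := by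
  have hn0 : (0:ℝ) < n := by exact_mod_cast (by omega : 0 < n)
  unfold Un at ha
  rw [mem_filter, mem_range] at ha
  have h1 : 1 ≤ a := by
    rcases Nat.eq_zero_or_pos a with h | h
    · rw [h] at ha; have := ha.2; rw [Nat.coprime_zero_left] at this; omega
    · exact h
  have h1' : (1:ℝ) ≤ a := by exact_mod_cast h1
  have h2 : (a:ℝ) + 1 ≤ n := by exact_mod_cast ha.1
  apply Set.Icc_subset_Icc
  · rw [← sub_div]; apply div_nonneg _ hn0.le; linarith [hψ2 n]
  · rw [← add_div, div_le_one hn0]; linarith [hψ2 n]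

lemma Un_card (q : ℕ) : (Un q).card = Nat.totient q := by
  unfold Un; rw [Nat.totient]; congr 1; ext x; simp [Nat.coprime_comm]

lemma mean_lower (ψ : ℕ → ℝ) (hψ : ∀ n, 0 ≤ ψ n) (hψ2 : ∀ n, ψ n ≤ 1/2) (N : ℕ) :
    2 * ∑ n ∈ Icc 1 N, muw ψ n - 1 ≤ ∫ α in Set.Icc (0:ℝ) 1, FF ψ N α := by
  unfold FF
  rw [integral_finsetSum _ (fun n _ => integrable_finsetSum _ (fun a _ => (fI_int ψ n a).integrableOn))]
  have : ∀ n ∈ Icc 1 N, 2 * muw ψ n - (if n = 1 then 1 else 0) ≤ ∫ α in Set.Icc (0:ℝ) 1, ∑ a ∈ Un n, fI ψ n a α := by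
    intro n hn
    rw [mem_Icc] at hn
    by_cases h : n = 1
    · subst h
      have h0 : 0 ≤ ∫ α in Set.Icc (0:ℝ) 1, ∑ a ∈ Un 1, fI ψ 1 a α :=
        integral_nonneg fun x => sum_nonneg fun a _ => fI_nonneg ψ 1 a x
      simp only [if_true]
      have : muw ψ 1 = ψ 1 := by simp [muw]
      linarith [hψ2 1]
    · rw [if_neg h, sub_zero, integral_finsetSum _ (fun a _ => (fI_int ψ n a).integrableOn)]
      have e : ∀ a ∈ Un n, ∫ α in Set.Icc (0:ℝ) 1, fI ψ n a α = 2 * (ψ n / n) := by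
        intro a ha
        rw [← fI_integral ψ hψ n a]
        apply setIntegral_eq_integral_of_forall_compl_eq_zero
        intro x hx
        apply Set.indicator_of_notMem
        exact fun h' => hx (sum_fI_mem01 ψ hψ2 n a (by omega) ha h')
      rw [sum_congr rfl e, sum_const, Un_card, nsmul_eq_mul, muw]
      apply le_of_eq; ring
  refine le_trans ?_ (sum_le_sum this)
  rw [sum_sub_distrib, ← mul_sum]
  have : ∑ i ∈ Icc 1 N, (if i = 1 then (1:ℝ) else 0) ≤ 1 := by
    rw [Finset.sum_ite_eq' (Icc 1 N) 1 (fun _ => (1:ℝ))]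
    split_ifs <;> norm_num
  linarith

lemma FF_sq (ψ : ℕ → ℝ) (N : ℕ) (α : ℝ) : FF ψ N α ^ 2 = ∑ q ∈ Icc 1 N, ∑ r ∈ Icc 1 N, ∑ a ∈ Un q, ∑ b ∈ Un r, fI ψ q a α * fI ψ r b α := by
  unfold FF
  rw [pow_two, sum_mul_sum]
  exact sum_congr rfl fun q _ => sum_congr rfl fun r _ => sum_mul_sum _ _ _ _

lemma FF_sq_int (ψ : ℕ → ℝ) (N : ℕ) : Integrable (fun α => FF ψ N α ^ 2) := by
  simp_rw [FF_sq]
  exact integrable_finsetSum _ fun q _ => integrable_finsetSum _ fun r _ => integrable_finsetSum _ fun a _ => integrable_finsetSum _ fun b _ => fI_mul_int ψ q r a b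

lemma FF_int (ψ : ℕ → ℝ) (N : ℕ) : Integrable (FF ψ N) := by
  unfold FF
  exact integrable_finsetSum _ fun q _ => integrable_finsetSum _ fun a _ => fI_int ψ q a

lemma FF_sq_integral (ψ : ℕ → ℝ) (N : ℕ) : ∫ α, FF ψ N α ^ 2 = ∑ q ∈ Icc 1 N, ∑ r ∈ Icc 1 N, I2 ψ q r := by
  simp_rw [FF_sq]
  rw [integral_finsetSum _ fun q _ => integrable_finsetSum _ fun r _ => integrable_finsetSum _ fun a _ => integrable_finsetSum _ fun b _ => fI_mul_int ψ q r a b]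
  refine sum_congr rfl fun q _ => ?_
  rw [integral_finsetSum _ fun r _ => integrable_finsetSum _ fun a _ => integrable_finsetSum _ fun b _ => fI_mul_int ψ q r a b]
  refine sum_congr rfl fun r _ => ?_
  rw [integral_finsetSum _ fun a _ => integrable_finsetSum _ fun b _ => fI_mul_int ψ q r a b]
  refine sum_congr rfl fun a _ => ?_
  rw [integral_finsetSum _ fun b _ => fI_mul_int ψ q r a b]
  exact sum_congr rfl fun b _ => fI_mul_integral ψ q r a b

lemma var_int (ψ : ℕ → ℝ) (N : ℕ) (P : ℝ) : IntegrableOn (fun α => (FF ψ N α - P)^2) (Set.Icc (0:ℝ) 1) := by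
  have e : (fun α => (FF ψ N α - P)^2) = fun α => FF ψ N α^2 - 2*P*FF ψ N α + P^2 := by ext; ring
  rw [e]
  exact ((FF_sq_int ψ N).integrableOn.sub ((FF_int ψ N).integrableOn.const_mul _)).add (continuousOn_const.integrableOn_compact isCompact_Icc)

lemma var_bound (ψ : ℕ → ℝ) (hψ : ∀ n, 0 ≤ ψ n) (hψ2 : ∀ n, ψ n ≤ 1/2) (N : ℕ) (P B : ℝ) (hP : P = 2 * ∑ n ∈ Icc 1 N, muw ψ n)
    (hB : ∑ q ∈ Icc 1 N, ∑ r ∈ Icc 1 N, (if q = r then 0 else I2 ψ q r) ≤ P^2 + B) :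
    ∫ α in Set.Icc (0:ℝ) 1, (FF ψ N α - P)^2 ≤ 3 * P + B := by
  have hP0 : 0 ≤ P := by
    rw [hP]; have := sum_nonneg fun n (_ : n ∈ Icc 1 N) => muw_nonneg ψ hψ n
    linarith
  have e : (fun α => (FF ψ N α - P)^2) = fun α => FF ψ N α^2 - 2*P*FF ψ N α + P^2 := by ext; ring
  have i1 : IntegrableOn (fun α => FF ψ N α^2 - 2*P*FF ψ N α) (Set.Icc (0:ℝ) 1) :=
    (FF_sq_int ψ N).integrableOn.sub ((FF_int ψ N).integrableOn.const_mul _)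
  rw [e, integral_add i1 (continuousOn_const.integrableOn_compact isCompact_Icc),
    integral_sub (FF_sq_int ψ N).integrableOn ((FF_int ψ N).integrableOn.const_mul _), integral_const_mul]
  have h1 : ∫ α in Set.Icc (0:ℝ) 1, FF ψ N α ^ 2 ≤ ∫ α, FF ψ N α ^ 2 :=
    setIntegral_le_integral (FF_sq_int ψ N) (Eventually.of_forall fun x => sq_nonneg _)
  rw [FF_sq_integral] at h1
  have h2 := mean_lower ψ hψ hψ2 N
  rw [← hP] at h2
  have h3 : ∑ q ∈ Icc 1 N, ∑ r ∈ Icc 1 N, I2 ψ q r ≤ P + ∑ q ∈ Icc 1 N, ∑ r ∈ Icc 1 N, (if q = r then 0 else I2 ψ q r) := by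
    rw [hP, mul_sum, ← sum_add_distrib]
    refine sum_le_sum fun q hq => ?_
    rw [← add_sum_erase _ _ hq]
    rw [← add_sum_erase (Icc 1 N) (fun r => if q = r then 0 else I2 ψ q r) hq]
    have := I2_diag ψ hψ hψ2 q (mem_Icc.1 hq).1
    have e2 : ∑ r ∈ (Icc 1 N).erase q, I2 ψ q r = ∑ r ∈ (Icc 1 N).erase q, (if q = r then 0 else I2 ψ q r) :=
      sum_congr rfl fun r hr => by rw [if_neg (ne_of_mem_erase hr).symm]
    simp only [if_true]
    linarith
  have h4 : ∫ α in Set.Icc (0:ℝ) 1, P^2 = P^2 := by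
    rw [setIntegral_const]; simp
  rw [h4]
  have h5 : 2*P*(P-1) ≤ 2*P*∫ α in Set.Icc (0:ℝ) 1, FF ψ N α := by gcongr
  nlinarith

lemma FF_eq_card (ψ : ℕ → ℝ) (N : ℕ) (α : ℝ) :
    FF ψ N α = ((((Icc 1 N).sigma (fun n => Un n)).filter
      (fun x => |α - ((x.2:ℕ):ℝ) / ((x.1:ℕ):ℝ)| ≤ ψ x.1 / x.1)).card : ℝ) := by
  classical
  rw [Finset.card_filter, Nat.cast_sum, Finset.sum_sigma]
  unfold FF
  refine sum_congr rfl fun n _ => sum_congr rfl fun a _ => ?_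
  unfold fI Set.indicator
  have : α ∈ Set.Icc ((a:ℝ)/n - ψ n/n) ((a:ℝ)/n + ψ n/n) ↔ |α - (a:ℝ) / n| ≤ ψ n / n := by
    rw [Set.mem_Icc, abs_le]
    constructor
    · rintro ⟨h1, h2⟩; constructor <;> linarith
    · rintro ⟨h1, h2⟩; constructor <;> linarith
  simp only [this]
  split_ifs <;> simp

lemma S_FF (ψ : ℕ → ℝ) (hψ2 : ∀ n, ψ n ≤ 1/2) (N : ℕ) (α : ℝ) (h0 : 0 ≤ α) (h1 : α ≤ 1) :
    |(S ψ N α : ℝ) - FF ψ N α| ≤ 1 := by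
  classical
  rw [FF_eq_card]
  set B := ((Icc 1 N).sigma (fun n => Un n)).filter
      (fun x => |α - ((x.2:ℕ):ℝ) / ((x.1:ℕ):ℝ)| ≤ ψ x.1 / x.1) with hB
  unfold S
  set A := {p : ℤ × ℕ | 1 ≤ p.2 ∧ p.2 ≤ N ∧ Int.gcd p.1 (p.2 : ℤ) = 1 ∧
    |α - (p.1 : ℝ) / (p.2 : ℝ)| ≤ ψ p.2 / p.2} with hA
  let g : (Σ _ : ℕ, ℕ) → ℤ × ℕ := fun x => ((x.2:ℤ), x.1)
  have hg : Function.Injective g := by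
    rintro ⟨n, a⟩ ⟨m, b⟩ h
    simp only [g, Prod.mk.injEq, Nat.cast_inj] at h
    obtain ⟨rfl, rfl⟩ := h; rfl
  have hc : (B.image g).card = B.card := Finset.card_image_of_injective _ hg
  have sub1 : ((B.image g : Finset (ℤ × ℕ)) : Set (ℤ × ℕ)) ⊆ A := by
    intro p hp
    rw [Finset.mem_coe, mem_image] at hp
    obtain ⟨⟨n, a⟩, hx, rfl⟩ := hp
    rw [hB, mem_filter, Finset.mem_sigma, mem_Icc] at hx
    obtain ⟨⟨⟨hn1, hn2⟩, ha⟩, hx⟩ := hx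
    unfold Un at ha
    rw [mem_filter] at ha
    refine ⟨hn1, hn2, ?_, ?_⟩
    · simpa [g] using ha.2
    · simpa [g] using hx
  have sub2 : A ⊆ ((insert ((1:ℤ),1) (B.image g) : Finset (ℤ × ℕ)) : Set (ℤ × ℕ)) := by
    rintro ⟨a, n⟩ ⟨hn1, hn2, hgcd, hx⟩
    simp only at hn1 hn2 hgcd hx
    have hn0 : (0:ℝ) < n := by exact_mod_cast hn1
    have hx' : |α * n - a| ≤ 1/2 := by
      have : α * n - a = (α - a/n) * n := by field_simp
      rw [this, abs_mul, abs_of_pos hn0]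
      calc _ ≤ (ψ n / n) * n := by gcongr
        _ = ψ n := by field_simp
        _ ≤ _ := hψ2 n
    rw [abs_le] at hx'
    have hαn : 0 ≤ α * n := by positivity
    have hαn2 : α * n ≤ n := by nlinarith
    have ha0 : 0 ≤ a := by
      have : (-1:ℝ) < a := by linarith [hx'.2]
      have : (-1:ℤ) < a := by exact_mod_cast this
      omega
    have han : a ≤ n := by
      have : (a:ℝ) < n + 1 := by linarith [hx'.1]
      have : a < (n:ℤ) + 1 := by exact_mod_cast this
      omega
    lift a to ℕ using ha0
    rw [Finset.coe_insert, Set.mem_insert_iff, Finset.mem_coe, mem_image]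
    rcases (show (a:ℤ) = n ∨ a < n by omega) with h | h
    · left
      rw [h, Int.gcd_self] at hgcd
      have : n = 1 := by simpa using hgcd
      simp [h, this]
    · right
      refine ⟨⟨n, a⟩, ?_, rfl⟩
      rw [hB, mem_filter, Finset.mem_sigma, mem_Icc]
      refine ⟨⟨⟨hn1, hn2⟩, ?_⟩, by simpa using hx⟩
      unfold Un
      rw [mem_filter, mem_range]
      exact ⟨h, by simpa using hgcd⟩
  have fin : A.Finite := (Finset.finite_toSet _).subset sub2
  have c1 := Set.ncard_le_ncard sub1 fin
  have c2 := Set.ncard_le_ncard sub2 (Finset.finite_toSet _)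
  rw [Set.ncard_coe_finset] at c1 c2
  have c3 := Finset.card_insert_le ((1:ℤ),1) (B.image g)
  rw [hc] at c1 c3
  have c2' : (A.ncard : ℝ) ≤ B.card + 1 := by exact_mod_cast c2.trans c3
  have c1' : (B.card : ℝ) ≤ A.ncard := by exact_mod_cast c1
  rw [abs_le]; constructor <;> linarith

lemma Psi_muw (ψ : ℕ → ℝ) (N : ℕ) : Psi ψ N = 2 * ∑ n ∈ Icc 1 N, muw ψ n := by
  unfold Psi muw
  rw [mul_sum]
  exact sum_congr rfl fun n _ => by ring

lemma varF (κ : ℝ) (hκ : 0 < κ) (hκ2 : κ < 1/2) (ψ : ℕ → ℝ) (hψ : ∀ n, 0 ≤ ψ n) (hψ2 : ∀ n, ψ n ≤ 1/2) :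
    ∃ Y0 : ℝ, 1 ≤ Y0 ∧ ∀ N, Y0 ≤ Psi ψ N → 
    ∫ α in Set.Icc (0:ℝ) 1, (FF ψ N α - Psi ψ N)^2 ≤ exp (-(log (Psi ψ N))^κ) * (Psi ψ N)^2 := by
  set κ' := (κ + 1/2)/2 with hκ'
  obtain ⟨X0, hX0, h⟩ := varsum κ' (by linarith) (by linarith)
  have ev : ∀ᶠ u : ℝ in atTop, 2 ≤ u ∧ (2^κ') * u^κ ≤ u^κ' ∧ 2 * u^κ ≤ u^(1:ℝ) ∧ 4 ≤ u := by
    filter_upwards [eventually_ge_atTop 2, rpow_ev κ κ' (2^κ') (by linarith), rpow_ev κ 1 2 (by linarith), eventually_ge_atTop 4] with u a b c d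
    exact ⟨a, b, c, d⟩
  obtain ⟨Y1, hY1⟩ := eventually_atTop.1 (tendsto_log_atTop.eventually ev)
  refine ⟨max (2*X0) Y1, le_trans (by linarith) (le_max_left _ _), fun N hN => ?_⟩
  obtain ⟨a, b, c, d⟩ := hY1 _ ((le_max_right _ _).trans hN)
  have hX := (le_max_left _ _).trans hN
  set P := Psi ψ N with hP
  have hPX : P = 2 * ∑ n ∈ Icc 1 N, muw ψ n := Psi_muw ψ N
  have hh := h ψ hψ hψ2 N (by linarith)
  set X := ∑ n ∈ Icc 1 N, muw ψ n
  have hX0' : 0 < X := by linarith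
  have hP0 : 0 < P := by linarith
  have hv := var_bound ψ hψ hψ2 N P (exp (-(log X)^κ') * X^2) hPX (by
    refine hh.trans (le_of_eq ?_); rw [hPX]; ring)
  refine hv.trans ?_
  set u := log P
  have hlX : u / 2 ≤ log X := by
    have : u = log 2 + log X := by
      rw [← Real.log_mul (by norm_num) hX0'.ne', ← hPX]
    have := Real.log_two_lt_d9
    linarith
  have hE : exp (-(log X)^κ') ≤ exp (-u^κ) := by
    apply exp_le_exp.2
    apply neg_le_neg
    calc u^κ = ((2:ℝ)^κ')⁻¹ * (2^κ' * u^κ) := by field_simp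
      _ ≤ ((2:ℝ)^κ')⁻¹ * u^κ' := by gcongr
      _ = (u/2)^κ' := by rw [div_rpow (by linarith) (by norm_num)]; ring
      _ ≤ _ := rpow_le_rpow (by linarith) hlX (by linarith)
  have h3 : 3 * P ≤ (3/4) * (exp (-u^κ) * P^2) := by
    have : 4 ≤ exp (-u^κ) * P := by
      have hPe : P = exp u := (exp_log hP0).symm
      rw [hPe, ← exp_add]
      rw [rpow_one] at c
      have h2 : exp 2 ≤ exp (-u^κ + u) := exp_le_exp.2 (by linarith only [c, d])
      have h1 : exp 2 = exp 1 * exp 1 := by rw [← exp_add]; norm_num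
      have := exp_one_gt_d9
      nlinarith
    nlinarith
  have h4 : exp (-(log X)^κ') * X^2 ≤ (1/4) * (exp (-u^κ) * P^2) := by
    calc _ ≤ exp (-u^κ) * X^2 := by gcongr
      _ = _ := by rw [hPX]; ring
  linarith

lemma seq_props (p θ : ℝ) (hp : 1 < p) (hθ : 0 < θ) (hθ1 : θ < 1) : ∀ᶠ j : ℕ in atTop, 
    1 ≤ j ∧
    exp ((log ((j+1:ℕ):ℝ))^p) ≤ exp ((log j)^p) * (1 + exp (-(log ((j+1:ℕ):ℝ))^θ)) ∧
    1 ≤ exp ((log j)^p) * exp (-(log ((j+1:ℕ):ℝ))^θ) ∧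
    exp (-(log j)^θ) ≤ 3 * exp (-(log ((j+1:ℕ):ℝ))^θ) := by
  have ev : ∀ᶠ L : ℝ in atTop, 4 ≤ L ∧ 2 * L^θ ≤ L^(1:ℝ) ∧ 16*p*L^(p-1) ≤ exp ((1/2)*L) := by
    have h1 := (isLittleO_rpow_exp_pos_mul_atTop (p-1) (by norm_num : (0:ℝ) < 1/2)).def (by positivity : 0 < (16*p)⁻¹)
    filter_upwards [eventually_ge_atTop 4, rpow_ev θ 1 2 (by linarith), h1] with L a b c
    refine ⟨a, b, ?_⟩
    rw [Real.norm_of_nonneg (by positivity), Real.norm_of_nonneg (by positivity)] at c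
    calc 16*p*L^(p-1) ≤ 16*p*((16*p)⁻¹ * exp ((1/2)*L)) := by gcongr
      _ = _ := by field_simp
  have tL : Tendsto (fun j : ℕ => log ((j+1:ℕ):ℝ)) atTop atTop :=
    tendsto_log_atTop.comp (tendsto_natCast_atTop_atTop.comp (tendsto_add_atTop_nat 1))
  filter_upwards [tL.eventually ev, eventually_ge_atTop 1] with j hL hj
  obtain ⟨a, b, c⟩ := hL
  rw [rpow_one] at b
  have hj1 : (1:ℝ) ≤ j := by exact_mod_cast hj
  have hLe : (j:ℝ) + 1 = exp (log ((j+1:ℕ):ℝ)) := by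
    rw [exp_log (by positivity)]; push_cast; ring
  have hLl : log ((j+1:ℕ):ℝ) ≤ log j + 1/j := by
    have : log ((j+1:ℕ):ℝ) - log j = log (1 + 1/j) := by
      rw [← Real.log_div (by positivity) (by positivity)]; congr 1; push_cast; field_simp
    have h2 := Real.log_le_sub_one_of_pos (show (0:ℝ) < 1 + 1/j by positivity)
    linarith
  have hlL : log j ≤ log ((j+1:ℕ):ℝ) := log_le_log (by positivity) (by push_cast; linarith)
  set L := log ((j+1:ℕ):ℝ)
  set l := log (j:ℝ)
  have h1j : 1/(j:ℝ) ≤ 1 := by rw [div_le_one (by positivity)]; exact hj1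
  have h1j2 : 1/(j:ℝ) ≤ 2 * exp (-L) := by
    rw [exp_neg, ← hLe]
    rw [div_le_iff₀ (by positivity)]
    have : 2 * ((j:ℝ)+1)⁻¹ * j = 2*j/(j+1) := by field_simp
    rw [this, le_div_iff₀ (by positivity)]; linarith
  have hl0 : 1 ≤ l := by linarith
  refine ⟨hj, ?_, ?_, ?_⟩
  · have hb : L^p - l^p ≤ p * L^(p-1) * (L - l) := by
      have B := one_add_mul_self_le_rpow_one_add (s := -(L-l)/L) (p := p) (by
        rw [le_div_iff₀ (by linarith)]; linarith) hp.le
      have e1 : 1 + -(L-l)/L = l/L := by field_simp; ring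
      rw [e1, div_rpow (by linarith) (by linarith)] at B
      have hLp : 0 < L^p := Real.rpow_pos_of_pos (by linarith) _
      rw [le_div_iff₀ hLp] at B
      have e2 : L^(p-1) = L^p / L := Real.rpow_sub_one (by linarith) p
      rw [e2]
      have e3 : (1 + p * (-(L-l)/L)) * L^p = L^p - p * (L^p/L) * (L-l) := by
        have : L ≠ 0 := by linarith
        field_simp; ring
      rw [e3] at B
      linarith
    set h := L^p - l^p with hh
    have hh0 : 0 ≤ h := sub_nonneg.2 (rpow_le_rpow (by linarith) hlL (by linarith))
    have hh1 : h ≤ (1/8) * exp (-((1/2)*L)) := by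
      have : (exp ((1/2)*L)) * exp (-L) = exp (-((1/2)*L)) := by
        rw [← exp_add]; ring_nf
      calc h ≤ p * L^(p-1) * (2 * exp (-L)) := hb.trans (by gcongr; linarith)
        _ = (1/8) * (16*p*L^(p-1)) * exp (-L) := by ring
        _ ≤ (1/8) * (exp ((1/2)*L)) * exp (-L) := by gcongr
        _ = _ := by rw [mul_assoc, this]
    have hE1 : exp (-((1/2)*L)) ≤ 1 := exp_le_one_iff.2 (by linarith)
    have hE2 : exp (-((1/2)*L)) ≤ exp (-L^θ) := exp_le_exp.2 (by linarith)
    have hx := Real.abs_exp_sub_one_le (x := h) (by rw [abs_of_nonneg hh0]; linarith)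
    rw [abs_of_nonneg hh0] at hx
    have hx2 := (le_abs_self _).trans hx
    have : L^p = l^p + h := by rw [hh]; ring
    rw [this, exp_add]
    gcongr
    have := exp_pos (-((1/2)*L))
    linarith
  · rw [← exp_add]
    apply one_le_exp
    have : l ≤ l^p := by
      conv_lhs => rw [← rpow_one l]
      exact Real.rpow_le_rpow_of_exponent_le hl0 hp.le
    linarith
  · have h1 : L^θ ≤ l^θ + 1 := by
      calc L^θ ≤ (l + 1)^θ := rpow_le_rpow (by linarith) (by linarith) hθ.le
        _ ≤ l^θ + 1^θ := Real.rpow_add_le_add_rpow (by linarith) (by linarith) hθ.le hθ1.le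
        _ = _ := by rw [Real.one_rpow]
    have := exp_one_lt_d9
    calc exp (-l^θ) ≤ exp (1 + -L^θ) := exp_le_exp.2 (by linarith)
      _ = exp 1 * exp (-L^θ) := exp_add _ _
      _ ≤ _ := by gcongr; linarith

lemma det_step (x y y' D E P1 P2 F1 F2 F : ℝ) (hy : 1 ≤ y) (hyx : y ≤ x) (hxy : x ≤ y') (hD : 0 ≤ D) (hD1 : D ≤ 1)
   (hE0 : 0 ≤ E) (hE : E ≤ 1) (hED : E ≤ 3*D) (hyy : y' ≤ y*(1+D)) (hyD : 1 ≤ y*D)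
   (hP1 : y ≤ P1) (hP2 : P2 ≤ y'+1) (h1 : P1*(1-E) ≤ F1) (h2 : F2 ≤ P2*(1+D)) (hF1 : F1 ≤ F) (hF2 : F ≤ F2) :
   |F - x| ≤ 5*x*D := by
  have hx : 0 ≤ x := by linarith
  have hxD : 0 ≤ x*D := by positivity
  have hyxD : y*D ≤ x*D := by gcongr
  rw [abs_le]
  constructor
  · have a1 : y*(1-E) ≤ P1*(1-E) := mul_le_mul_of_nonneg_right hP1 (by linarith)
    have a2 : x - x*D ≤ y := by
      have : x ≤ y + y*D := by linarith only [hyy, hxy]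
      linarith only [this, hyxD]
    have a3 : (x - x*D)*(1-E) ≤ y*(1-E) := mul_le_mul_of_nonneg_right a2 (by linarith)
    have a4 : x*E ≤ x*(3*D) := by gcongr
    have a6 : 0 ≤ x*D*E := by positivity
    have a7 : (x - x*D)*(1-E) = x - x*D - x*E + x*D*E := by ring
    linarith only [a1, a3, a4, a6, a7, h1, hF1, hxD]
  · have b1 : P2 ≤ x*(1+2*D) := by
      have : x*(1+2*D) = x + x*D + x*D := by ring
      have : y*(1+D) = y + y*D := by ring
      linarith
    have b2 : P2*(1+D) ≤ x*(1+2*D)*(1+D) := by gcongr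
    have b3 : x*D*D ≤ x*D*1 := by gcongr
    have b4 : x*(1+2*D)*(1+D) = x + 3*(x*D) + 2*(x*D*D) := by ring
    linarith only [b2, b3, b4, h2, hF2]

lemma ae_abs {Ω : Type*} [MeasurableSpace Ω] (μ : Measure Ω) [IsFiniteMeasure μ] (F : ℕ → Ω → ℝ) (P : ℕ → ℝ)
    (hF : ∀ ω, Monotone (fun N => F N ω)) (hP0 : P 0 = 0) (hP1 : ∀ N, P (N+1) ≤ P N + 1) (hPm : Monotone P)
    (hPt : Tendsto P atTop atTop) (κ κ2 : ℝ) (hκ : 0 < κ) (hκ2 : κ < κ2) (hκ3 : κ2 < 1/2) (Y0 : ℝ)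
    (hint : ∀ N, Integrable (fun ω => (F N ω - P N)^2) μ)
    (hv : ∀ N, Y0 ≤ P N → ∫ ω, (F N ω - P N)^2 ∂μ ≤ exp (-(log (P N))^κ2) * (P N)^2) :
    ∀ᵐ ω ∂μ, ∀ᶠ N in atTop, |F N ω - P N| ≤ 5 * P N * exp (-(log (P N))^κ) := by
  set κ1 := (κ + κ2)/2 with hκ1
  set p := 1/κ1 with hp
  have hκ1p : 0 < κ1 := by linarith
  have hp1 : 1 < p := by rw [hp, lt_div_iff₀ hκ1p]; linarith
  have hθ0 : 0 < p*κ := by positivity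
  have hθ1 : p*κ < 1 := by rw [hp, one_div, inv_mul_lt_iff₀ hκ1p]; linarith
  have hθ2 : 1 < p*κ2 := by rw [hp, one_div, lt_inv_mul_iff₀ hκ1p]; linarith
  set y : ℕ → ℝ := fun j => exp ((log j)^p) with hy
  have hlog0 : ∀ j : ℕ, 0 ≤ log (j:ℝ) := fun j => Real.log_natCast_nonneg j
  have hy1 : ∀ j, 1 ≤ y j := fun j => one_le_exp (rpow_nonneg (hlog0 j) _)
  have hly : ∀ j, log (y j) = (log j)^p := fun j => Real.log_exp _
  have htl : Tendsto (fun j : ℕ => (log (j:ℝ))) atTop atTop := tendsto_log_atTop.comp tendsto_natCast_atTop_atTop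
  have htlp : Tendsto (fun j : ℕ => (log (j:ℝ))^p) atTop atTop := (tendsto_rpow_atTop (by linarith)).comp htl
  have hyt : Tendsto y atTop atTop := Real.tendsto_exp_atTop.comp htlp
  have hex : ∀ j, ∃ N, y j ≤ P N := fun j => (hPt.eventually_ge_atTop (y j)).exists
  classical
  set n : ℕ → ℕ := fun j => Nat.find (hex j) with hn
  have hn1 : ∀ j, y j ≤ P (n j) := fun j => Nat.find_spec (hex j)
  have hn2 : ∀ j, P (n j) ≤ y j + 1 := by
    intro j
    have h0 : n j ≠ 0 := by
      intro h; have := hn1 j; rw [h, hP0] at this; linarith [hy1 j]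
    obtain ⟨m, hm⟩ := Nat.exists_eq_succ_of_ne_zero h0
    have : ¬ y j ≤ P m := Nat.find_min (hex j) (by change m < n j; omega)
    rw [hm]
    have := hP1 m
    push Not at *
    change P (m+1) ≤ _
    linarith
  have hn3 : ∀ j N, y j ≤ P N → n j ≤ N := fun j N h => Nat.find_min' (hex j) h
  -- eventual bound
  have ev1 : ∀ᶠ u : ℝ in atTop, 4 * u^κ ≤ u^κ2 := rpow_ev κ κ2 4 hκ2
  have ev2 : ∀ᶠ j : ℕ in atTop, 1 ≤ j ∧ Y0 ≤ y j ∧ (∀ u, (log j)^p ≤ u → 4 * u^κ ≤ u^κ2) ∧ 4 * (log j)^(1:ℝ) ≤ (log j)^(p*κ2) := by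
    obtain ⟨U, hU⟩ := eventually_atTop.1 ev1
    filter_upwards [eventually_ge_atTop 1, hyt.eventually_ge_atTop Y0, htlp.eventually_ge_atTop U, htl.eventually (rpow_ev 1 (p*κ2) 4 hθ2)] with j a b c d
    exact ⟨a, b, fun u hu => hU u (c.trans hu), d⟩
  obtain ⟨J, hJ⟩ := eventually_atTop.1 ev2
  set c : ℕ → ℝ := fun N => P N * exp (-(log (P N))^κ) with hc
  have hb : ∀ j, J ≤ j → μ.real {ω | c (n j) ≤ |F (n j) ω - P (n j)|} ≤ 1/(j:ℝ)^2 := by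
    intro j hj
    obtain ⟨j1, jY, jk, jl⟩ := hJ j hj
    have hj0 : (0:ℝ) < j := by exact_mod_cast j1
    set N := n j
    have hPN := hn1 j
    have hPpos : 0 < P N := by linarith [hy1 j]
    have hcpos : 0 < c N := mul_pos hPpos (exp_pos _)
    have hV := hv N (jY.trans hPN)
    have hC := mul_meas_ge_le_integral_of_nonneg (μ := μ) (f := fun ω => (F N ω - P N)^2) (Eventually.of_forall fun ω => sq_nonneg _) (hint N) ((c N)^2)
    have hset : {ω | c N ≤ |F N ω - P N|} = {ω | (c N)^2 ≤ (F N ω - P N)^2} := by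
      ext ω
      simp only [Set.mem_ofPred_eq]
      rw [← sq_abs (F N ω - P N)]
      exact (pow_le_pow_iff_left₀ hcpos.le (abs_nonneg _) two_ne_zero).symm
    rw [hset]
    set m := μ.real {ω | (c N)^2 ≤ (F N ω - P N)^2}
    set u := log (P N)
    have hu : (log j)^p ≤ u := by rw [← hly]; exact log_le_log (by linarith [hy1 j]) hPN
    have hu0 : 0 ≤ (log j)^p := rpow_nonneg (hlog0 j) _
    have hcc : (c N)^2 = exp (-(2*u^κ)) * (P N)^2 := by
      rw [hc]; simp only; rw [mul_pow, ← exp_nat_mul]; push_cast; rw [mul_comm]; congr 2; ring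
    have h1 : exp (-(2*u^κ)) * m ≤ exp (-u^κ2) := by
      have hP2 : 0 < (P N)^2 := by positivity
      have := hC.trans hV
      rw [hcc] at this
      apply le_of_mul_le_mul_right _ hP2
      linarith only [this]
    have h2 : m ≤ exp (-u^κ2 + 2*u^κ) := by
      have e : exp (-u^κ2) = exp (-(2*u^κ)) * exp (-u^κ2 + 2*u^κ) := by rw [← exp_add]; ring_nf
      rw [e] at h1
      exact le_of_mul_le_mul_left h1 (exp_pos _)
    have h3 : 4 * log j ≤ u^κ2 := by
      rw [rpow_one] at jl
      refine jl.trans ?_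
      rw [rpow_mul (hlog0 j)]
      exact rpow_le_rpow hu0 hu (by linarith)
    have h4 := jk u hu
    calc m ≤ exp (-u^κ2 + 2*u^κ) := h2
      _ ≤ exp (-(2 * log j)) := exp_le_exp.2 (by linarith only [h3, h4])
      _ = 1/(j:ℝ)^2 := by
        rw [exp_neg, mul_comm, exp_mul, exp_log hj0, one_div]; norm_num
  set s : ℕ → Set Ω := fun j => {ω | J ≤ j ∧ c (n j) ≤ |F (n j) ω - P (n j)|} with hs
  have hsum : ∑' j, μ (s j) ≠ ⊤ := by
    have hle : ∀ j, μ (s j) ≤ ENNReal.ofReal (1/(j:ℝ)^2) := by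
      intro j
      by_cases hj : J ≤ j
      · have : s j = {ω | c (n j) ≤ |F (n j) ω - P (n j)|} := by ext ω; simp [hs, hj]
        rw [this]
        rw [← ofReal_measureReal]
        exact ENNReal.ofReal_le_ofReal (hb j hj)
      · have : s j = ∅ := by ext ω; simp [hs, hj]
        rw [this]; simp
    have hS : Summable (fun j : ℕ => 1/(j:ℝ)^2) := Real.summable_one_div_nat_pow.2 (by norm_num)
    exact ne_top_of_le_ne_top (hS.tsum_ofReal_ne_top) (ENNReal.tsum_le_tsum hle)
  have hae := ae_eventually_notMem hsum
  filter_upwards [hae] with ω hω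
  obtain ⟨J2, hJ2⟩ := eventually_atTop.1 ((hω.and (seq_props p (p*κ) hp1 hθ0 hθ1)).and (eventually_ge_atTop J))
  have hgood : ∀ j, J2 ≤ j → |F (n j) ω - P (n j)| ≤ P (n j) * exp (-(log j)^(p*κ)) := by
    intro j hj
    obtain ⟨⟨h1, _⟩, h2⟩ := hJ2 j hj
    have h3 : |F (n j) ω - P (n j)| ≤ c (n j) := by
      by_contra hcon
      push Not at hcon
      exact h1 ⟨h2, hcon.le⟩
    refine h3.trans ?_
    have : 0 ≤ P (n j) := by linarith [hy1 j, hn1 j]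
    simp only [hc]
    gcongr
    rw [rpow_mul (hlog0 j), ← hly]
    exact rpow_le_rpow (Real.log_nonneg (hy1 j)) (log_le_log (by linarith [hy1 j]) (hn1 j)) hκ.le
  filter_upwards [hPt.eventually_ge_atTop (y J2)] with N hN
  have hexk : ∃ k, J2 ≤ k ∧ P N < y k := ((eventually_ge_atTop J2).and (hyt.eventually_gt_atTop (P N))).exists
  obtain ⟨j, hj, hjN, hjN2⟩ : ∃ j, J2 ≤ j ∧ y j ≤ P N ∧ P N < y (j+1) := by
    obtain ⟨hk1, hk2⟩ := Nat.find_spec hexk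
    have hkm := fun m => @Nat.find_min _ _ hexk m
    generalize Nat.find hexk = k at *
    have hkne : k ≠ J2 := by intro h; rw [h] at hk2; linarith
    obtain ⟨j, rfl⟩ : ∃ j, k = j + 1 := ⟨k - 1, by omega⟩
    have := hkm j (by omega)
    push Not at this
    exact ⟨j, by omega, this (by omega), hk2⟩
  obtain ⟨⟨_, ⟨j1, s1, s2, s3⟩⟩, _⟩ := hJ2 j hj
  have g1 := abs_le.1 (hgood j hj)
  have g2 := abs_le.1 (hgood (j+1) (by omega))
  have hNn : N ≤ n (j+1) := by
    by_contra hcon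
    push Not at hcon
    have := hPm hcon.le
    linarith [hn1 (j+1)]
  have hD1 : ∀ i : ℕ, exp (-(log i)^(p*κ)) ≤ 1 := fun i =>
    exp_le_one_iff.2 (neg_nonpos.2 (rpow_nonneg (hlog0 i) _))
  have hmain := det_step (P N) (y j) (y (j+1)) (exp (-(log ((j+1:ℕ):ℝ))^(p*κ))) (exp (-(log j)^(p*κ)))
    (P (n j)) (P (n (j+1))) (F (n j) ω) (F (n (j+1)) ω) (F N ω) (hy1 j) hjN hjN2.le (exp_pos _).le (hD1 (j+1))
    (exp_pos _).le (hD1 j) s3 s1 s2 (hn1 j) (hn2 (j+1)) (by linarith only [g1.1]) (by linarith only [g2.2]) (hF ω (hn3 j N hjN)) (hF ω hNn)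
  refine hmain.trans ?_
  have hPpos : 0 < P N := by linarith [hy1 j]
  gcongr
  rw [rpow_mul (hlog0 _), ← hly]
  exact rpow_le_rpow (Real.log_nonneg ((hy1 j).trans hjN)) (log_le_log hPpos hjN2.le) hκ.le

end

/-- **Improved error term for quantitative metric approximations**:
`S(N,α) = Ψ(N)(1 + O_{ε,α}(exp(-(log Ψ(N))^{1/2-ε})))` for almost every `α`. -/
theorem quantitative_duffin_schaeffer_improved (ψ : ℕ → ℝ)
    (hψ : ∀ n, ψ n ∈ Set.Icc (0:ℝ) (1/2))
    (hdiv : ¬ Summable (fun n : ℕ => ψ n * (Nat.totient n : ℝ) / n))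
    (ε : ℝ) (hε : 0 < ε) :
    ∀ᵐ α ∂(volume.restrict (Set.Icc (0:ℝ) 1)),
      ∃ C : ℝ, 0 < C ∧ ∀ᶠ N : ℕ in atTop,
        |(S ψ N α : ℝ) - Psi ψ N| ≤
          C * Psi ψ N * Real.exp (-(Real.log (Psi ψ N)) ^ ((1:ℝ)/2 - ε)) := by
  have h0 : ∀ n, 0 ≤ ψ n := fun n => (hψ n).1
  have h2 : ∀ n, ψ n ≤ 1/2 := fun n => (hψ n).2
  have hm0 : ∀ n, 0 ≤ muw ψ n := muw_nonneg ψ h0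
  have hm1 : ∀ n, 2 * muw ψ n ≤ 1 := by
    intro n
    unfold muw
    rcases Nat.eq_zero_or_pos n with h | h
    · subst h; simp
    · have hn : (0:ℝ) < n := by exact_mod_cast h
      have ht : (Nat.totient n : ℝ) ≤ n := by exact_mod_cast Nat.totient_le n
      have : (Nat.totient n : ℝ) * ψ n / n ≤ 1/2 := by
        rw [div_le_iff₀ hn]
        calc _ ≤ (n:ℝ) * (1/2) := by gcongr; exacts [h0 n, h2 n]
          _ = _ := by ring
      linarith
  have hsucc : ∀ N, Psi ψ (N+1) = Psi ψ N + 2 * muw ψ (N+1) := by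
    intro N
    rw [Psi_muw, Psi_muw, Finset.sum_Icc_succ_top (by omega)]; ring
  have hmono : Monotone (Psi ψ) := monotone_nat_of_le_succ fun N => by rw [hsucc]; linarith [hm0 (N+1)]
  have hP0 : Psi ψ 0 = 0 := by simp [Psi]
  have htend : Tendsto (Psi ψ) atTop atTop := by
    have e : (fun n : ℕ => ψ n * (Nat.totient n : ℝ) / n) = muw ψ := by ext n; unfold muw; ring
    rw [e, not_summable_iff_tendsto_nat_atTop_of_nonneg hm0] at hdiv
    have e2 : ∀ N, Psi ψ N = 2 * ∑ i ∈ Finset.range (N+1), muw ψ i := by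
      intro N
      induction N with
      | zero => simp [hP0, muw]
      | succ k ih => rw [hsucc, ih, Finset.sum_range_succ _ (k+1)]; ring
    have : Psi ψ = fun N => 2 * ∑ i ∈ Finset.range (N+1), muw ψ i := funext e2
    rw [this]
    exact (hdiv.comp (tendsto_add_atTop_nat 1)).const_mul_atTop (by norm_num)
  set κ := max (1/2 - ε) (1/4) with hκ
  have hκ0 : 0 < κ := lt_of_lt_of_le (by norm_num) (le_max_right _ _)
  have hκ2 : κ < 1/2 := max_lt (by linarith) (by norm_num)
  set κ2 := (κ + 1/2)/2 with hκ2'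
  obtain ⟨Y0, hY0, hV⟩ := varF κ2 (by linarith) (by linarith) ψ h0 h2
  have hFm : ∀ α, Monotone (fun N => FF ψ N α) := fun α => monotone_nat_of_le_succ fun N => by
    unfold FF
    rw [Finset.sum_Icc_succ_top (by omega)]
    have : 0 ≤ ∑ a ∈ Un (N+1), fI ψ (N+1) a α := Finset.sum_nonneg fun a _ => fI_nonneg ψ _ a α
    linarith
  have hae := ae_abs (volume.restrict (Set.Icc (0:ℝ) 1)) (FF ψ) (Psi ψ) hFm hP0 (fun N => by rw [hsucc]; linarith [hm1 (N+1)]) hmono htend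
    κ κ2 hκ0 (by linarith) (by linarith) Y0 (fun N => var_int ψ N _) hV
  filter_upwards [hae, ae_restrict_mem measurableSet_Icc] with α hα hα01
  refine ⟨6, by norm_num, ?_⟩
  have hlog : Tendsto (fun N => Real.log (Psi ψ N)) atTop atTop := Real.tendsto_log_atTop.comp htend
  filter_upwards [hα, htend.eventually_ge_atTop 1, hlog.eventually_ge_atTop 1] with N hN hN1 hN2
  have hSF := S_FF ψ h2 N α hα01.1 hα01.2
  set P := Psi ψ N
  set u := Real.log P
  have hE : Real.exp (-u^κ) ≤ Real.exp (-u^((1:ℝ)/2-ε)) :=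
    Real.exp_le_exp.2 (neg_le_neg (Real.rpow_le_rpow_of_exponent_le hN2 (le_max_left _ _)))
  have h1 : 1 ≤ P * Real.exp (-u^κ) := by
    have hPe : P = Real.exp u := (Real.exp_log (by linarith)).symm
    rw [hPe, ← Real.exp_add]
    apply Real.one_le_exp
    have : u^κ ≤ u^(1:ℝ) := Real.rpow_le_rpow_of_exponent_le hN2 (by linarith)
    rw [Real.rpow_one] at this
    linarith only [this]
  calc |(S ψ N α : ℝ) - P| ≤ |(S ψ N α : ℝ) - FF ψ N α| + |FF ψ N α - P| := abs_sub_le _ _ _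
    _ ≤ 6 * P * Real.exp (-u^κ) := by linarith
    _ ≤ _ := by gcongr
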